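/- arXiv:1303.1789 — 4 statements merged into one kernel-verified Lean document; each statement's English description precedes it below -/
import Mathlib

section
/- Let n = 3 (so q = 6), let k ≥ 2, β_k > 0, and suppose p(x) = p₀ + β_k|x−a|^k on cl(Ω) with p₀ > 0. Fix R > 0 with cl(B(a,R)) ⊂ Ω and define, for ζ in the class H_R of smooth functions ζ : [0,∞) → [0,1] with ζ ≡ 1 on [0,R/2] and ζ ≡ 0 on [R,∞), D(k,ζ) = ( ∫₀^R (p₀ + β_k r^k) ζ'(r)² dr + kβ_k ∫₀^R ζ(r)² r^{k−2} dr ) / ∫₀^R ζ(r)² dr, and γ(k) = inf_{ζ ∈ H_R} D(k,ζ). Then γ(k) > 0, and for every λ > γ(k) one has S_λ(p) < p₀·S. -/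
open MeasureTheory Filter Asymptotics
open scoped Topology

noncomputable section

/-- Euclidean space `ℝⁿ`. -/
abbrev Euc (n : ℕ) := EuclideanSpace ℝ (Fin n)

/-- `u ∈ C_c^∞(Ω)`, `u ≢ 0`. -/
def IsTest {n : ℕ} (Ω : Set (Euc n)) (u : Euc n → ℝ) : Prop :=
  ContDiff ℝ (⊤ : ℕ∞) u ∧ HasCompactSupport u ∧ tsupport u ⊆ Ω ∧ u ≠ 0

/-- The best Sobolev constant
`S = inf { ∫_Ω |∇u|² / (∫_Ω |u|^q)^{2/q} : u ∈ C_c^∞(Ω), u ≢ 0 }`. -/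
def SobolevS {n : ℕ} (Ω : Set (Euc n)) (q : ℝ) : ℝ :=
  sInf {r : ℝ | ∃ u : Euc n → ℝ, IsTest Ω u ∧
    r = (∫ x in Ω, ‖gradient u x‖ ^ 2) / (∫ x in Ω, |u x| ^ q) ^ (2 / q)}

/-- `S_λ(p) = inf { (∫_Ω p|∇u|² - λ∫_Ω u²) / (∫_Ω |u|^q)^{2/q} : u ∈ C_c^∞(Ω), u ≢ 0 }`. -/
def Slam {n : ℕ} (Ω : Set (Euc n)) (p : Euc n → ℝ) (q lam : ℝ) : ℝ :=
  sInf {r : ℝ | ∃ u : Euc n → ℝ, IsTest Ω u ∧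
    r = ((∫ x in Ω, p x * ‖gradient u x‖ ^ 2) - lam * ∫ x in Ω, (u x) ^ 2) /
        (∫ x in Ω, |u x| ^ q) ^ (2 / q)}

/-- A strictly increasing `C¹` function with limits `∓c` at `∓∞` has a `C¹` inverse on `(-c, c)`. -/
theorem exists_inverse_of_deriv_pos {Φ ψ : ℝ → ℝ} {c : ℝ} (hΦ : ∀ t, HasDerivAt Φ (ψ t) t)
    (hψ : ∀ t, 0 < ψ t) (hbot : Tendsto Φ atBot (𝓝 (-c))) (htop : Tendsto Φ atTop (𝓝 c)) :
    ∃ Ψ : ℝ → ℝ, (∀ y ∈ Set.Ioo (-c) c, Φ (Ψ y) = y) ∧ (∀ t, Ψ (Φ t) = t) ∧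
      (∀ t, Φ t ∈ Set.Ioo (-c) c) ∧
      ∀ y ∈ Set.Ioo (-c) c, HasDerivAt Ψ (ψ (Ψ y))⁻¹ y := by
  have hmono : StrictMono Φ := strictMono_of_deriv_pos fun t => by rw [(hΦ t).deriv]; exact hψ t
  have hcont : Continuous Φ := continuous_iff_continuousAt.2 fun t => (hΦ t).continuousAt
  have hmem : ∀ t, Φ t ∈ Set.Ioo (-c) c := fun t =>
    ⟨(hmono.monotone.le_of_tendsto hbot (t - 1)).trans_lt (hmono (by linarith)),
      (hmono (by linarith)).trans_le (hmono.monotone.ge_of_tendsto htop (t + 1))⟩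
  have hsurj : ∀ y ∈ Set.Ioo (-c) c, ∃ t, Φ t = y := fun y hy =>
    mem_range_of_exists_le_of_exists_ge hcont
      ((hbot.eventually_le_const hy.1).exists)
      ((htop.eventually_const_le hy.2).exists)
  have hrange : Set.range Φ = Set.Ioo (-c) c := by
    ext y
    exact ⟨fun ⟨t, ht⟩ => ht ▸ hmem t, hsurj y⟩
  have hleft : ∀ t, Function.invFun Φ (Φ t) = t := Function.leftInverse_invFun hmono.injective
  have hright : ∀ y ∈ Set.Ioo (-c) c, Φ (Function.invFun Φ y) = y := fun y hy =>
    Function.invFun_eq (hsurj y hy)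
  have hemb : Topology.IsOpenEmbedding Φ :=
    ⟨hmono.isEmbedding_of_ordConnected (hrange ▸ Set.ordConnected_Ioo), hrange ▸ isOpen_Ioo⟩
  refine ⟨Function.invFun Φ, hright, hleft, hmem, fun y hy => ?_⟩
  refine HasDerivAt.of_local_left_inverse ?_ (hΦ _) (hψ _).ne' ?_
  · obtain ⟨t, rfl⟩ := hsurj y hy
    rw [ContinuousAt, ← hemb.map_nhds_eq, tendsto_map'_iff]
    simp only [Function.comp_def, hleft]
    exact tendsto_id
  · filter_upwards [isOpen_Ioo.mem_nhds hy] with z hz using hright z hz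

theorem integrable_const_mul_inv_one_add_sq (B : ℝ) :
    Integrable fun s : ℝ => B * (1 + s ^ 2)⁻¹ :=
  integrable_inv_one_add_sq.const_mul B

/-- Continuity of the marginal of a dominated continuous function. -/
theorem continuous_integral_of_le {X : Type*} [TopologicalSpace X] [FirstCountableTopology X]
    {F : X → ℝ → ℝ} (hc : Continuous (Function.uncurry F)) (hpos : ∀ x s, 0 < F x s) {B : ℝ}
    (hB : ∀ x s, F x s ≤ B * (1 + s ^ 2)⁻¹) (A : Set ℝ) :
    Continuous fun x => ∫ s in A, F x s := by
  refine continuous_of_dominated (bound := fun s => B * (1 + s ^ 2)⁻¹) (fun x => ?_) (fun x => ?_)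
    (integrable_const_mul_inv_one_add_sq B).integrableOn (ae_of_all _ fun s => ?_)
  · exact (hc.comp (by fun_prop : Continuous fun s => (x, s))).aestronglyMeasurable
  · exact ae_of_all _ fun s => by rw [Real.norm_of_nonneg (hpos x s).le]; exact hB x s
  · exact hc.comp (by fun_prop : Continuous fun x => (x, s))

theorem integrable_of_le {X : Type*} [TopologicalSpace X]
    {F : X → ℝ → ℝ} (hc : Continuous (Function.uncurry F)) (hpos : ∀ x s, 0 < F x s) {B : ℝ}
    (hB : ∀ x s, F x s ≤ B * (1 + s ^ 2)⁻¹) (x : X) : Integrable (F x) := by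
  refine (integrable_const_mul_inv_one_add_sq B).mono'
    (hc.comp (by fun_prop : Continuous fun s => (x, s))).aestronglyMeasurable ?_
  exact ae_of_all _ fun s => by rw [Real.norm_of_nonneg (hpos x s).le]; exact hB x s

theorem integral_pos_of_le {X : Type*} [TopologicalSpace X]
    {F : X → ℝ → ℝ} (hc : Continuous (Function.uncurry F)) (hpos : ∀ x s, 0 < F x s) {B : ℝ}
    (hB : ∀ x s, F x s ≤ B * (1 + s ^ 2)⁻¹) (x : X) : 0 < ∫ s, F x s := by
  rw [integral_pos_iff_support_of_nonneg (fun s => (hpos x s).le) (integrable_of_le hc hpos hB x)]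
  have : Function.support (F x) = Set.univ := by
    ext s; simp [(hpos x s).ne']
  simp [this]

/-- Monotone transport, with parameters, of positive densities on the line onto the fixed
density `ψ`. -/
theorem exists_transport {X : Type*} [TopologicalSpace X] [FirstCountableTopology X]
    [LocallyCompactSpace X]
    {F : X → ℝ → ℝ} (hc : Continuous (Function.uncurry F)) (hpos : ∀ x s, 0 < F x s) {B : ℝ}
    (hB : ∀ x s, F x s ≤ B * (1 + s ^ 2)⁻¹) {Φ ψ : ℝ → ℝ} {c : ℝ} (hc0 : 0 < c)
    (hΦ : ∀ t, HasDerivAt Φ (ψ t) t) (hψ : ∀ t, 0 < ψ t)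
    (hbot : Tendsto Φ atBot (𝓝 (-c))) (htop : Tendsto Φ atTop (𝓝 c)) :
    ∃ t : X → ℝ → ℝ, Continuous (Function.uncurry t) ∧
      (∀ x s, HasDerivAt (t x) (2 * c * F x s / ((∫ r, F x r) * ψ (t x s))) s) ∧
      ∀ x (H : ℝ → ℝ), 2 * c * ∫ s, F x s * H (t x s) = (∫ r, F x r) * ∫ τ, H τ * ψ τ := by
  obtain ⟨Ψ, hΦΨ, hΨΦ, hmem, hΨ⟩ := exists_inverse_of_deriv_pos hΦ hψ hbot htop
  have hint := integrable_of_le hc hpos hB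
  have hmpos := integral_pos_of_le hc hpos hB
  set m : X → ℝ := fun x => ∫ r, F x r with hm
  have hmc : Continuous m := by
    simpa [hm] using continuous_integral_of_le hc hpos hB Set.univ
  have hFx : ∀ x, Continuous (F x) := fun x =>
    hc.comp (by fun_prop : Continuous fun s => (x, s))
  set G : X → ℝ → ℝ := fun x s => (∫ r in Set.Iic 0, F x r) + ∫ r in (0 : ℝ)..s, F x r with hG
  have hGc : Continuous (Function.uncurry G) := by
    refine ((continuous_integral_of_le hc hpos hB (Set.Iic 0)).comp continuous_fst).add ?_
    exact intervalIntegral.continuous_parametric_intervalIntegral_of_continuous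
      (f := fun (p : X × ℝ) r => F p.1 r)
      (hc.comp (by fun_prop : Continuous fun q : (X × ℝ) × ℝ => (q.1.1, q.2))) continuous_snd
  have hGd : ∀ x s, HasDerivAt (G x) (F x s) s := fun x s =>
    (intervalIntegral.integral_hasDerivAt_right ((hFx x).intervalIntegrable _ _)
      ((hFx x).stronglyMeasurableAtFilter _ _) (hFx x).continuousAt).const_add _
  have hGtop : ∀ x, Tendsto (G x) atTop (𝓝 (m x)) := fun x => by
    have h := intervalIntegral_tendsto_integral_Ioi 0 (hint x).integrableOn tendsto_id
    have h2 : m x = (∫ r in Set.Iic 0, F x r) + ∫ r in Set.Ioi 0, F x r :=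
      (intervalIntegral.integral_Iic_add_Ioi (hint x).integrableOn (hint x).integrableOn).symm
    rw [h2]
    exact h.const_add _
  have hGbot : ∀ x, Tendsto (G x) atBot (𝓝 0) := fun x => by
    have h := intervalIntegral_tendsto_integral_Iic 0 (hint x).integrableOn tendsto_id
    have h2 := h.const_sub (∫ r in Set.Iic 0, F x r)
    rw [sub_self] at h2
    refine h2.congr fun s => ?_
    rw [hG]
    simp only [id]
    rw [intervalIntegral.integral_symm s 0]
    ring
  set Y : X → ℝ → ℝ := fun x s => -c + 2 * c * (G x s / m x) with hY
  have hYd : ∀ x s, HasDerivAt (Y x) (2 * c * (F x s / m x)) s := fun x s =>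
    (((hGd x s).div_const _).const_mul _).const_add _
  have hYc : Continuous (Function.uncurry Y) := by
    refine continuous_const.add (continuous_const.mul (hGc.div (hmc.comp continuous_fst) ?_))
    exact fun p => (hmpos p.1).ne'
  have hYmono : ∀ x, StrictMono (Y x) := fun x => strictMono_of_deriv_pos fun s => by
    rw [(hYd x s).deriv]
    have := hpos x s
    have := hmpos x
    positivity
  have hYtop : ∀ x, Tendsto (Y x) atTop (𝓝 c) := fun x => by
    have h := (((hGtop x).div_const (m x)).const_mul (2 * c)).const_add (-c)
    rwa [div_self (hmpos x).ne', show -c + 2 * c * 1 = c by ring] at h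
  have hYbot : ∀ x, Tendsto (Y x) atBot (𝓝 (-c)) := fun x => by
    have h := (((hGbot x).div_const (m x)).const_mul (2 * c)).const_add (-c)
    rwa [zero_div, mul_zero, add_zero] at h
  have hYmem : ∀ x s, Y x s ∈ Set.Ioo (-c) c := fun x s =>
    ⟨((hYmono x).monotone.le_of_tendsto (hYbot x) (s - 1)).trans_lt (hYmono x (by linarith)),
      (hYmono x (by linarith)).trans_le ((hYmono x).monotone.ge_of_tendsto (hYtop x) (s + 1))⟩
  have hd : ∀ x s, HasDerivAt (fun s => Ψ (Y x s))
      (2 * c * F x s / (m x * ψ (Ψ (Y x s)))) s := fun x s => by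
    have h := (hΨ _ (hYmem x s)).comp s (hYd x s)
    refine h.congr_deriv ?_
    have := (hψ (Ψ (Y x s))).ne'
    have := (hmpos x).ne'
    field_simp
  refine ⟨fun x s => Ψ (Y x s), ?_, hd, fun x H => ?_⟩
  · refine continuous_iff_continuousAt.2 fun p => ?_
    exact (hΨ _ (hYmem p.1 p.2)).continuousAt.comp_of_eq hYc.continuousAt rfl
  · have hinj : Function.Injective fun s => Ψ (Y x s) := fun a b hab => by
      have := congrArg Φ hab
      simp only [hΦΨ _ (hYmem x a), hΦΨ _ (hYmem x b)] at this
      exact (hYmono x).injective this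
    have hsurj : Function.Surjective fun s => Ψ (Y x s) := fun τ => by
      have hYcx : Continuous (Y x) := hYc.comp (by fun_prop : Continuous fun s => (x, s))
      obtain ⟨s, hs⟩ := mem_range_of_exists_le_of_exists_ge hYcx
        (((hYbot x).eventually_le_const (hmem τ).1).exists)
        (((hYtop x).eventually_const_le (hmem τ).2).exists)
      exact ⟨s, by simp only [hs, hΨΦ]⟩
    have h := integral_image_eq_integral_abs_deriv_smul MeasurableSet.univ
      (fun s _ => (hd x s).hasDerivWithinAt) hinj.injOn (fun τ => H τ * ψ τ)
    rw [Set.image_univ, hsurj.range_eq, setIntegral_univ, setIntegral_univ] at h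
    rw [h, ← integral_const_mul, ← integral_const_mul]
    congr 1
    ext s
    have h1 := (hψ (Ψ (Y x s)))
    have h2 := (hmpos x)
    have h3 := hpos x s
    rw [abs_of_pos (by positivity), smul_eq_mul]
    field_simp
    rw [mul_div_assoc, div_self h2.ne', mul_one]

theorem tendsto_one_add_sq_inv_atTop : Tendsto (fun t : ℝ => (1 + t ^ 2)⁻¹) atTop (𝓝 0) :=
  tendsto_inv_atTop_zero.comp
    (tendsto_atTop_add_const_left _ _ (tendsto_pow_atTop two_ne_zero))

theorem tendsto_div_one_add_sq_atTop : Tendsto (fun t : ℝ => t / (1 + t ^ 2)) atTop (𝓝 0) := by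
  refine squeeze_zero' ?_ ?_ tendsto_inv_atTop_zero
  · filter_upwards [eventually_gt_atTop 0] with t ht using by positivity
  · filter_upwards [eventually_gt_atTop 0] with t ht
    rw [div_le_iff₀ (by positivity)]
    field_simp
    linarith

theorem tendsto_div_sqrt_one_add_sq_atTop :
    Tendsto (fun t : ℝ => t / √(1 + t ^ 2)) atTop (𝓝 1) := by
  have h := (tendsto_one_add_sq_inv_atTop.const_sub 1).sqrt
  rw [sub_zero, Real.sqrt_one] at h
  refine h.congr' ?_
  filter_upwards [eventually_gt_atTop 0] with t ht
  rw [show (1 : ℝ) - (1 + t ^ 2)⁻¹ = t ^ 2 / (1 + t ^ 2) by field_simp; ring,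
    Real.sqrt_div (by positivity), Real.sqrt_sq ht.le]

theorem tendsto_atBot_of_odd {Φ : ℝ → ℝ} {c : ℝ} (hodd : ∀ t, Φ (-t) = -Φ t)
    (h : Tendsto Φ atTop (𝓝 c)) : Tendsto Φ atBot (𝓝 (-c)) := by
  refine ((h.comp tendsto_neg_atBot_atTop).neg).congr fun t => ?_
  simp [hodd]

theorem hasDerivAt_div_one_add_sq_pow (m : ℕ) (t : ℝ) :
    HasDerivAt (fun t : ℝ => t / (1 + t ^ 2) ^ (m + 1))
      ((1 + t ^ 2 - 2 * (m + 1) * t ^ 2) / (1 + t ^ 2) ^ (m + 2)) t := by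
  have h0 : (1 + t ^ 2) ≠ 0 := by positivity
  have h1 := (((hasDerivAt_id' t).pow 2).const_add 1).pow (m + 1)
  have h := (hasDerivAt_id' t).div h1 (by simp only [Pi.pow_apply]; positivity)
  refine h.congr_deriv ?_
  simp only [Pi.pow_apply]
  push_cast
  field_simp
  ring

theorem hasDerivAt_div_sqrt_one_add_sq (t : ℝ) :
    HasDerivAt (fun t : ℝ => t / √(1 + t ^ 2)) (((1 + t ^ 2) * √(1 + t ^ 2))⁻¹) t := by
  have h0 : 0 < 1 + t ^ 2 := by positivity
  have h1 := (((hasDerivAt_id' t).pow 2).const_add 1).sqrt (by simp only [Pi.pow_apply]; positivity)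
  have h := (hasDerivAt_id' t).div h1 (by simp only [Pi.pow_apply]; positivity)
  refine h.congr_deriv ?_
  simp only [Pi.pow_apply]
  have hs := Real.sq_sqrt h0.le
  have hs0 := Real.sqrt_pos.2 h0
  field_simp
  rw [hs]
  norm_num
  left
  ring

/-- The density `(1 + t²)⁻²`, its odd primitive and its total mass. -/
theorem hasDerivAt_primitive_two (t : ℝ) :
    HasDerivAt (fun t : ℝ => (Real.arctan t + t / (1 + t ^ 2)) / 2) (((1 + t ^ 2) ^ 2)⁻¹) t := by
  have h := ((Real.hasDerivAt_arctan t).add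
    (by simpa using hasDerivAt_div_one_add_sq_pow 0 t)).div_const 2
  refine h.congr_deriv ?_
  have h0 : (1 + t ^ 2) ≠ 0 := by positivity
  field_simp
  ring

theorem tendsto_primitive_two :
    Tendsto (fun t : ℝ => (Real.arctan t + t / (1 + t ^ 2)) / 2) atTop (𝓝 (Real.pi / 4)) := by
  have h := ((Real.tendsto_arctan_atTop.mono_right nhdsWithin_le_nhds).add
    tendsto_div_one_add_sq_atTop).div_const 2
  rwa [add_zero, div_div, show (2 : ℝ) * 2 = 4 by norm_num] at h

theorem hasDerivAt_primitive_five_halves (t : ℝ) :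
    HasDerivAt (fun t : ℝ => t / √(1 + t ^ 2) - (t / √(1 + t ^ 2)) ^ 3 / 3)
      (((1 + t ^ 2) ^ 2 * √(1 + t ^ 2))⁻¹) t := by
  have h := (hasDerivAt_div_sqrt_one_add_sq t).sub
    (((hasDerivAt_div_sqrt_one_add_sq t).pow 3).div_const 3)
  refine h.congr_deriv ?_
  have h0 : 0 < 1 + t ^ 2 := by positivity
  have hs := Real.sq_sqrt h0.le
  have hs0 := Real.sqrt_pos.2 h0
  have : (t / √(1 + t ^ 2)) ^ 2 = t ^ 2 / (1 + t ^ 2) := by rw [div_pow, hs]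
  norm_num only [Nat.cast_ofNat, this]
  field_simp
  ring

theorem tendsto_primitive_five_halves :
    Tendsto (fun t : ℝ => t / √(1 + t ^ 2) - (t / √(1 + t ^ 2)) ^ 3 / 3) atTop (𝓝 (2 / 3)) := by
  have h := tendsto_div_sqrt_one_add_sq_atTop.sub
    ((tendsto_div_sqrt_one_add_sq_atTop.pow 3).div_const 3)
  norm_num at h
  exact h

theorem hasDerivAt_primitive_three (t : ℝ) :
    HasDerivAt (fun t : ℝ => 3 / 8 * Real.arctan t + 3 / 8 * (t / (1 + t ^ 2)) +
      1 / 4 * (t / (1 + t ^ 2) ^ 2)) (((1 + t ^ 2) ^ 3)⁻¹) t := by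
  have h := (((Real.hasDerivAt_arctan t).const_mul (3 / 8)).add
    (HasDerivAt.const_mul (3 / 8) (by simpa using hasDerivAt_div_one_add_sq_pow 0 t))).add
    ((hasDerivAt_div_one_add_sq_pow 1 t).const_mul (1 / 4))
  refine h.congr_deriv ?_
  have h0 : (1 + t ^ 2) ≠ 0 := by positivity
  field_simp
  push_cast
  ring

theorem tendsto_primitive_three :
    Tendsto (fun t : ℝ => 3 / 8 * Real.arctan t + 3 / 8 * (t / (1 + t ^ 2)) +
      1 / 4 * (t / (1 + t ^ 2) ^ 2)) atTop (𝓝 (3 * Real.pi / 16)) := by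
  have h3 : Tendsto (fun t : ℝ => t / (1 + t ^ 2) ^ 2) atTop (𝓝 0) := by
    have := tendsto_div_one_add_sq_atTop.mul tendsto_one_add_sq_inv_atTop
    rw [mul_zero] at this
    refine this.congr fun t => ?_
    have h0 : (1 + t ^ 2) ≠ 0 := by positivity
    field_simp
  have h := (((Real.tendsto_arctan_atTop.mono_right nhdsWithin_le_nhds).const_mul (3 / 8)).add
    (tendsto_div_one_add_sq_atTop.const_mul (3 / 8))).add (h3.const_mul (1 / 4))
  rwa [mul_zero, mul_zero, add_zero, add_zero,
    show (3 : ℝ) / 8 * (Real.pi / 2) = 3 * Real.pi / 16 by ring] at h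

/-- Truncated moments converge to the full moment. -/
theorem tendsto_integral_min_mul {ψ χ : ℝ → ℝ} (hχ : ∀ t, (1 + t ^ 2) * ψ t = χ t)
    (hψ : ∀ t, 0 < ψ t) (hψc : Continuous ψ) (hint : Integrable χ) :
    Tendsto (fun K : ℕ => ∫ t, min (1 + t ^ 2) (K : ℝ) * ψ t) atTop (𝓝 (∫ t, χ t)) := by
  refine tendsto_integral_of_dominated_convergence χ (fun K => ?_) hint (fun K => ?_) ?_
  · exact (by fun_prop : Continuous fun t : ℝ => min (1 + t ^ 2) (K : ℝ) * ψ t).aestronglyMeasurable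
  · refine ae_of_all _ fun t => ?_
    have h1 : 0 ≤ min (1 + t ^ 2) (K : ℝ) := le_min (by positivity) (by positivity)
    rw [Real.norm_of_nonneg (mul_nonneg h1 (hψ t).le), ← hχ]
    exact mul_le_mul_of_nonneg_right (min_le_left _ _) (hψ t).le
  · refine ae_of_all _ fun t => tendsto_const_nhds.congr' ?_
    obtain ⟨N, hN⟩ := exists_nat_ge (1 + t ^ 2)
    filter_upwards [eventually_ge_atTop N] with K hK
    rw [min_eq_left (hN.trans (by exact_mod_cast hK)), hχ]

theorem integrable_of_le_inv_one_add_sq {χ : ℝ → ℝ} (hc : Continuous χ) (h0 : ∀ t, 0 ≤ χ t)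
    (h : ∀ t, χ t ≤ (1 + t ^ 2)⁻¹) : Integrable χ :=
  integrable_inv_one_add_sq.mono' hc.aestronglyMeasurable
    (ae_of_all _ fun t => by rw [Real.norm_of_nonneg (h0 t)]; exact h t)

theorem tendsto_moment_two :
    Tendsto (fun K : ℕ => ∫ t : ℝ, min (1 + t ^ 2) (K : ℝ) * ((1 + t ^ 2) ^ 2)⁻¹) atTop
      (𝓝 Real.pi) := by
  rw [← integral_univ_inv_one_add_sq]
  refine tendsto_integral_min_mul (fun t => ?_) (fun t => by positivity) ?_
    integrable_inv_one_add_sq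
  · have h0 : (1 + t ^ 2) ≠ 0 := by positivity
    field_simp
  · exact Continuous.inv₀ (by fun_prop) fun t => by positivity

theorem tendsto_moment_five_halves :
    Tendsto (fun K : ℕ => ∫ t : ℝ, min (1 + t ^ 2) (K : ℝ) * ((1 + t ^ 2) ^ 2 * √(1 + t ^ 2))⁻¹)
      atTop (𝓝 2) := by
  have hc : Continuous fun t : ℝ => ((1 + t ^ 2) * √(1 + t ^ 2))⁻¹ :=
    Continuous.inv₀ (by fun_prop) fun t => by positivity
  have hint : Integrable fun t : ℝ => ((1 + t ^ 2) * √(1 + t ^ 2))⁻¹ := by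
    refine integrable_of_le_inv_one_add_sq hc (fun t => by positivity) fun t => ?_
    have h1 : 1 ≤ √(1 + t ^ 2) := Real.one_le_sqrt.2 (by nlinarith)
    exact inv_anti₀ (by positivity) (by nlinarith [sq_nonneg t])
  have hval : ∫ t : ℝ, ((1 + t ^ 2) * √(1 + t ^ 2))⁻¹ = 2 := by
    rw [integral_of_hasDerivAt_of_tendsto hasDerivAt_div_sqrt_one_add_sq hint
      (tendsto_atBot_of_odd (fun t => by rw [neg_sq, neg_div]) tendsto_div_sqrt_one_add_sq_atTop)
      tendsto_div_sqrt_one_add_sq_atTop]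
    norm_num
  rw [← hval]
  refine tendsto_integral_min_mul (fun t => ?_) (fun t => by positivity) ?_ hint
  · have h0 : (1 + t ^ 2) ≠ 0 := by positivity
    field_simp
  · exact Continuous.inv₀ (by fun_prop) fun t => by positivity

theorem tendsto_moment_three :
    Tendsto (fun K : ℕ => ∫ t : ℝ, min (1 + t ^ 2) (K : ℝ) * ((1 + t ^ 2) ^ 3)⁻¹) atTop
      (𝓝 (Real.pi / 2)) := by
  have hc : Continuous fun t : ℝ => ((1 + t ^ 2) ^ 2)⁻¹ :=
    Continuous.inv₀ (by fun_prop) fun t => by positivity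
  have hint : Integrable fun t : ℝ => ((1 + t ^ 2) ^ 2)⁻¹ :=
    integrable_of_le_inv_one_add_sq hc (fun t => by positivity) fun t =>
      inv_anti₀ (by positivity) (by nlinarith [sq_nonneg t])
  have hval : ∫ t : ℝ, ((1 + t ^ 2) ^ 2)⁻¹ = Real.pi / 2 := by
    rw [integral_of_hasDerivAt_of_tendsto hasDerivAt_primitive_two hint
      (tendsto_atBot_of_odd (fun t => by rw [neg_sq, neg_div, Real.arctan_neg]; ring)
        tendsto_primitive_two) tendsto_primitive_two]
    ring
  rw [← hval]
  refine tendsto_integral_min_mul (fun t => ?_) (fun t => by positivity) ?_ hint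
  · have h0 : (1 + t ^ 2) ≠ 0 := by positivity
    field_simp
  · exact Continuous.inv₀ (by fun_prop) fun t => by positivity

theorem integral_euclidean_three (g : (ℝ × ℝ) × ℝ → ℝ) :
    ∫ x : EuclideanSpace ℝ (Fin 3), g ((x 0, x 1), x 2) = ∫ p, g p := by
  have h1 := PiLp.volume_preserving_ofLp (Fin 3)
  have h2 := volume_preserving_piFinSuccAbove (fun _ : Fin 3 => ℝ) 2
  have h3 := volume_preserving_finTwoArrow ℝ
  have h4 : MeasurePreserving (Prod.swap : ℝ × (ℝ × ℝ) → (ℝ × ℝ) × ℝ) volume volume :=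
    Measure.measurePreserving_swap
  have h5 := h4.comp ((((MeasurePreserving.id volume).prod h3).comp h2).comp h1)
  have hemb : MeasurableEmbedding (Prod.swap : ℝ × (ℝ × ℝ) → (ℝ × ℝ) × ℝ) :=
    MeasurableEquiv.prodComm.measurableEmbedding
  have h6 := h5.integral_comp (hemb.comp
    (((MeasurableEmbedding.id.prodMap MeasurableEquiv.finTwoArrow.measurableEmbedding).comp
      (MeasurableEquiv.piFinSuccAbove (fun _ : Fin 3 => ℝ) 2).measurableEmbedding).comp
      (MeasurableEquiv.toLp 2 (Fin 3 → ℝ)).symm.measurableEmbedding)) g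
  rw [← h6]
  rfl

/-- The truncated moment appearing in the triangular transport. -/
def truncMoment (K : ℕ) (ψ : ℝ → ℝ) : ℝ := ∫ t, min (1 + t ^ 2) (K : ℝ) * ψ t

theorem integrable_inv_one_add_sq_prod :
    Integrable fun p : ℝ × ℝ => (1 + p.1 ^ 2)⁻¹ * (1 + p.2 ^ 2)⁻¹ :=
  integrable_inv_one_add_sq.mul_prod integrable_inv_one_add_sq

theorem integrable_inv_one_add_sq_prod_prod :
    Integrable fun p : (ℝ × ℝ) × ℝ => (1 + p.1.1 ^ 2)⁻¹ * (1 + p.1.2 ^ 2)⁻¹ * (1 + p.2 ^ 2)⁻¹ :=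
  integrable_inv_one_add_sq_prod.mul_prod integrable_inv_one_add_sq

theorem min_one_add_sq_nonneg (K : ℕ) (t : ℝ) : 0 ≤ min (1 + t ^ 2) (K : ℝ) :=
  le_min (by positivity) (by positivity)

theorem exists_triangular_transport {F : (ℝ × ℝ) × ℝ → ℝ} (hc : Continuous F)
    (hpos : ∀ p, 0 < F p) {B : ℝ}
    (hB : ∀ p, F p ≤ B * ((1 + p.1.1 ^ 2)⁻¹ * (1 + p.1.2 ^ 2)⁻¹ * (1 + p.2 ^ 2)⁻¹)) :
    Integrable F ∧ 0 < (∫ p, F p) ∧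
    ∃ (t₁ d₁ : ℝ → ℝ) (t₂ d₂ : ℝ × ℝ → ℝ) (t₃ d₃ : (ℝ × ℝ) × ℝ → ℝ),
      Continuous t₁ ∧ Continuous d₁ ∧ Continuous t₂ ∧ Continuous d₂ ∧ Continuous t₃ ∧
      Continuous d₃ ∧ (∀ a, 0 < d₁ a) ∧ (∀ a, 0 < d₂ a) ∧ (∀ a, 0 < d₃ a) ∧
      (∀ a, HasDerivAt t₁ (d₁ a) a) ∧
      (∀ a b, HasDerivAt (fun b => t₂ (a, b)) (d₂ (a, b)) b) ∧
      (∀ p c, HasDerivAt (fun c => t₃ (p, c)) (d₃ (p, c)) c) ∧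
      (∀ p, d₁ p.1.1 * d₂ p.1 * d₃ p = Real.pi ^ 2 / 4 * (F p / ∫ p, F p) *
        ((1 + t₁ p.1.1 ^ 2) ^ 2 * ((1 + t₂ p.1 ^ 2) ^ 2 * √(1 + t₂ p.1 ^ 2)) *
          (1 + t₃ p ^ 2) ^ 3)) ∧
      ∀ K : ℕ, Real.pi ^ 2 / 4 * ∫ p, F p * (min (1 + t₁ p.1.1 ^ 2) (K : ℝ) *
          min (1 + t₂ p.1 ^ 2) (K : ℝ) * min (1 + t₃ p ^ 2) (K : ℝ)) =
        (∫ p, F p) * (truncMoment K (fun t => ((1 + t ^ 2) ^ 2)⁻¹) *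
          truncMoment K (fun t => ((1 + t ^ 2) ^ 2 * √(1 + t ^ 2))⁻¹) *
          truncMoment K (fun t => ((1 + t ^ 2) ^ 3)⁻¹)) := by
  have hB0 : 0 ≤ B := by
    have h := (hpos ((0, 0), 0)).le.trans (hB ((0, 0), 0))
    simpa using h
  have hle1 : ∀ t : ℝ, (1 + t ^ 2)⁻¹ ≤ 1 := fun t => inv_le_one_of_one_le₀ (by nlinarith)
  have hp1 : ∀ t : ℝ, 0 < (1 + t ^ 2)⁻¹ := fun t => by positivity
  have hpi := Real.pi_pos
  have hint : Integrable F := (integrable_inv_one_add_sq_prod_prod.const_mul B).mono'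
    hc.aestronglyMeasurable (ae_of_all _ fun p => by
      rw [Real.norm_of_nonneg (hpos p).le]; exact hB p)
  -- the last coordinate
  have hc3 : Continuous (Function.uncurry fun (p : ℝ × ℝ) s => F (p, s)) := hc
  have hpos3 : ∀ (p : ℝ × ℝ) s, 0 < F (p, s) := fun p s => hpos _
  have hB3 : ∀ (p : ℝ × ℝ) s, F (p, s) ≤ B * (1 + s ^ 2)⁻¹ := fun p s => by
    refine (hB (p, s)).trans (mul_le_mul_of_nonneg_left ?_ hB0)
    refine mul_le_of_le_one_left (hp1 _).le ?_
    exact mul_le_one₀ (hle1 _) (hp1 _).le (hle1 _)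
  obtain ⟨t₃, ht3c, ht3d, ht3i⟩ := exists_transport hc3 hpos3 hB3
    (show 0 < 3 * Real.pi / 16 by positivity) hasDerivAt_primitive_three
    (fun t => by positivity) (tendsto_atBot_of_odd
      (fun t => by rw [neg_sq, neg_div, neg_div, Real.arctan_neg]; ring) tendsto_primitive_three)
    tendsto_primitive_three
  set m₂ : ℝ × ℝ → ℝ := fun p => ∫ s, F (p, s) with hm2
  have hm2c : Continuous m₂ := by
    simpa using continuous_integral_of_le hc3 hpos3 hB3 Set.univ
  have hm2pos : ∀ p, 0 < m₂ p := integral_pos_of_le hc3 hpos3 hB3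
  have hm2le : ∀ p, m₂ p ≤ B * Real.pi * ((1 + p.1 ^ 2)⁻¹ * (1 + p.2 ^ 2)⁻¹) := fun p => by
    calc m₂ p ≤ ∫ s, (B * ((1 + p.1 ^ 2)⁻¹ * (1 + p.2 ^ 2)⁻¹)) * (1 + s ^ 2)⁻¹ :=
          integral_mono (integrable_of_le hc3 hpos3 hB3 p)
            (integrable_const_mul_inv_one_add_sq _) fun s => (hB (p, s)).trans_eq (by ring)
      _ = _ := by rw [integral_const_mul, integral_univ_inv_one_add_sq]; ring
  -- the middle coordinate
  have hc2 : Continuous (Function.uncurry fun a b : ℝ => m₂ (a, b)) := hm2c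
  have hpos2 : ∀ a b : ℝ, 0 < m₂ (a, b) := fun a b => hm2pos _
  have hB2 : ∀ a b : ℝ, m₂ (a, b) ≤ B * Real.pi * (1 + b ^ 2)⁻¹ := fun a b => by
    refine (hm2le (a, b)).trans (mul_le_mul_of_nonneg_left ?_ (by positivity))
    exact mul_le_of_le_one_left (hp1 _).le (hle1 _)
  obtain ⟨t₂, ht2c, ht2d, ht2i⟩ := exists_transport hc2 hpos2 hB2
    (show (0 : ℝ) < 2 / 3 by positivity) hasDerivAt_primitive_five_halves
    (fun t => by positivity) (tendsto_atBot_of_odd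
      (fun t => by rw [neg_sq, neg_div]; ring) tendsto_primitive_five_halves)
    tendsto_primitive_five_halves
  set m₁ : ℝ → ℝ := fun a => ∫ b, m₂ (a, b) with hm1
  have hm1c : Continuous m₁ := by
    simpa using continuous_integral_of_le hc2 hpos2 hB2 Set.univ
  have hm1pos : ∀ a, 0 < m₁ a := integral_pos_of_le hc2 hpos2 hB2
  have hm1le : ∀ a, m₁ a ≤ B * Real.pi * Real.pi * (1 + a ^ 2)⁻¹ := fun a => by
    calc m₁ a ≤ ∫ s, (B * Real.pi * (1 + a ^ 2)⁻¹) * (1 + s ^ 2)⁻¹ :=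
          integral_mono (integrable_of_le hc2 hpos2 hB2 a)
            (integrable_const_mul_inv_one_add_sq _) fun s => (hm2le (a, s)).trans_eq (by ring)
      _ = _ := by rw [integral_const_mul, integral_univ_inv_one_add_sq]; ring
  -- the first coordinate
  have hc1 : Continuous (Function.uncurry fun (_ : Unit) a => m₁ a) := hm1c.comp continuous_snd
  obtain ⟨t₁, ht1c, ht1d, ht1i⟩ := exists_transport hc1 (fun _ a => hm1pos a) (fun _ a => hm1le a)
    (show (0 : ℝ) < Real.pi / 4 by positivity) hasDerivAt_primitive_two
    (fun t => by positivity) (tendsto_atBot_of_odd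
      (fun t => by rw [neg_sq, neg_div, Real.arctan_neg]; ring) tendsto_primitive_two)
    tendsto_primitive_two
  have hMpos := integral_pos_of_le hc1 (fun _ a => hm1pos a) (fun _ a => hm1le a) ()
  have hm2int : Integrable m₂ := (integrable_inv_one_add_sq_prod.const_mul _).mono'
    hm2c.aestronglyMeasurable (ae_of_all _ fun p => by
      rw [Real.norm_of_nonneg (hm2pos p).le]; exact hm2le p)
  have hM : ∫ p, F p = ∫ a, m₁ a := by
    rw [Measure.volume_eq_prod, integral_prod _ hint]
    exact integral_prod _ hm2int
  rw [hM]
  have ht1c' : Continuous (t₁ ()) := ht1c.comp (by fun_prop : Continuous fun s : ℝ => ((), s))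
  have hs : ∀ t : ℝ, 0 < √(1 + t ^ 2) := fun t => Real.sqrt_pos.2 (by positivity)
  refine ⟨hint, hMpos, t₁ (), fun a => 2 * (Real.pi / 4) * m₁ a /
      ((∫ r, m₁ r) * ((1 + t₁ () a ^ 2) ^ 2)⁻¹),
    Function.uncurry t₂, fun p => 2 * (2 / 3) * m₂ p /
      (m₁ p.1 * ((1 + t₂ p.1 p.2 ^ 2) ^ 2 * √(1 + t₂ p.1 p.2 ^ 2))⁻¹),
    Function.uncurry t₃, fun p => 2 * (3 * Real.pi / 16) * F p /
      (m₂ p.1 * ((1 + t₃ p.1 p.2 ^ 2) ^ 3)⁻¹),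
    ht1c', ?_, ht2c, ?_, ht3c, ?_, fun a => ?_, fun p => ?_, fun p => ?_, ht1d (),
    fun a b => ht2d a b, fun p c => ht3d p c, fun p => ?_, fun K => ?_⟩
  · refine (by fun_prop : Continuous _).div ?_ fun a => by positivity
    exact continuous_const.mul (Continuous.inv₀ (by fun_prop) fun a => by positivity)
  · have ht2c' : Continuous fun p : ℝ × ℝ => t₂ p.1 p.2 := ht2c
    refine (by fun_prop : Continuous _).div ?_ fun p => ?_
    · refine (hm1c.comp continuous_fst).mul (Continuous.inv₀ (by fun_prop) fun a => ?_)
      have := hs (t₂ a.1 a.2)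
      positivity
    · have := hs (t₂ p.1 p.2)
      have := hm1pos p.1
      positivity
  · have ht3c' : Continuous fun p : (ℝ × ℝ) × ℝ => t₃ p.1 p.2 := ht3c
    refine (by fun_prop : Continuous _).div ?_ fun p => ?_
    · exact (hm2c.comp continuous_fst).mul (Continuous.inv₀ (by fun_prop) fun a => by positivity)
    · have := hm2pos p.1
      positivity
  · have := hm1pos a
    positivity
  · have := hm1pos p.1
    have := hm2pos p
    have := hs (t₂ p.1 p.2)
    positivity
  · have := hm2pos p.1
    have := hpos p
    positivity
  · have h1 := hm1pos p.1.1
    have h2 := hm2pos p.1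
    have h3 := hs (t₂ p.1.1 p.1.2)
    simp only [Function.uncurry]
    field_simp
    ring
  · simp only [Function.uncurry]
    have ht2c' : Continuous fun p : ℝ × ℝ => t₂ p.1 p.2 := ht2c
    have ht3c' : Continuous fun p : (ℝ × ℝ) × ℝ => t₃ p.1 p.2 := ht3c
    have hK0 := min_one_add_sq_nonneg K
    have hKle : ∀ t : ℝ, min (1 + t ^ 2) (K : ℝ) ≤ K := fun t => min_le_right _ _
    have hi3 : Integrable fun p : (ℝ × ℝ) × ℝ => F p * (min (1 + t₁ () p.1.1 ^ 2) (K : ℝ) *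
        min (1 + t₂ p.1.1 p.1.2 ^ 2) (K : ℝ) * min (1 + t₃ p.1 p.2 ^ 2) (K : ℝ)) := by
      refine (hint.mul_const ((K : ℝ) * K * K)).mono' (by fun_prop) (ae_of_all _ fun p => ?_)
      have := hK0 (t₁ () p.1.1)
      have := hK0 (t₂ p.1.1 p.1.2)
      have := hK0 (t₃ p.1 p.2)
      have := (hpos p).le
      rw [Real.norm_of_nonneg (by positivity)]
      gcongr <;> exact hKle _
    have hi2 : Integrable fun p : ℝ × ℝ => m₂ p * (min (1 + t₁ () p.1 ^ 2) (K : ℝ) *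
        min (1 + t₂ p.1 p.2 ^ 2) (K : ℝ)) := by
      refine (hm2int.mul_const ((K : ℝ) * K)).mono' (by fun_prop) (ae_of_all _ fun p => ?_)
      have := hK0 (t₁ () p.1)
      have := hK0 (t₂ p.1 p.2)
      have := (hm2pos p).le
      rw [Real.norm_of_nonneg (by positivity)]
      gcongr <;> exact hKle _
    have e3 : 2 * (3 * Real.pi / 16) * ∫ p : (ℝ × ℝ) × ℝ, F p * (min (1 + t₁ () p.1.1 ^ 2) (K : ℝ) *
        min (1 + t₂ p.1.1 p.1.2 ^ 2) (K : ℝ) * min (1 + t₃ p.1 p.2 ^ 2) (K : ℝ)) =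
        (∫ p : ℝ × ℝ, m₂ p * (min (1 + t₁ () p.1 ^ 2) (K : ℝ) *
        min (1 + t₂ p.1 p.2 ^ 2) (K : ℝ))) * truncMoment K (fun t => ((1 + t ^ 2) ^ 3)⁻¹) := by
      rw [Measure.volume_eq_prod, integral_prod _ hi3, ← integral_const_mul, ← integral_mul_const]
      congr 1
      ext p
      have h := ht3i p (fun t => min (1 + t ^ 2) (K : ℝ))
      calc _ = (min (1 + t₁ () p.1 ^ 2) (K : ℝ) * min (1 + t₂ p.1 p.2 ^ 2) (K : ℝ)) *
            (2 * (3 * Real.pi / 16) * ∫ s, F (p, s) * min (1 + t₃ p s ^ 2) (K : ℝ)) := by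
            rw [← integral_const_mul, ← integral_const_mul, ← integral_const_mul]
            congr 1
            ext s
            ring
        _ = _ := by rw [h, truncMoment]; ring
    have e2 : 2 * (2 / 3) * ∫ p : ℝ × ℝ, m₂ p * (min (1 + t₁ () p.1 ^ 2) (K : ℝ) *
        min (1 + t₂ p.1 p.2 ^ 2) (K : ℝ)) = (∫ a, m₁ a * min (1 + t₁ () a ^ 2) (K : ℝ)) *
        truncMoment K (fun t => ((1 + t ^ 2) ^ 2 * √(1 + t ^ 2))⁻¹) := by
      rw [Measure.volume_eq_prod, integral_prod _ hi2, ← integral_const_mul, ← integral_mul_const]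
      congr 1
      ext a
      have h := ht2i a (fun t => min (1 + t ^ 2) (K : ℝ))
      calc _ = min (1 + t₁ () a ^ 2) (K : ℝ) *
            (2 * (2 / 3) * ∫ b, m₂ (a, b) * min (1 + t₂ a b ^ 2) (K : ℝ)) := by
            rw [← integral_const_mul, ← integral_const_mul, ← integral_const_mul]
            congr 1
            ext s
            ring
        _ = _ := by rw [h, truncMoment]; ring
    have e1 := ht1i () (fun t => min (1 + t ^ 2) (K : ℝ))
    calc _ = (2 * (Real.pi / 4)) * (2 * (2 / 3)) * (2 * (3 * Real.pi / 16) *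
          ∫ p : (ℝ × ℝ) × ℝ, F p * (min (1 + t₁ () p.1.1 ^ 2) (K : ℝ) *
          min (1 + t₂ p.1.1 p.1.2 ^ 2) (K : ℝ) * min (1 + t₃ p.1 p.2 ^ 2) (K : ℝ))) := by ring
      _ = (2 * (Real.pi / 4)) * (2 * (2 / 3) * ∫ p : ℝ × ℝ, m₂ p *
          (min (1 + t₁ () p.1 ^ 2) (K : ℝ) * min (1 + t₂ p.1 p.2 ^ 2) (K : ℝ))) *
          truncMoment K (fun t => ((1 + t ^ 2) ^ 3)⁻¹) := by rw [e3]; ring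
      _ = (2 * (Real.pi / 4) * ∫ a, m₁ a * min (1 + t₁ () a ^ 2) (K : ℝ)) *
          truncMoment K (fun t => ((1 + t ^ 2) ^ 2 * √(1 + t ^ 2))⁻¹) *
          truncMoment K (fun t => ((1 + t ^ 2) ^ 3)⁻¹) := by rw [e2]; ring
      _ = _ := by rw [e1]; simp only [truncMoment]; ring

/-- The weight `∏ (1 + x_i²)⁻¹` on `ℝ³`. -/
def cauchyWeight (x : EuclideanSpace ℝ (Fin 3)) : ℝ :=
  (1 + x 0 ^ 2)⁻¹ * (1 + x 1 ^ 2)⁻¹ * (1 + x 2 ^ 2)⁻¹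

theorem cauchyWeight_pos (x : EuclideanSpace ℝ (Fin 3)) : 0 < cauchyWeight x := by
  unfold cauchyWeight; positivity

theorem continuous_cauchyWeight : Continuous cauchyWeight := by
  unfold cauchyWeight
  exact ((Continuous.inv₀ (by fun_prop) fun x => by positivity).mul
    (Continuous.inv₀ (by fun_prop) fun x => by positivity)).mul
    (Continuous.inv₀ (by fun_prop) fun x => by positivity)

theorem integral_cauchyWeight : ∫ x, cauchyWeight x = Real.pi ^ 3 := by
  have h := integral_euclidean_three fun p =>
    (1 + p.1.1 ^ 2)⁻¹ * (1 + p.1.2 ^ 2)⁻¹ * (1 + p.2 ^ 2)⁻¹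
  refine Eq.trans h ?_
  rw [Measure.volume_eq_prod, integral_prod_mul (fun p : ℝ × ℝ => (1 + p.1 ^ 2)⁻¹ * (1 + p.2 ^ 2)⁻¹)
    (fun s : ℝ => (1 + s ^ 2)⁻¹), Measure.volume_eq_prod,
    integral_prod_mul (fun s : ℝ => (1 + s ^ 2)⁻¹) (fun s : ℝ => (1 + s ^ 2)⁻¹),
    integral_univ_inv_one_add_sq]
  ring

theorem integrable_cauchyWeight : Integrable cauchyWeight := by
  by_contra h
  have := integral_undef h
  rw [integral_cauchyWeight] at this
  exact (pow_pos Real.pi_pos 3).ne' this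

theorem norm_gradient_sq (f : EuclideanSpace ℝ (Fin 3) → ℝ) (x : EuclideanSpace ℝ (Fin 3)) :
    ‖gradient f x‖ ^ 2 = fderiv ℝ f x (EuclideanSpace.single 0 1) ^ 2 +
      fderiv ℝ f x (EuclideanSpace.single 1 1) ^ 2 +
      fderiv ℝ f x (EuclideanSpace.single 2 1) ^ 2 := by
  have h : ∀ i, gradient f x i = fderiv ℝ f x (EuclideanSpace.single i 1) := fun i => by
    have := InnerProductSpace.toDual_symm_apply (𝕜 := ℝ) (x := EuclideanSpace.single i (1 : ℝ))
      (y := fderiv ℝ f x)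
    rw [← this, gradient, EuclideanSpace.inner_single_right]
    simp
  rw [EuclideanSpace.norm_sq_eq, Fin.sum_univ_three]
  simp only [h, Real.norm_eq_abs, sq_abs]

/-- Integration by parts against the fourth power of a compactly supported function. -/
theorem integral_pow_four_mul_lineDeriv {f : EuclideanSpace ℝ (Fin 3) → ℝ} (hf : ContDiff ℝ 1 f)
    (hs : HasCompactSupport f) {T D : EuclideanSpace ℝ (Fin 3) → ℝ} (hT : Continuous T)
    (hD : Continuous D) (v : EuclideanSpace ℝ (Fin 3)) (hTD : ∀ x, HasLineDerivAt ℝ T (D x) x v) :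
    ∫ x, f x ^ 4 * D x = -∫ x, 4 * f x ^ 3 * fderiv ℝ f x v * T x := by
  have hfc := hf.continuous
  have hfd : Continuous fun x => fderiv ℝ f x v :=
    (hf.continuous_fderiv one_ne_zero).clm_apply continuous_const
  have hz : ∀ x, x ∉ tsupport f → f x = 0 := fun x hx => image_eq_zero_of_notMem_tsupport hx
  have hcs : ∀ g : EuclideanSpace ℝ (Fin 3) → ℝ, Continuous g → (∀ x, f x = 0 → g x = 0) →
      Integrable g := fun g hg h0 => hg.integrable_of_hasCompactSupport
    (HasCompactSupport.intro hs fun x hx => h0 x (hz x hx))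
  refine integral_bilinear_hasLineDerivAt_right_eq_neg_left_of_integrable
    (f := fun x => f x ^ 4) (f' := fun x => 4 * f x ^ 3 * fderiv ℝ f x v) (g := T) (g' := D)
    (v := v) (B := ContinuousLinearMap.mul ℝ ℝ) ?_ ?_ ?_ (fun x _ => ?_) (fun x _ => hTD x)
  · exact hcs _ (by simp only [ContinuousLinearMap.mul_apply']; fun_prop) fun x hx => by simp [hx]
  · exact hcs _ (by simp only [ContinuousLinearMap.mul_apply']; fun_prop) fun x hx => by simp [hx]
  · exact hcs _ (by simp only [ContinuousLinearMap.mul_apply']; fun_prop) fun x hx => by simp [hx]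
  · have h := ((hf.differentiable one_ne_zero x).hasFDerivAt.pow 4).hasLineDerivAt v
    simpa using h

theorem mul_mul_le_div_three_pow {x y z : ℝ} (hx : 0 < x) (hy : 0 < y) (hz : 0 < z) :
    x * y * z ≤ ((x + y + z) / 3) ^ 3 := by
  have h1 := mul_nonneg hx.le (sq_nonneg (y - z))
  have h2 := mul_nonneg hy.le (sq_nonneg (x - z))
  have h3 := mul_nonneg hz.le (sq_nonneg (x - y))
  have h4 := mul_nonneg (add_nonneg (add_nonneg hx.le hy.le) hz.le)
    (add_nonneg (add_nonneg (sq_nonneg (x - y)) (sq_nonneg (y - z))) (sq_nonneg (x - z)))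
  nlinarith

set_option maxHeartbeats 2000000 in
theorem sobolev_of_transport {f : EuclideanSpace ℝ (Fin 3) → ℝ} (hf : ContDiff ℝ 1 f)
    (hs : HasCompactSupport f) {δ c : ℝ} (hδ : 0 < δ) (hc : 0 < c)
    (hcM : c ^ 3 = 4 / Real.pi ^ 2 * ((∫ x, f x ^ 6) + δ * Real.pi ^ 3)) (K : ℕ) :
    ((∫ x, f x ^ 6) + δ * Real.pi ^ 3) * (4 / Real.pi ^ 2 *
        (truncMoment K (fun t => ((1 + t ^ 2) ^ 2)⁻¹) *
          truncMoment K (fun t => ((1 + t ^ 2) ^ 2 * √(1 + t ^ 2))⁻¹) *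
          truncMoment K (fun t => ((1 + t ^ 2) ^ 3)⁻¹))) - δ * (Real.pi ^ 3 * (K : ℝ) ^ 3) +
      2 * (∫ x, f x ^ 6) ≤ 2 * c ^ 2 * ∫ x, ‖gradient f x‖ ^ 2 := by
  have hfc := hf.continuous
  have hpi := Real.pi_pos
  have hz : ∀ x, x ∉ tsupport f → f x = 0 := fun x hx => image_eq_zero_of_notMem_tsupport hx
  have hcs : ∀ g : EuclideanSpace ℝ (Fin 3) → ℝ, Continuous g → (∀ x, f x = 0 → g x = 0) →
      Integrable g := fun g hg h0 => hg.integrable_of_hasCompactSupport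
    (HasCompactSupport.intro hs fun x hx => h0 x (hz x hx))
  set F : (ℝ × ℝ) × ℝ → ℝ := fun p => f (!₂[p.1.1, p.1.2, p.2]) ^ 6 +
    δ * cauchyWeight (!₂[p.1.1, p.1.2, p.2]) with hF
  have hmk : ∀ x : EuclideanSpace ℝ (Fin 3), !₂[x 0, x 1, x 2] = x := fun x => by
    ext i; fin_cases i <;> rfl
  have hFx : ∀ x : EuclideanSpace ℝ (Fin 3), F ((x 0, x 1), x 2) = f x ^ 6 + δ * cauchyWeight x :=
    fun x => by simp only [hF, hmk]
  have hmkc : Continuous fun p : (ℝ × ℝ) × ℝ => !₂[p.1.1, p.1.2, p.2] := by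
    refine (PiLp.continuous_toLp 2 _).comp (continuous_pi fun i => ?_)
    fin_cases i <;> simp <;> fun_prop
  have hFc : Continuous F :=
    ((hfc.comp hmkc).pow 6).add (continuous_const.mul (continuous_cauchyWeight.comp hmkc))
  have hf6 : ∀ x, 0 ≤ f x ^ 6 := fun x => by positivity
  have hFpos : ∀ p, 0 < F p := fun p =>
    add_pos_of_nonneg_of_pos (hf6 _) (mul_pos hδ (cauchyWeight_pos _))
  obtain ⟨B, hB⟩ : ∃ B, ∀ p, F p ≤
      B * ((1 + p.1.1 ^ 2)⁻¹ * (1 + p.1.2 ^ 2)⁻¹ * (1 + p.2 ^ 2)⁻¹) := by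
    have hgc : Continuous fun x => f x ^ 6 / cauchyWeight x :=
      (hfc.pow 6).div continuous_cauchyWeight fun x => (cauchyWeight_pos x).ne'
    obtain ⟨A, hA⟩ := hgc.bounded_above_of_compact_support
      (HasCompactSupport.intro hs fun x hx => by simp [hz x hx])
    refine ⟨A + δ, fun p => ?_⟩
    have h1 := (le_abs_self _).trans (hA (!₂[p.1.1, p.1.2, p.2]))
    rw [div_le_iff₀ (cauchyWeight_pos _)] at h1
    calc F p ≤ A * cauchyWeight (!₂[p.1.1, p.1.2, p.2]) +
          δ * cauchyWeight (!₂[p.1.1, p.1.2, p.2]) := by simp only [hF]; gcongr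
      _ = _ := by rw [← add_mul]; rfl
  obtain ⟨hFint, hMpos, t₁, d₁, t₂, d₂, t₃, d₃, ht1, hd1, ht2, hd2, ht3, hd3, hd1p, hd2p, hd3p,
    hder1, hder2, hder3, hprod, hmom⟩ := exists_triangular_transport hFc hFpos hB
  have hM : ∫ p, F p = (∫ x, f x ^ 6) + δ * Real.pi ^ 3 := by
    rw [← integral_euclidean_three]
    simp only [hFx]
    rw [integral_add (hcs _ (by fun_prop) fun x hx => by simp [hx])
      (integrable_cauchyWeight.const_mul δ), integral_const_mul, integral_cauchyWeight]
  specialize hmom K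
  rw [← integral_euclidean_three] at hmom
  simp only [hFx] at hmom
  rw [hM] at hmom hprod hMpos
  set M₀ := ∫ x, f x ^ 6 with hM0
  set E := truncMoment K (fun t => ((1 + t ^ 2) ^ 2)⁻¹) *
          truncMoment K (fun t => ((1 + t ^ 2) ^ 2 * √(1 + t ^ 2))⁻¹) *
          truncMoment K (fun t => ((1 + t ^ 2) ^ 3)⁻¹) with hE
  -- the transport in coordinates
  set a : EuclideanSpace ℝ (Fin 3) → ℝ := fun x => t₁ (x 0) with ha
  set b : EuclideanSpace ℝ (Fin 3) → ℝ := fun x => t₂ (x 0, x 1) with hb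
  set e : EuclideanSpace ℝ (Fin 3) → ℝ := fun x => t₃ ((x 0, x 1), x 2) with he
  have hac : Continuous a := by fun_prop
  have hbc : Continuous b := by fun_prop
  have hec : Continuous e := by fun_prop
  set D₀ : EuclideanSpace ℝ (Fin 3) → ℝ := fun x => d₁ (x 0) with hD0
  set D₁ : EuclideanSpace ℝ (Fin 3) → ℝ := fun x => √(1 + a x ^ 2) * d₂ (x 0, x 1) with hD1
  set D₂ : EuclideanSpace ℝ (Fin 3) → ℝ := fun x =>
    √(1 + a x ^ 2) * √(1 + b x ^ 2) * d₃ ((x 0, x 1), x 2) with hD2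
  set T₁ : EuclideanSpace ℝ (Fin 3) → ℝ := fun x => √(1 + a x ^ 2) * b x with hT1
  set T₂ : EuclideanSpace ℝ (Fin 3) → ℝ := fun x =>
    √(1 + a x ^ 2) * √(1 + b x ^ 2) * e x with hT2
  have hD0c : Continuous D₀ := by fun_prop
  have hD1c : Continuous D₁ := by fun_prop
  have hD2c : Continuous D₂ := by fun_prop
  have hT1c : Continuous T₁ := by fun_prop
  have hT2c : Continuous T₂ := by fun_prop
  have hshift : ∀ (u : ℝ → ℝ) (u' s : ℝ), HasDerivAt u u' s →
      HasDerivAt (fun t => u (s + t)) u' 0 := fun u u' s h => by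
    have h2 : HasDerivAt u u' (s + 0) := by rwa [add_zero]
    simpa using h2.comp_const_add s 0
  have p0 := integral_pow_four_mul_lineDeriv hf hs hac hD0c (EuclideanSpace.single 0 1)
    fun x => by
      simpa [HasLineDerivAt, ha] using hshift _ _ _ (hder1 (x 0))
  have p1 := integral_pow_four_mul_lineDeriv hf hs hT1c hD1c (EuclideanSpace.single 1 1)
    fun x => by
      simpa [HasLineDerivAt, hT1, ha, hb] using
        (hshift _ _ _ (hder2 (x 0) (x 1))).const_mul (√(1 + a x ^ 2))
  have p2 := integral_pow_four_mul_lineDeriv hf hs hT2c hD2c (EuclideanSpace.single 2 1)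
    fun x => by
      simpa [HasLineDerivAt, hT2, ha, hb, he] using
        (hshift _ _ _ (hder3 (x 0, x 1) (x 2))).const_mul (√(1 + a x ^ 2) * √(1 + b x ^ 2))
  set P : EuclideanSpace ℝ (Fin 3) → ℝ := fun x =>
    (1 + a x ^ 2) * (1 + b x ^ 2) * (1 + e x ^ 2) with hP
  have hPc : Continuous P := by fun_prop
  have hPT : ∀ x, P x = 1 + (a x ^ 2 + T₁ x ^ 2 + T₂ x ^ 2) := fun x => by
    simp only [hP, hT1, hT2, mul_pow]
    rw [Real.sq_sqrt (by positivity), Real.sq_sqrt (by positivity)]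
    ring
  have hpt : ∀ x, f x ^ 6 * P x ≤ c / 3 * (f x ^ 4 * D₀ x + f x ^ 4 * D₁ x + f x ^ 4 * D₂ x) := by
    intro x
    have h := hprod ((x 0, x 1), x 2)
    rw [hFx] at h
    have hDD : D₀ x * D₁ x * D₂ x = Real.pi ^ 2 / 4 *
        ((f x ^ 6 + δ * cauchyWeight x) / (M₀ + δ * Real.pi ^ 3)) * P x ^ 3 := by
      have q1 : √(1 + a x ^ 2) ^ 2 = 1 + a x ^ 2 := Real.sq_sqrt (by positivity)
      have q2 : √(1 + b x ^ 2) ^ 2 = 1 + b x ^ 2 := Real.sq_sqrt (by positivity)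
      calc D₀ x * D₁ x * D₂ x = √(1 + a x ^ 2) ^ 2 * √(1 + b x ^ 2) *
            (d₁ (x 0) * d₂ (x 0, x 1) * d₃ ((x 0, x 1), x 2)) := by
            simp only [hD0, hD1, hD2]; ring
        _ = √(1 + b x ^ 2) ^ 2 * (1 + a x ^ 2) * (Real.pi ^ 2 / 4 *
            ((f x ^ 6 + δ * cauchyWeight x) / (M₀ + δ * Real.pi ^ 3)) *
            ((1 + a x ^ 2) ^ 2 * (1 + b x ^ 2) ^ 2 * (1 + e x ^ 2) ^ 3)) := by
            rw [h, q1]; simp only [ha, hb, he]; ring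
        _ = _ := by rw [q2]; simp only [hP]; ring
    have k0 : 0 < D₀ x := hd1p _
    have k1 : 0 < D₁ x := mul_pos (Real.sqrt_pos.2 (by positivity)) (hd2p _)
    have k2 : 0 < D₂ x := mul_pos (mul_pos (Real.sqrt_pos.2 (by positivity))
      (Real.sqrt_pos.2 (by positivity))) (hd3p _)
    have hPpos : 0 < P x := by simp only [hP]; positivity
    have amgm : D₀ x * D₁ x * D₂ x ≤ ((D₀ x + D₁ x + D₂ x) / 3) ^ 3 :=
      mul_mul_le_div_three_pow k0 k1 k2
    have hcube : (f x ^ 2 * P x) ^ 3 ≤ (c * ((D₀ x + D₁ x + D₂ x) / 3)) ^ 3 := by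
      calc (f x ^ 2 * P x) ^ 3 = f x ^ 6 * P x ^ 3 := by ring
        _ ≤ (f x ^ 6 + δ * cauchyWeight x) * P x ^ 3 := by
            have := mul_pos hδ (cauchyWeight_pos x)
            gcongr
            linarith
        _ = c ^ 3 * (D₀ x * D₁ x * D₂ x) := by
            rw [hDD, hcM]; field_simp
        _ ≤ c ^ 3 * ((D₀ x + D₁ x + D₂ x) / 3) ^ 3 := by gcongr
        _ = _ := by ring
    have hroot : f x ^ 2 * P x ≤ c * ((D₀ x + D₁ x + D₂ x) / 3) :=
      le_of_pow_le_pow_left₀ (by norm_num) (by positivity) hcube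
    calc f x ^ 6 * P x = f x ^ 4 * (f x ^ 2 * P x) := by ring
      _ ≤ f x ^ 4 * (c * ((D₀ x + D₁ x + D₂ x) / 3)) := by gcongr
      _ = _ := by ring
  have hg : ∀ v, Continuous fun x => fderiv ℝ f x v := fun v =>
    (hf.continuous_fderiv one_ne_zero).clm_apply continuous_const
  have hgz : ∀ v x, x ∉ tsupport f → fderiv ℝ f x v = 0 := fun v x hx => by
    have : fderiv ℝ f x = 0 :=
      image_eq_zero_of_notMem_tsupport fun h => hx (tsupport_fderiv_subset ℝ h)
    rw [this]; rfl
  have hgrad : Integrable fun x => ‖gradient f x‖ ^ 2 := by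
    simp only [norm_gradient_sq]
    have h0 := hg (EuclideanSpace.single 0 1)
    have h1 := hg (EuclideanSpace.single 1 1)
    have h2 := hg (EuclideanSpace.single 2 1)
    refine Continuous.integrable_of_hasCompactSupport (by fun_prop)
      (HasCompactSupport.intro hs fun x hx => by simp [hgz _ x hx])
  have hX : Integrable fun x => f x ^ 6 * P x := hcs _ (by fun_prop) fun x hx => by simp [hx]
  have hi6 : Integrable fun x => f x ^ 6 := hcs _ (by fun_prop) fun x hx => by simp [hx]
  have hupper : (∫ x, f x ^ 6 * P x) ≤ 2 / 3 * ((∫ x, f x ^ 6 * P x) - M₀) +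
      2 / 3 * c ^ 2 * ∫ x, ‖gradient f x‖ ^ 2 := by
    have i0 : Integrable fun x => f x ^ 4 * D₀ x := hcs _ (by fun_prop) fun x hx => by simp [hx]
    have i1 : Integrable fun x => f x ^ 4 * D₁ x := hcs _ (by fun_prop) fun x hx => by simp [hx]
    have i2 : Integrable fun x => f x ^ 4 * D₂ x := hcs _ (by fun_prop) fun x hx => by simp [hx]
    have g0 := hg (EuclideanSpace.single 0 1)
    have g1 := hg (EuclideanSpace.single 1 1)
    have g2 := hg (EuclideanSpace.single 2 1)
    have j0 : Integrable fun x => 4 * f x ^ 3 * fderiv ℝ f x (EuclideanSpace.single 0 1) * a x :=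
      hcs _ (by fun_prop) fun x hx => by simp [hx]
    have j1 : Integrable fun x => 4 * f x ^ 3 * fderiv ℝ f x (EuclideanSpace.single 1 1) * T₁ x :=
      hcs _ (by fun_prop) fun x hx => by simp [hx]
    have j2 : Integrable fun x => 4 * f x ^ 3 * fderiv ℝ f x (EuclideanSpace.single 2 1) * T₂ x :=
      hcs _ (by fun_prop) fun x hx => by simp [hx]
    have i01 : Integrable fun x => f x ^ 4 * D₀ x + f x ^ 4 * D₁ x := i0.add i1
    have j01 : Integrable fun x => 4 * f x ^ 3 * fderiv ℝ f x (EuclideanSpace.single 0 1) * a x +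
        4 * f x ^ 3 * fderiv ℝ f x (EuclideanSpace.single 1 1) * T₁ x := j0.add j1
    have iX : Integrable fun x => 2 / 3 * (f x ^ 6 * P x - f x ^ 6) := (hX.sub hi6).const_mul _
    calc (∫ x, f x ^ 6 * P x)
        ≤ ∫ x, c / 3 * (f x ^ 4 * D₀ x + f x ^ 4 * D₁ x + f x ^ 4 * D₂ x) :=
          integral_mono hX (((i0.add i1).add i2).const_mul _) hpt
      _ = c / 3 * ((∫ x, f x ^ 4 * D₀ x) + (∫ x, f x ^ 4 * D₁ x) + ∫ x, f x ^ 4 * D₂ x) := by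
          rw [integral_const_mul, integral_add i01 i2, integral_add i0 i1]
      _ = ∫ x, -(c / 3) * (4 * f x ^ 3 * fderiv ℝ f x (EuclideanSpace.single 0 1) * a x +
            4 * f x ^ 3 * fderiv ℝ f x (EuclideanSpace.single 1 1) * T₁ x +
            4 * f x ^ 3 * fderiv ℝ f x (EuclideanSpace.single 2 1) * T₂ x) := by
          rw [p0, p1, p2, integral_const_mul, integral_add j01 j2, integral_add j0 j1]
          ring
      _ ≤ ∫ x, (2 / 3 * (f x ^ 6 * P x - f x ^ 6) + 2 / 3 * c ^ 2 * ‖gradient f x‖ ^ 2) := by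
          refine integral_mono (((j0.add j1).add j2).const_mul _)
            (((hX.sub hi6).const_mul _).add (hgrad.const_mul _)) fun x => ?_
          simp only [hPT, norm_gradient_sq]
          nlinarith [sq_nonneg (f x ^ 3 * a x + c * fderiv ℝ f x (EuclideanSpace.single 0 1)),
            sq_nonneg (f x ^ 3 * T₁ x + c * fderiv ℝ f x (EuclideanSpace.single 1 1)),
            sq_nonneg (f x ^ 3 * T₂ x + c * fderiv ℝ f x (EuclideanSpace.single 2 1))]
      _ = _ := by
          rw [integral_add iX (hgrad.const_mul _), integral_const_mul,
            integral_const_mul, integral_sub hX hi6]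
  have hK0 := min_one_add_sq_nonneg K
  have hKle : ∀ t : ℝ, min (1 + t ^ 2) (K : ℝ) ≤ K := fun t => min_le_right _ _
  set Q : EuclideanSpace ℝ (Fin 3) → ℝ := fun x =>
    min (1 + a x ^ 2) (K : ℝ) * min (1 + b x ^ 2) (K : ℝ) * min (1 + e x ^ 2) (K : ℝ) with hQ
  have hQc : Continuous Q := by fun_prop
  have hQ0 : ∀ x, 0 ≤ Q x := fun x => mul_nonneg (mul_nonneg (hK0 _) (hK0 _)) (hK0 _)
  have hQP : ∀ x, Q x ≤ P x := fun x => by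
    have h1 := hK0 (a x)
    have h2 := hK0 (b x)
    have h3 := hK0 (e x)
    simp only [hQ, hP]
    gcongr <;> exact min_le_left _ _
  have hQK : ∀ x, Q x ≤ (K : ℝ) ^ 3 := fun x => by
    have h1 := hK0 (a x)
    have h2 := hK0 (b x)
    have h3 := hK0 (e x)
    calc Q x ≤ (K : ℝ) * K * K := by
          simp only [hQ]
          gcongr <;> exact hKle _
      _ = _ := by ring
  have hiQ : Integrable fun x => f x ^ 6 * Q x := hcs _ (by fun_prop) fun x hx => by simp [hx]
  have hwQ : Integrable fun x => cauchyWeight x * Q x := by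
    refine (integrable_cauchyWeight.mul_const ((K : ℝ) ^ 3)).mono'
      (continuous_cauchyWeight.mul hQc).aestronglyMeasurable (ae_of_all _ fun x => ?_)
    have := (cauchyWeight_pos x).le
    rw [Real.norm_of_nonneg (mul_nonneg this (hQ0 x))]
    exact mul_le_mul_of_nonneg_left (hQK x) this
  have hlower : (M₀ + δ * Real.pi ^ 3) * (4 / Real.pi ^ 2 * E) - δ * (Real.pi ^ 3 * (K : ℝ) ^ 3) ≤
      ∫ x, f x ^ 6 * P x := by
    have h1 : (∫ x, f x ^ 6 * Q x) ≤ ∫ x, f x ^ 6 * P x :=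
      integral_mono hiQ hX fun x => mul_le_mul_of_nonneg_left (hQP x) (hf6 x)
    have h2 : (∫ x, cauchyWeight x * Q x) ≤ Real.pi ^ 3 * (K : ℝ) ^ 3 := by
      rw [← integral_cauchyWeight, ← integral_mul_const]
      exact integral_mono hwQ (integrable_cauchyWeight.mul_const _) fun x =>
        mul_le_mul_of_nonneg_left (hQK x) (cauchyWeight_pos x).le
    have h3 : (∫ x, (f x ^ 6 + δ * cauchyWeight x) * Q x) =
        (∫ x, f x ^ 6 * Q x) + δ * ∫ x, cauchyWeight x * Q x := by
      rw [← integral_const_mul, ← integral_add hiQ (hwQ.const_mul δ)]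
      congr 1
      ext x
      ring
    have h4 : (M₀ + δ * Real.pi ^ 3) * (4 / Real.pi ^ 2 * E) =
        ∫ x, (f x ^ 6 + δ * cauchyWeight x) * Q x := by
      have : (M₀ + δ * Real.pi ^ 3) * (4 / Real.pi ^ 2 * E) =
        4 / Real.pi ^ 2 * ((M₀ + δ * Real.pi ^ 3) * E) := by ring
      rw [this, ← hmom, ← mul_assoc, show 4 / Real.pi ^ 2 * (Real.pi ^ 2 / 4) = 1 by field_simp,
        one_mul]
    rw [h4, h3]
    have := mul_le_mul_of_nonneg_left h2 hδ.le
    linarith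
  nlinarith [hupper, hlower]

/-- The sharp constant `3 (π / 2) ^ (4 / 3)` of the Sobolev inequality in `ℝ³`. -/
def sharpSobolev : ℝ := 3 * ((Real.pi ^ 2 / 4) ^ (1 / 3 : ℝ)) ^ 2

/-- **Sharp Sobolev inequality in dimension three.** -/
theorem sharpSobolev_le {f : EuclideanSpace ℝ (Fin 3) → ℝ} (hf : ContDiff ℝ 1 f)
    (hs : HasCompactSupport f) (hf0 : 0 < ∫ x, f x ^ 6) :
    sharpSobolev * (∫ x, f x ^ 6) ^ (1 / 3 : ℝ) ≤ ∫ x, ‖gradient f x‖ ^ 2 := by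
  have hpi := Real.pi_pos
  set M := ∫ x, f x ^ 6 with hM
  set D := ∫ x, ‖gradient f x‖ ^ 2 with hD
  set κ : ℝ → ℝ := fun δ => (4 / Real.pi ^ 2 * (M + δ * Real.pi ^ 3)) ^ (1 / 3 : ℝ) with hκ
  have hκc : ContinuousAt κ 0 :=
    ContinuousAt.rpow_const (by fun_prop) (Or.inr (by norm_num))
  set E : ℕ → ℝ := fun K => truncMoment K (fun t => ((1 + t ^ 2) ^ 2)⁻¹) *
          truncMoment K (fun t => ((1 + t ^ 2) ^ 2 * √(1 + t ^ 2))⁻¹) *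
          truncMoment K (fun t => ((1 + t ^ 2) ^ 3)⁻¹) with hE
  have hE_lim : Tendsto E atTop (𝓝 (Real.pi * 2 * (Real.pi / 2))) :=
    (tendsto_moment_two.mul tendsto_moment_five_halves).mul tendsto_moment_three
  have hpow : ∀ y : ℝ, 0 ≤ y → (y ^ (1 / 3 : ℝ)) ^ 3 = y := fun y hy => by
    rw [← Real.rpow_natCast, ← Real.rpow_mul hy]; norm_num
  have step : ∀ K : ℕ, M * (4 / Real.pi ^ 2 * E K) + 2 * M ≤ 2 * κ 0 ^ 2 * D := fun K => by
    have hl : ContinuousAt (fun δ : ℝ => (M + δ * Real.pi ^ 3) * (4 / Real.pi ^ 2 * E K) -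
        δ * (Real.pi ^ 3 * (K : ℝ) ^ 3) + 2 * M) 0 := by fun_prop
    have hr : ContinuousAt (fun δ : ℝ => 2 * κ δ ^ 2 * D) 0 :=
      ((hκc.pow 2).const_mul 2).mul_const D
    have h := le_of_tendsto_of_tendsto (hl.tendsto.mono_left (nhdsWithin_le_nhds (s := Set.Ioi 0)))
      (hr.tendsto.mono_left nhdsWithin_le_nhds) (by
        filter_upwards [self_mem_nhdsWithin] with δ hδ
        have hδ' : 0 < δ := hδ
        have hpos : 0 < 4 / Real.pi ^ 2 * (M + δ * Real.pi ^ 3) := by positivity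
        exact sobolev_of_transport hf hs hδ' (Real.rpow_pos_of_pos hpos _) (hpow _ hpos.le) K)
    simpa using h
  have hlim : M * (4 / Real.pi ^ 2 * (Real.pi * 2 * (Real.pi / 2))) + 2 * M ≤ 2 * κ 0 ^ 2 * D :=
    le_of_tendsto' (((hE_lim.const_mul _).const_mul _).add_const _) step
  have h4 : M * (4 / Real.pi ^ 2 * (Real.pi * 2 * (Real.pi / 2))) = 4 * M := by
    field_simp
  rw [h4] at hlim
  set μ := M ^ (1 / 3 : ℝ) with hμ
  have hμpos : 0 < μ := Real.rpow_pos_of_pos hf0 _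
  have hμ3 : μ ^ 3 = M := hpow M hf0.le
  set ρ := (Real.pi ^ 2 / 4) ^ (1 / 3 : ℝ) with hρ
  have hρpos : 0 < ρ := Real.rpow_pos_of_pos (by positivity) _
  have hκ0 : κ 0 = μ / ρ := by
    simp only [hκ, hρ, hμ]
    rw [← Real.div_rpow hf0.le (by positivity)]
    congr 1
    field_simp
    ring
  rw [hκ0, ← hμ3] at hlim
  have h5 : 2 * (μ / ρ) ^ 2 * D = μ ^ 2 * (2 * D / ρ ^ 2) := by field_simp
  have h6 : 4 * μ ^ 3 + 2 * μ ^ 3 = μ ^ 2 * (6 * μ) := by ring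
  rw [h5, h6] at hlim
  have h7 := le_of_mul_le_mul_left hlim (by positivity)
  rw [le_div_iff₀ (by positivity)] at h7
  rw [sharpSobolev, ← hρ]
  linarith

namespace IsTest

variable {Ω : Set (Euc 3)} {u : Euc 3 → ℝ}

theorem setIntegral_eq (h : IsTest Ω u) {g : Euc 3 → ℝ} (hg : ∀ x, x ∉ tsupport u → g x = 0) :
    ∫ x in Ω, g x = ∫ x, g x :=
  setIntegral_eq_integral_of_forall_compl_eq_zero fun x hx => hg x fun hx' => hx (h.2.2.1 hx')

theorem setIntegral_abs_rpow_six (h : IsTest Ω u) :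
    ∫ x in Ω, |u x| ^ (6 : ℝ) = ∫ x, u x ^ 6 := by
  rw [h.setIntegral_eq fun x hx => by simp [image_eq_zero_of_notMem_tsupport hx]]
  congr 1
  ext x
  rw [show (6 : ℝ) = (6 : ℕ) by norm_num, Real.rpow_natCast, Even.pow_abs (by decide)]

theorem integrable_pow (h : IsTest Ω u) {m : ℕ} (hm : m ≠ 0) : Integrable fun x => u x ^ m :=
  (h.1.continuous.pow m).integrable_of_hasCompactSupport
    (HasCompactSupport.intro h.2.1 fun x hx => by
      simp [image_eq_zero_of_notMem_tsupport hx, hm])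

theorem integral_pow_six_pos (h : IsTest Ω u) : 0 < ∫ x, u x ^ 6 := by
  obtain ⟨x, hx⟩ := Function.ne_iff.1 h.2.2.2
  exact (h.1.continuous.pow 6).integral_pos_of_hasCompactSupport_nonneg_nonzero (x := x)
    (HasCompactSupport.intro h.2.1 fun x hx => by simp [image_eq_zero_of_notMem_tsupport hx])
    (fun x => (by positivity : 0 ≤ u x ^ 6)) (pow_ne_zero 6 hx)

theorem gradient_eq_zero {x : Euc 3} (hx : x ∉ tsupport u) : gradient u x = 0 := by
  have : fderiv ℝ u x = 0 :=
    image_eq_zero_of_notMem_tsupport fun h => hx (tsupport_fderiv_subset ℝ h)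
  simp [gradient, this]

end IsTest

theorem sharpSobolev_le_SobolevS {Ω : Set (Euc 3)} (hΩ : ∃ u, IsTest Ω u) :
    sharpSobolev ≤ SobolevS Ω 6 := by
  obtain ⟨u, hu⟩ := hΩ
  refine le_csInf ⟨_, u, hu, rfl⟩ ?_
  rintro r ⟨v, hv, rfl⟩
  rw [hv.setIntegral_abs_rpow_six, show (2 / 6 : ℝ) = 1 / 3 by norm_num,
    hv.setIntegral_eq fun x hx => by simp [IsTest.gradient_eq_zero hx],
    le_div_iff₀ (Real.rpow_pos_of_pos hv.integral_pow_six_pos _)]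
  exact sharpSobolev_le (hv.1.of_le (by exact_mod_cast le_top)) hv.2.1 hv.integral_pow_six_pos

/-- The infimum defining `S_λ(p)` is bounded below by each of its quotients. -/
theorem Slam_le {Ω : Set (Euc 3)} (hΩo : IsOpen Ω) (hΩb : Bornology.IsBounded Ω)
    {p : Euc 3 → ℝ} (hp : ∀ x ∈ Ω, 0 ≤ p x) {lam : ℝ} (hlam : 0 ≤ lam) {u : Euc 3 → ℝ}
    (hu : IsTest Ω u) :
    Slam Ω p 6 lam ≤ ((∫ x in Ω, p x * ‖gradient u x‖ ^ 2) - lam * ∫ x, u x ^ 2) /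
      (∫ x, u x ^ 6) ^ (1 / 3 : ℝ) := by
  have key : ∀ v : Euc 3 → ℝ, IsTest Ω v →
      ((∫ x in Ω, p x * ‖gradient v x‖ ^ 2) - lam * ∫ x in Ω, (v x) ^ 2) /
        (∫ x in Ω, |v x| ^ (6 : ℝ)) ^ (2 / 6 : ℝ) =
      ((∫ x in Ω, p x * ‖gradient v x‖ ^ 2) - lam * ∫ x, v x ^ 2) /
        (∫ x, v x ^ 6) ^ (1 / 3 : ℝ) := fun v hv => by
    rw [hv.setIntegral_abs_rpow_six, show (2 / 6 : ℝ) = 1 / 3 by norm_num,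
      hv.setIntegral_eq (g := fun x => v x ^ 2) fun x hx => by
        simp [image_eq_zero_of_notMem_tsupport hx]]
  refine csInf_le ⟨-(lam * (volume.real Ω + 1)), ?_⟩ ⟨u, hu, (key u hu).symm⟩
  rintro r ⟨v, hv, rfl⟩
  rw [key v hv]
  set M := ∫ x, v x ^ 6 with hM
  have hM0 : 0 < M := hv.integral_pow_six_pos
  set s := M ^ (1 / 3 : ℝ) with hs
  have hs0 : 0 < s := Real.rpow_pos_of_pos hM0 _
  have hs3 : s ^ 3 = M := by
    rw [hs, ← Real.rpow_natCast, ← Real.rpow_mul hM0.le]; norm_num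
  have hfin : volume Ω ≠ ⊤ := hΩb.measure_lt_top.ne
  have hyoung : ∀ x, v x ^ 2 ≤ s + s / M * v x ^ 6 := fun x => by
    have h1 : 0 ≤ v x ^ 2 / s := by positivity
    have h2 : v x ^ 2 / s ≤ 1 + (v x ^ 2 / s) ^ 3 := by
      rcases le_total (v x ^ 2 / s) 1 with h | h
      · have := pow_nonneg h1 3
        linarith
      · have := le_self_pow₀ h three_ne_zero
        linarith
    calc v x ^ 2 = s * (v x ^ 2 / s) := by field_simp
      _ ≤ s * (1 + (v x ^ 2 / s) ^ 3) := by gcongr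
      _ = _ := by rw [← hs3]; field_simp
  have hint : (∫ x, v x ^ 2) ≤ s * (volume.real Ω + 1) := by
    have hc : IntegrableOn (fun _ : Euc 3 => s) Ω := integrableOn_const hfin
    have h6 : IntegrableOn (fun x => s / M * v x ^ 6) Ω :=
      ((hv.integrable_pow (by norm_num)).const_mul _).integrableOn
    rw [← hv.setIntegral_eq fun x hx => by simp [image_eq_zero_of_notMem_tsupport hx]]
    calc (∫ x in Ω, v x ^ 2) ≤ ∫ x in Ω, (s + s / M * v x ^ 6) :=
          integral_mono (hv.integrable_pow two_ne_zero).integrableOn (Integrable.add hc h6) hyoung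
      _ = s * (volume.real Ω + 1) := by
          rw [integral_add hc h6, setIntegral_const, integral_const_mul,
            hv.setIntegral_eq fun x hx => by simp [image_eq_zero_of_notMem_tsupport hx], ← hM,
            smul_eq_mul]
          field_simp
  have hgrad : 0 ≤ ∫ x in Ω, p x * ‖gradient v x‖ ^ 2 :=
    setIntegral_nonneg hΩo.measurableSet fun x hx => mul_nonneg (hp x hx) (by positivity)
  rw [le_div_iff₀ hs0]
  have := mul_le_mul_of_nonneg_left hint hlam
  nlinarith

/-- The class `H_R` of cutoff functions. -/
def IsCutoff (R : ℝ) (ζ : ℝ → ℝ) : Prop :=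
  ContDiff ℝ (⊤ : ℕ∞) ζ ∧ (∀ r, ζ r ∈ Set.Icc (0 : ℝ) 1) ∧
    (∀ r ∈ Set.Icc (0 : ℝ) (R / 2), ζ r = 1) ∧ ∀ r, R ≤ r → ζ r = 0

/-- The quotient `D(k, ζ)`. -/
def cutoffQuotient (k β p₀ R : ℝ) (ζ : ℝ → ℝ) : ℝ :=
  ((∫ r in (0 : ℝ)..R, (p₀ + β * r ^ k) * (deriv ζ r) ^ 2) +
    k * β * ∫ r in (0 : ℝ)..R, (ζ r) ^ 2 * r ^ (k - 2)) / ∫ r in (0 : ℝ)..R, (ζ r) ^ 2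

theorem exists_isCutoff {R : ℝ} (hR : 0 < R) : ∃ ζ, IsCutoff R ζ := by
  refine ⟨fun r => Real.smoothTransition (2 - 2 * r / R), ?_,
    fun r => ⟨Real.smoothTransition.nonneg _, Real.smoothTransition.le_one _⟩, fun r hr => Real.smoothTransition.one_of_one_le ?_,
    fun r hr => Real.smoothTransition.zero_of_nonpos ?_⟩
  · exact Real.smoothTransition.contDiff.comp
      (contDiff_const.sub ((contDiff_const.mul contDiff_id).div_const R))
  · have : 2 * r / R ≤ 1 := by rw [div_le_one hR]; linarith [hr.2]
    linarith
  · have : 2 ≤ 2 * r / R := by rw [le_div_iff₀ hR]; linarith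
    linarith

namespace IsCutoff

variable {R : ℝ} {ζ : ℝ → ℝ}

theorem continuous (h : IsCutoff R ζ) : Continuous ζ := h.1.continuous

theorem hasDerivAt (h : IsCutoff R ζ) (r : ℝ) : HasDerivAt ζ (deriv ζ r) r :=
  (h.1.differentiable (by simp) r).hasDerivAt

theorem continuous_deriv (h : IsCutoff R ζ) : Continuous (deriv ζ) :=
  h.1.continuous_deriv (by exact_mod_cast le_top)

theorem integral_sq_pos (h : IsCutoff R ζ) (hR : 0 < R) : 0 < ∫ r in (0 : ℝ)..R, ζ r ^ 2 := by
  refine intervalIntegral.integral_pos hR (h.continuous.pow 2).continuousOn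
    (fun x _ => by positivity) ⟨0, ⟨le_rfl, hR.le⟩, ?_⟩
  rw [h.2.2.1 0 ⟨le_rfl, by positivity⟩]
  norm_num

theorem integral_sq_le (h : IsCutoff R ζ) (hR : 0 < R) :
    ∫ r in (0 : ℝ)..R, ζ r ^ 2 ≤ 4 * R ^ 2 * ∫ r in (0 : ℝ)..R, deriv ζ r ^ 2 := by
  have hc := h.continuous
  have hc' := h.continuous_deriv
  have h0 : ∫ r in (0 : ℝ)..R, (ζ r ^ 2 + r * (2 * ζ r * deriv ζ r)) = 0 := by
    rw [intervalIntegral.integral_eq_sub_of_hasDerivAt (f := fun r => r * ζ r ^ 2)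
      (fun r _ => ?_) (Continuous.intervalIntegrable (by fun_prop) _ _)]
    · simp [h.2.2.2 R le_rfl]
    · simpa using (hasDerivAt_id' r).fun_mul ((h.hasDerivAt r).fun_pow 2)
  have h1 : ∫ r in (0 : ℝ)..R, (1 / 2 * ζ r ^ 2 - 2 * R ^ 2 * deriv ζ r ^ 2) ≤
      ∫ r in (0 : ℝ)..R, (ζ r ^ 2 + r * (2 * ζ r * deriv ζ r)) := by
    refine intervalIntegral.integral_mono_on hR.le
      (Continuous.intervalIntegrable (by fun_prop) _ _)
      (Continuous.intervalIntegrable (by fun_prop) _ _) fun r hr => ?_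
    have h2 : r ^ 2 * deriv ζ r ^ 2 ≤ R ^ 2 * deriv ζ r ^ 2 :=
      mul_le_mul_of_nonneg_right (pow_le_pow_left₀ hr.1 hr.2 2) (sq_nonneg _)
    nlinarith [sq_nonneg (ζ r + 2 * (r * deriv ζ r))]
  rw [h0, intervalIntegral.integral_sub (Continuous.intervalIntegrable (by fun_prop) _ _)
    (Continuous.intervalIntegrable (by fun_prop) _ _), intervalIntegral.integral_const_mul,
    intervalIntegral.integral_const_mul] at h1
  linarith

theorem le_cutoffQuotient (h : IsCutoff R ζ) (hR : 0 < R) {k β p₀ : ℝ} (hk : 2 ≤ k) (hβ : 0 < β)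
    (hp₀ : 0 < p₀) : p₀ / (4 * R ^ 2) ≤ cutoffQuotient k β p₀ R ζ := by
  have hc := h.continuous
  have hc' := h.continuous_deriv
  have hrk : Continuous fun r : ℝ => r ^ k := Real.continuous_rpow_const (by linarith)
  rw [cutoffQuotient, div_le_div_iff₀ (by positivity) (h.integral_sq_pos hR)]
  have h1 : p₀ * ∫ r in (0 : ℝ)..R, deriv ζ r ^ 2 ≤
      ∫ r in (0 : ℝ)..R, (p₀ + β * r ^ k) * deriv ζ r ^ 2 := by
    rw [← intervalIntegral.integral_const_mul]
    refine intervalIntegral.integral_mono_on hR.le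
      (Continuous.intervalIntegrable (by fun_prop) _ _)
      (Continuous.intervalIntegrable (by fun_prop) _ _) fun r hr => ?_
    have : 0 ≤ β * r ^ k := mul_nonneg hβ.le (Real.rpow_nonneg hr.1 _)
    gcongr
    linarith
  have h2 : 0 ≤ k * β * ∫ r in (0 : ℝ)..R, ζ r ^ 2 * r ^ (k - 2) :=
    mul_nonneg (by positivity) (intervalIntegral.integral_nonneg hR.le fun r hr =>
      mul_nonneg (sq_nonneg _) (Real.rpow_nonneg hr.1 _))
  have h3 := mul_le_mul_of_nonneg_left (h.integral_sq_le hR) hp₀.le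
  nlinarith [mul_le_mul_of_nonneg_right (add_le_add h1 h2) (by positivity : 0 ≤ 4 * R ^ 2)]

end IsCutoff

/-- A radial integral over `ℝ³` in polar coordinates. -/
theorem integral_radial (a : Euc 3) {R : ℝ} (hR : 0 ≤ R) {g : ℝ → ℝ} (hg : ∀ r, R < r → g r = 0) :
    ∫ x, g ‖x - a‖ = 4 * Real.pi * ∫ r in (0 : ℝ)..R, r ^ 2 * g r := by
  have hball : (volume : Measure (Euc 3)).real (Metric.ball 0 1) = Real.pi * 4 / 3 := by
    rw [measureReal_def, EuclideanSpace.volume_ball_fin_three]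
    have : 0 ≤ Real.pi * 4 / 3 := by positivity
    simp [this]
  rw [integral_sub_right_eq_self (fun x => g ‖x‖) a, integral_fun_norm_addHaar volume g,
    hball, finrank_euclideanSpace_fin, intervalIntegral.integral_of_le hR]
  have htail : ∫ r in Set.Ioi 0, r ^ 2 * g r = ∫ r in Set.Ioc 0 R, r ^ 2 * g r := by
    refine setIntegral_eq_of_subset_of_forall_sdiff_eq_zero measurableSet_Ioi
      Set.Ioc_subset_Ioi_self fun r hr => ?_
    have : R < r := by
      by_contra h
      exact hr.2 ⟨hr.1, not_lt.1 h⟩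
    simp [hg r this]
  simp only [nsmul_eq_mul, smul_eq_mul, show 3 - 1 = 2 from rfl]
  rw [htail]
  push_cast
  ring

theorem norm_gradient_radial (a : Euc 3) {v : ℝ → ℝ} {v' : ℝ} {x : Euc 3} (hx : x ≠ a)
    (hv : HasDerivAt v v' ‖x - a‖) : ‖gradient (fun y => v ‖y - a‖) x‖ ^ 2 = v' ^ 2 := by
  have hne : x - a ≠ 0 := sub_ne_zero.2 hx
  have hd : DifferentiableAt ℝ (fun y : Euc 3 => ‖y‖) (x - a) :=
    (contDiffAt_norm ℝ hne (n := 1)).differentiableAt one_ne_zero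
  have h1 : HasFDerivAt (fun y : Euc 3 => ‖y - a‖) (fderiv ℝ (fun y : Euc 3 => ‖y‖) (x - a)) x := by
    have := HasFDerivAt.comp (f := fun y => y - a) x hd.hasFDerivAt ((hasFDerivAt_id x).sub_const a)
    rwa [ContinuousLinearMap.comp_id] at this
  have h2 := (hv.comp_hasFDerivAt x h1).fderiv
  have h3 : fderiv ℝ (fun y => v ‖y - a‖) x = v' • fderiv ℝ (fun y : Euc 3 => ‖y‖) (x - a) := h2
  rw [gradient, LinearIsometryEquiv.norm_map, h3, norm_smul, norm_fderiv_norm hd, mul_one,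
    Real.norm_eq_abs, sq_abs]

theorem hasDerivAt_bubble_primitive {e : ℝ} (he : 0 < e) (r : ℝ) :
    HasDerivAt (fun r => (Real.arctan (r / e) / e ^ 3 +
      r * (r ^ 2 - e ^ 2) / (e ^ 2 * (e ^ 2 + r ^ 2) ^ 2)) / 8)
      (r ^ 2 / (e ^ 2 + r ^ 2) ^ 3) r := by
  have hq : e ^ 2 + r ^ 2 ≠ 0 := by positivity
  have h1 := ((hasDerivAt_id' r).div_const e).arctan.div_const (e ^ 3)
  have h2 := (hasDerivAt_id' r).fun_mul (((hasDerivAt_id' r).fun_pow 2).sub_const (e ^ 2))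
  have h3 := ((((hasDerivAt_id' r).fun_pow 2).const_add (e ^ 2)).fun_pow 2).const_mul (e ^ 2)
  have h4 := (h1.add (h2.fun_div h3 (by positivity))).div_const 8
  refine h4.congr_deriv ?_
  have : 1 + (r / e) ^ 2 = (e ^ 2 + r ^ 2) / e ^ 2 := by field_simp
  rw [this]
  field_simp
  ring

theorem tendsto_bubble_primitive {e : ℝ} (he : 0 < e) :
    Tendsto (fun r => (Real.arctan (r / e) / e ^ 3 +
      r * (r ^ 2 - e ^ 2) / (e ^ 2 * (e ^ 2 + r ^ 2) ^ 2)) / 8) atTop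
      (𝓝 (Real.pi / (16 * e ^ 3))) := by
  have h1 : Tendsto (fun r : ℝ => Real.arctan (r / e)) atTop (𝓝 (Real.pi / 2)) :=
    (Real.tendsto_arctan_atTop.mono_right nhdsWithin_le_nhds).comp (tendsto_id.atTop_div_const he)
  have h2 : Tendsto (fun r : ℝ => r * (r ^ 2 - e ^ 2) / (e ^ 2 * (e ^ 2 + r ^ 2) ^ 2)) atTop
      (𝓝 0) := by
    have h3 : Tendsto (fun r : ℝ => (e ^ 2)⁻¹ * r⁻¹) atTop (𝓝 0) := by
      simpa using tendsto_inv_atTop_zero.const_mul ((e ^ 2)⁻¹)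
    refine squeeze_zero_norm' ?_ h3
    filter_upwards [eventually_gt_atTop 0] with r hr
    rw [Real.norm_eq_abs, abs_div, abs_of_pos (by positivity : 0 < e ^ 2 * (e ^ 2 + r ^ 2) ^ 2),
      abs_mul, abs_of_pos hr, ← mul_inv, div_le_iff₀ (by positivity)]
    have h4 : |r ^ 2 - e ^ 2| ≤ e ^ 2 + r ^ 2 := abs_le.2 ⟨by nlinarith, by nlinarith⟩
    have h5 : r ^ 2 ≤ e ^ 2 + r ^ 2 := by nlinarith
    calc r * |r ^ 2 - e ^ 2| = r⁻¹ * (r ^ 2 * |r ^ 2 - e ^ 2|) := by field_simp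
      _ ≤ r⁻¹ * ((e ^ 2 + r ^ 2) * (e ^ 2 + r ^ 2)) := by gcongr
      _ = _ := by field_simp
  have h6 := ((h1.div_const (e ^ 3)).add h2).div_const 8
  convert h6 using 2
  field_simp
  ring

/-- The mass of the bubble `r² / (e² + r²)³` on `(0, R)`. -/
theorem integral_bubble_bounds {e : ℝ} (he : 0 < e) {R : ℝ} (hR : 0 < R) :
    ∫ r in (0 : ℝ)..R, r ^ 2 / (e ^ 2 + r ^ 2) ^ 3 ≤ Real.pi / (16 * e ^ 3) ∧
      Real.pi / (16 * e ^ 3) - ∫ r in Set.Ioi R, r ^ (-4 : ℝ) ≤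
        ∫ r in (0 : ℝ)..R, r ^ 2 / (e ^ 2 + r ^ 2) ^ 3 := by
  have hq : ∀ r : ℝ, e ^ 2 + r ^ 2 ≠ 0 := fun r => by positivity
  have hc : Continuous fun r : ℝ => r ^ 2 / (e ^ 2 + r ^ 2) ^ 3 := by
    exact Continuous.div (by fun_prop) (by fun_prop) fun r => pow_ne_zero 3 (hq r)
  have hI := intervalIntegral.integral_eq_sub_of_hasDerivAt
    (fun r (_ : r ∈ Set.uIcc 0 R) => hasDerivAt_bubble_primitive he r) (hc.intervalIntegrable _ _)
  have hpos : ∀ r ∈ Set.Ioi R, 0 ≤ r ^ 2 / (e ^ 2 + r ^ 2) ^ 3 := fun r _ => by positivity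
  have htail := integral_Ioi_of_hasDerivAt_of_nonneg'
    (fun r (_ : r ∈ Set.Ici R) => hasDerivAt_bubble_primitive he r) hpos
    (tendsto_bubble_primitive he)
  have hint := integrableOn_Ioi_deriv_of_nonneg'
    (fun r (_ : r ∈ Set.Ici R) => hasDerivAt_bubble_primitive he r) hpos
    (tendsto_bubble_primitive he)
  have h0 := setIntegral_nonneg (μ := volume) measurableSet_Ioi hpos
  have h1 : ∫ r in Set.Ioi R, r ^ 2 / (e ^ 2 + r ^ 2) ^ 3 ≤ ∫ r in Set.Ioi R, r ^ (-4 : ℝ) := by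
    refine setIntegral_mono_on hint (integrableOn_Ioi_rpow_of_lt (by norm_num) hR)
      measurableSet_Ioi fun r hr => ?_
    have hr0 : 0 < r := hR.trans hr
    rw [Real.rpow_neg hr0.le, show (4 : ℝ) = (4 : ℕ) by norm_num, Real.rpow_natCast,
      ← one_div, div_le_div_iff₀ (by positivity) (by positivity)]
    calc r ^ 2 * r ^ 4 = (r ^ 2) ^ 3 := by ring
      _ ≤ (e ^ 2 + r ^ 2) ^ 3 := by gcongr; nlinarith
      _ = _ := (one_mul _).symm
  rw [htail] at h0 h1
  simp only [zero_div, Real.arctan_zero, zero_mul, add_zero, sub_zero] at hI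
  rw [hI]
  constructor <;> linarith

/-- Integration by parts for the weighted Dirichlet energy of `ζ(r) (e² + r²)^(-1/2)`. -/
theorem IsCutoff.integral_energy {R : ℝ} {ζ : ℝ → ℝ} (h : IsCutoff R ζ) {e : ℝ} (he : 0 < e)
    {P P' : ℝ → ℝ} (hP : ∀ r, HasDerivAt P (P' r) r) (hP' : Continuous P') :
    ∫ r in (0 : ℝ)..R, r ^ 2 * (P r * (deriv ζ r ^ 2 / (e ^ 2 + r ^ 2) -
        2 * ζ r * deriv ζ r * r / (e ^ 2 + r ^ 2) ^ 2 + ζ r ^ 2 * r ^ 2 / (e ^ 2 + r ^ 2) ^ 3)) =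
      ∫ r in (0 : ℝ)..R, (P r * deriv ζ r ^ 2 * (r ^ 2 / (e ^ 2 + r ^ 2)) +
        3 * e ^ 2 * (P r * ζ r ^ 2 * (r ^ 2 / (e ^ 2 + r ^ 2) ^ 3)) +
        P' r * ζ r ^ 2 * (r ^ 3 / (e ^ 2 + r ^ 2) ^ 2)) := by
  have hc := h.continuous
  have hc' := h.continuous_deriv
  have hPc : Continuous P := continuous_iff_continuousAt.2 fun r => (hP r).continuousAt
  have hq : ∀ r : ℝ, e ^ 2 + r ^ 2 ≠ 0 := fun r => by positivity
  have hi : ∀ m : ℕ, Continuous fun r : ℝ => ((e ^ 2 + r ^ 2) ^ m)⁻¹ := fun m =>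
    Continuous.inv₀ (by fun_prop) fun r => pow_ne_zero m (hq r)
  have hi1 : Continuous fun r : ℝ => (e ^ 2 + r ^ 2)⁻¹ := by simpa using hi 1
  have hi2 := hi 2
  have hi3 := hi 3
  have hF : ∀ r, HasDerivAt (fun r => P r * ζ r ^ 2 * r ^ 3 / (e ^ 2 + r ^ 2) ^ 2)
      (P' r * ζ r ^ 2 * r ^ 3 / (e ^ 2 + r ^ 2) ^ 2 +
        2 * P r * ζ r * deriv ζ r * r ^ 3 / (e ^ 2 + r ^ 2) ^ 2 +
        P r * ζ r ^ 2 * (3 * r ^ 2 / (e ^ 2 + r ^ 2) ^ 2 - 4 * r ^ 4 / (e ^ 2 + r ^ 2) ^ 3)) r := by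
    intro r
    have hq' := hq r
    have := ((((hP r).fun_mul ((h.hasDerivAt r).fun_pow 2)).fun_mul
      ((hasDerivAt_id' r).fun_pow 3))).fun_div
      ((((hasDerivAt_id' r).fun_pow 2).const_add (e ^ 2)).fun_pow 2) (pow_ne_zero 2 hq')
    refine this.congr_deriv ?_
    field_simp
    ring
  have h0 := intervalIntegral.integral_eq_sub_of_hasDerivAt (fun r (_ : r ∈ Set.uIcc 0 R) => hF r)
    (Continuous.intervalIntegrable (by simp only [div_eq_mul_inv]; fun_prop) _ _)
  simp only [h.2.2.2 R le_rfl] at h0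
  norm_num at h0
  refine sub_eq_zero.1 (Eq.trans ?_ (neg_eq_zero.2 h0))
  rw [← intervalIntegral.integral_neg, ← intervalIntegral.integral_sub
    (Continuous.intervalIntegrable (by simp only [div_eq_mul_inv]; fun_prop) _ _)
    (Continuous.intervalIntegrable (by simp only [div_eq_mul_inv]; fun_prop) _ _)]
  refine intervalIntegral.integral_congr fun r _ => ?_
  have hq' := hq r
  field_simp
  ring

/-- The limit `e → 0` of the lower order part of the energy. -/
theorem tendsto_integral_bubble_weights {R : ℝ} (hR : 0 ≤ R) {A B C : ℝ → ℝ} (hA : Continuous A)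
    (hB : Continuous B) (hC : Continuous C) :
    Tendsto (fun e : ℝ => ∫ r in (0 : ℝ)..R, (A r * (r ^ 2 / (e ^ 2 + r ^ 2)) +
        B r * (e ^ 2 / (e ^ 2 + r ^ 2) * (r ^ 2 / (e ^ 2 + r ^ 2)) ^ 2) +
        C r * (r ^ 2 / (e ^ 2 + r ^ 2)) ^ 2)) (𝓝[>] 0)
      (𝓝 (∫ r in (0 : ℝ)..R, (A r + C r))) := by
  refine intervalIntegral.tendsto_integral_filter_of_dominated_convergence
    (fun r => |A r| + |B r| + |C r|) ?_ ?_ ?_ ?_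
  · filter_upwards [self_mem_nhdsWithin] with e he
    have he' : 0 < e := he
    have hi : Continuous fun r : ℝ => (e ^ 2 + r ^ 2)⁻¹ :=
      Continuous.inv₀ (by fun_prop) fun r => by positivity
    refine Continuous.aestronglyMeasurable ?_
    simp only [div_eq_mul_inv]
    fun_prop
  · filter_upwards [self_mem_nhdsWithin] with e he
    have he' : 0 < e := he
    refine ae_of_all _ fun r _ => ?_
    have hq : 0 < e ^ 2 + r ^ 2 := by positivity
    have s0 : 0 ≤ r ^ 2 / (e ^ 2 + r ^ 2) := by positivity
    have s1 : r ^ 2 / (e ^ 2 + r ^ 2) ≤ 1 := by rw [div_le_one hq]; nlinarith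
    have t0 : 0 ≤ e ^ 2 / (e ^ 2 + r ^ 2) := by positivity
    have t1 : e ^ 2 / (e ^ 2 + r ^ 2) ≤ 1 := by rw [div_le_one hq]; nlinarith
    have s2 : (r ^ 2 / (e ^ 2 + r ^ 2)) ^ 2 ≤ 1 := pow_le_one₀ s0 s1
    refine (norm_add₃_le).trans ?_
    simp only [norm_mul, Real.norm_eq_abs, abs_pow, abs_of_nonneg s0, abs_of_nonneg t0]
    have h1 : e ^ 2 / (e ^ 2 + r ^ 2) * (r ^ 2 / (e ^ 2 + r ^ 2)) ^ 2 ≤ 1 :=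
      mul_le_one₀ t1 (by positivity) s2
    gcongr
    · exact mul_le_of_le_one_right (abs_nonneg _) s1
    · exact mul_le_of_le_one_right (abs_nonneg _) h1
    · exact mul_le_of_le_one_right (abs_nonneg _) s2
  · exact Continuous.intervalIntegrable (by fun_prop) _ _
  · refine ae_of_all _ fun r hr => ?_
    rw [Set.uIoc_of_le hR] at hr
    have hr0 : (0 : ℝ) ^ 2 + r ^ 2 ≠ 0 := by have := hr.1; positivity
    have : ContinuousAt (fun e : ℝ => A r * (r ^ 2 / (e ^ 2 + r ^ 2)) +
        B r * (e ^ 2 / (e ^ 2 + r ^ 2) * (r ^ 2 / (e ^ 2 + r ^ 2)) ^ 2) +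
        C r * (r ^ 2 / (e ^ 2 + r ^ 2)) ^ 2) 0 := by
      have h1 : ContinuousAt (fun e : ℝ => r ^ 2 / (e ^ 2 + r ^ 2)) 0 :=
        ContinuousAt.div (by fun_prop) (by fun_prop) hr0
      have h2 : ContinuousAt (fun e : ℝ => e ^ 2 / (e ^ 2 + r ^ 2)) 0 :=
        ContinuousAt.div (by fun_prop) (by fun_prop) hr0
      fun_prop
    have h3 := this.tendsto.mono_left (nhdsWithin_le_nhds (s := Set.Ioi (0 : ℝ)))
    have h4 : r ^ 2 / ((0 : ℝ) ^ 2 + r ^ 2) = 1 := by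
      rw [zero_pow two_ne_zero, zero_add, div_self (pow_ne_zero 2 hr.1.ne')]
    have h5 : r ^ 2 / r ^ 2 = 1 := div_self (pow_ne_zero 2 hr.1.ne')
    simpa [h4, h5] using h3

/-- The truncated bubble `ζ(r) (e² + r²)^(-1/2)`. -/
def cutoffBubble (ζ : ℝ → ℝ) (e r : ℝ) : ℝ := ζ r * (√(e ^ 2 + r ^ 2))⁻¹

namespace IsCutoff

variable {R : ℝ} {ζ : ℝ → ℝ}

theorem deriv_eq_zero (h : IsCutoff R ζ) {r : ℝ} (hr : R < r) : deriv ζ r = 0 := by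
  have : ζ =ᶠ[𝓝 r] fun _ => 0 := by
    filter_upwards [Ioi_mem_nhds hr] with s hs using h.2.2.2 s (le_of_lt hs)
  rw [this.deriv_eq, deriv_const]

theorem hasDerivAt_cutoffBubble (h : IsCutoff R ζ) {e : ℝ} (he : 0 < e) (r : ℝ) :
    HasDerivAt (cutoffBubble ζ e) (deriv ζ r * (√(e ^ 2 + r ^ 2))⁻¹ -
      ζ r * (r / √(e ^ 2 + r ^ 2) ^ 3)) r := by
  have hq : 0 < e ^ 2 + r ^ 2 := by positivity
  have h1 := ((((hasDerivAt_id' r).fun_pow 2).const_add (e ^ 2)).sqrt hq.ne').fun_inv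
    (Real.sqrt_pos.2 hq).ne'
  refine ((h.hasDerivAt r).fun_mul h1).congr_deriv ?_
  have := (Real.sqrt_pos.2 hq).ne'
  field_simp
  ring

theorem isTest_cutoffBubble (h : IsCutoff R ζ) (hR : 0 < R) {Ω : Set (Euc 3)} {a : Euc 3}
    (hball : closure (Metric.ball a R) ⊆ Ω) {e : ℝ} (he : 0 < e) :
    IsTest Ω fun x => cutoffBubble ζ e ‖x - a‖ := by
  rw [closure_ball a hR.ne'] at hball
  have hsupp : (Function.support fun x => cutoffBubble ζ e ‖x - a‖) ⊆ Metric.closedBall a R := by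
    intro x hx
    by_contra hx'
    rw [Metric.mem_closedBall, dist_eq_norm, not_le] at hx'
    exact hx (by simp [cutoffBubble, h.2.2.2 _ hx'.le])
  refine ⟨ContDiff.mul ?_ (ContDiff.inv (ContDiff.sqrt ?_ ?_) ?_),
    HasCompactSupport.of_support_subset_isCompact (isCompact_closedBall a R) hsupp,
    (closure_minimal hsupp Metric.isClosed_closedBall).trans hball, fun h0 => ?_⟩
  · refine contDiff_iff_contDiffAt.2 fun x => ?_
    by_cases hx : x = a
    · refine (contDiffAt_const (c := (1 : ℝ))).congr_of_eventuallyEq ?_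
      subst hx
      filter_upwards [Metric.ball_mem_nhds x (half_pos hR)] with y hy
      rw [Metric.mem_ball, dist_eq_norm] at hy
      exact h.2.2.1 _ ⟨norm_nonneg _, hy.le⟩
    · exact h.1.contDiffAt.comp x
        ((contDiffAt_norm ℝ (sub_ne_zero.2 hx)).comp x (contDiffAt_id.sub contDiffAt_const))
  · exact contDiff_const.add ((contDiff_id.sub contDiff_const).norm_sq ℝ)
  · intro x
    positivity
  · intro x
    positivity
  · have h1 := congrFun h0 a
    simp only [cutoffBubble, sub_self, norm_zero, h.2.2.1 0 ⟨le_rfl, by positivity⟩,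
      Pi.zero_apply, one_mul] at h1
    have : 0 < (√(e ^ 2 + 0 ^ 2))⁻¹ := by positivity
    exact this.ne' h1

theorem integral_cutoffBubble_sq (h : IsCutoff R ζ) (hR : 0 < R) (a : Euc 3) (e : ℝ) :
    ∫ x, cutoffBubble ζ e ‖x - a‖ ^ 2 =
      4 * Real.pi * ∫ r in (0 : ℝ)..R, ζ r ^ 2 * (r ^ 2 / (e ^ 2 + r ^ 2)) := by
  rw [integral_radial a hR.le (g := fun r => cutoffBubble ζ e r ^ 2)
    fun r hr => by simp [cutoffBubble, h.2.2.2 r hr.le]]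
  congr 1
  refine intervalIntegral.integral_congr fun r _ => ?_
  simp only [cutoffBubble, mul_pow, inv_pow, Real.sq_sqrt (by positivity : 0 ≤ e ^ 2 + r ^ 2)]
  ring

theorem integral_cutoffBubble_pow_six (h : IsCutoff R ζ) (hR : 0 < R) (a : Euc 3) (e : ℝ) :
    ∫ x, cutoffBubble ζ e ‖x - a‖ ^ 6 =
      4 * Real.pi * ∫ r in (0 : ℝ)..R, ζ r ^ 6 * (r ^ 2 / (e ^ 2 + r ^ 2) ^ 3) := by
  rw [integral_radial a hR.le (g := fun r => cutoffBubble ζ e r ^ 6)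
    fun r hr => by simp [cutoffBubble, h.2.2.2 r hr.le]]
  congr 1
  refine intervalIntegral.integral_congr fun r _ => ?_
  have : √(e ^ 2 + r ^ 2) ^ 6 = (e ^ 2 + r ^ 2) ^ 3 := by
    rw [show 6 = 2 * 3 from rfl, pow_mul, Real.sq_sqrt (by positivity)]
  simp only [cutoffBubble, mul_pow, inv_pow, this]
  ring

theorem integral_gradient_cutoffBubble (h : IsCutoff R ζ) (hR : 0 < R) {Ω : Set (Euc 3)}
    (hΩ : MeasurableSet Ω) {a : Euc 3} (hball : closure (Metric.ball a R) ⊆ Ω) {p : Euc 3 → ℝ}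
    {P : ℝ → ℝ} (hp : ∀ x ∈ Ω, p x = P ‖x - a‖) {e : ℝ} (he : 0 < e) :
    ∫ x in Ω, p x * ‖gradient (fun y => cutoffBubble ζ e ‖y - a‖) x‖ ^ 2 =
      4 * Real.pi * ∫ r in (0 : ℝ)..R, r ^ 2 * (P r * (deriv ζ r ^ 2 / (e ^ 2 + r ^ 2) -
        2 * ζ r * deriv ζ r * r / (e ^ 2 + r ^ 2) ^ 2 +
          ζ r ^ 2 * r ^ 2 / (e ^ 2 + r ^ 2) ^ 3)) := by
  have hu := h.isTest_cutoffBubble hR hball he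
  rw [setIntegral_congr_fun hΩ (g := fun x => P ‖x - a‖ *
      ‖gradient (fun y => cutoffBubble ζ e ‖y - a‖) x‖ ^ 2) fun x hx => by simp only [hp x hx],
    hu.setIntegral_eq fun x hx => by simp [IsTest.gradient_eq_zero hx],
    ← integral_radial a hR.le (g := fun r => P r * (deriv ζ r ^ 2 / (e ^ 2 + r ^ 2) -
        2 * ζ r * deriv ζ r * r / (e ^ 2 + r ^ 2) ^ 2 + ζ r ^ 2 * r ^ 2 / (e ^ 2 + r ^ 2) ^ 3))
      fun r hr => by simp [h.2.2.2 r hr.le, h.deriv_eq_zero hr]]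
  refine integral_congr_ae ?_
  filter_upwards [(Set.countable_singleton a).ae_notMem volume] with x hx
  rw [norm_gradient_radial a hx (h.hasDerivAt_cutoffBubble he _)]
  congr 1
  have hq : 0 < e ^ 2 + ‖x - a‖ ^ 2 := by positivity
  set s := √(e ^ 2 + ‖x - a‖ ^ 2) with hs
  have hs0 : s ≠ 0 := (Real.sqrt_pos.2 hq).ne'
  rw [← Real.sq_sqrt hq.le, ← hs]
  field_simp
  ring

end IsCutoff

theorem sharpSobolev_mul_rpow_ge {e C J : ℝ} (he : 0 < e) (hC : 0 ≤ C)
    (hsmall : 16 * C * e ^ 3 ≤ Real.pi) (hJ : Real.pi / (16 * e ^ 3) - C ≤ J) :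
    3 * Real.pi ^ 2 / (4 * e) - 12 * Real.pi * C * e ^ 2 ≤
      sharpSobolev * (4 * Real.pi * J) ^ (1 / 3 : ℝ) := by
  have hpi := Real.pi_pos
  have hρ : 0 < (Real.pi ^ 2 / 4) ^ (1 / 3 : ℝ) := by positivity
  have hρ3 : ((Real.pi ^ 2 / 4) ^ (1 / 3 : ℝ)) ^ 3 = Real.pi ^ 2 / 4 := by
    rw [← Real.rpow_natCast, ← Real.rpow_mul (by positivity)]
    norm_num
  rw [sharpSobolev]
  set ρ := (Real.pi ^ 2 / 4) ^ (1 / 3 : ℝ)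
  set X := 1 - 16 * C * e ^ 3 / Real.pi with hX
  have hX0 : 0 ≤ X := by
    rw [hX, sub_nonneg, div_le_one hpi]
    exact hsmall
  have hX1 : X ≤ 1 := by
    rw [hX]
    have : 0 ≤ 16 * C * e ^ 3 / Real.pi := by positivity
    linarith
  have hle : ρ * X / e ≤ (4 * Real.pi * J) ^ (1 / 3 : ℝ) := by
    have h1 : (ρ * X / e) ^ 3 ≤ 4 * Real.pi * J := by
      calc (ρ * X / e) ^ 3 = Real.pi ^ 2 / 4 / e ^ 3 * X ^ 3 := by rw [← hρ3]; ring
        _ ≤ Real.pi ^ 2 / 4 / e ^ 3 * X := by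
            gcongr
            exact pow_le_of_le_one hX0 hX1 three_ne_zero
        _ = 4 * Real.pi * (Real.pi / (16 * e ^ 3) - C) := by rw [hX]; field_simp; ring
        _ ≤ _ := by gcongr
    calc ρ * X / e = ((ρ * X / e) ^ 3) ^ (1 / 3 : ℝ) := by
          rw [← Real.rpow_natCast, ← Real.rpow_mul (by positivity)]
          norm_num
      _ ≤ _ := Real.rpow_le_rpow (by positivity) h1 (by norm_num)
  calc 3 * Real.pi ^ 2 / (4 * e) - 12 * Real.pi * C * e ^ 2 = 3 * ρ ^ 3 * X / e := by
        rw [hρ3, hX]; field_simp; ring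
    _ = 3 * ρ ^ 2 * (ρ * X / e) := by ring
    _ ≤ _ := by gcongr

namespace IsCutoff

variable {R : ℝ} {ζ : ℝ → ℝ}

theorem integral_sq_bubble_le (h : IsCutoff R ζ) (hR : 0 < R) {e : ℝ} (he : 0 < e) :
    ∫ r in (0 : ℝ)..R, ζ r ^ 2 * (r ^ 2 / (e ^ 2 + r ^ 2) ^ 3) ≤ Real.pi / (16 * e ^ 3) := by
  have hc := h.continuous
  have hi : Continuous fun r : ℝ => r ^ 2 / (e ^ 2 + r ^ 2) ^ 3 :=
    Continuous.div (by fun_prop) (by fun_prop) fun r => by positivity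
  refine le_trans ?_ (integral_bubble_bounds he hR).1
  refine intervalIntegral.integral_mono_on hR.le (Continuous.intervalIntegrable (by fun_prop) _ _)
    (hi.intervalIntegrable _ _) fun r _ => ?_
  exact mul_le_of_le_one_left (by positivity) (pow_le_one₀ (h.2.1 r).1 (h.2.1 r).2)

theorem le_integral_pow_six_bubble (h : IsCutoff R ζ) (hR : 0 < R) {e : ℝ} (he : 0 < e) :
    Real.pi / (16 * e ^ 3) - ∫ r in Set.Ioi (R / 2), r ^ (-4 : ℝ) ≤
      ∫ r in (0 : ℝ)..R, ζ r ^ 6 * (r ^ 2 / (e ^ 2 + r ^ 2) ^ 3) := by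
  have hc := h.continuous
  have hi : Continuous fun r : ℝ => r ^ 2 / (e ^ 2 + r ^ 2) ^ 3 :=
    Continuous.div (by fun_prop) (by fun_prop) fun r => by positivity
  have hi6 : Continuous fun r => ζ r ^ 6 * (r ^ 2 / (e ^ 2 + r ^ 2) ^ 3) := by fun_prop
  refine (integral_bubble_bounds he (half_pos hR)).2.trans ?_
  rw [← intervalIntegral.integral_add_adjacent_intervals (hi6.intervalIntegrable 0 (R / 2))
    (hi6.intervalIntegrable (R / 2) R)]
  have h1 : 0 ≤ ∫ r in (R / 2)..R, ζ r ^ 6 * (r ^ 2 / (e ^ 2 + r ^ 2) ^ 3) :=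
    intervalIntegral.integral_nonneg (by linarith) fun r _ =>
      mul_nonneg (pow_nonneg (h.2.1 r).1 6) (by positivity)
  have h2 : ∫ r in (0 : ℝ)..(R / 2), ζ r ^ 6 * (r ^ 2 / (e ^ 2 + r ^ 2) ^ 3) =
      ∫ r in (0 : ℝ)..(R / 2), r ^ 2 / (e ^ 2 + r ^ 2) ^ 3 := by
    refine intervalIntegral.integral_congr fun r hr => ?_
    rw [Set.uIcc_of_le (by positivity)] at hr
    simp only [h.2.2.1 r hr, one_pow, one_mul]
  linarith

/-- The numerator of the quotient of `S_λ(p)` at a truncated bubble. -/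
theorem energy_cutoffBubble (h : IsCutoff R ζ) (hR : 0 < R) {Ω : Set (Euc 3)}
    (hΩ : MeasurableSet Ω) {a : Euc 3} (hball : closure (Metric.ball a R) ⊆ Ω) {p : Euc 3 → ℝ}
    {k β p₀ : ℝ} (hk : 2 ≤ k) (hp : ∀ x ∈ Ω, p x = p₀ + β * ‖x - a‖ ^ k) (lam : ℝ) {e : ℝ}
    (he : 0 < e) :
    (∫ x in Ω, p x * ‖gradient (fun y => cutoffBubble ζ e ‖y - a‖) x‖ ^ 2) -
        lam * ∫ x, cutoffBubble ζ e ‖x - a‖ ^ 2 =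
      4 * Real.pi * (3 * e ^ 2 * p₀ *
          (∫ r in (0 : ℝ)..R, ζ r ^ 2 * (r ^ 2 / (e ^ 2 + r ^ 2) ^ 3)) +
        ∫ r in (0 : ℝ)..R,
          (((p₀ + β * r ^ k) * deriv ζ r ^ 2 - lam * ζ r ^ 2) * (r ^ 2 / (e ^ 2 + r ^ 2)) +
          3 * β * (ζ r ^ 2 * r ^ (k - 2)) *
            (e ^ 2 / (e ^ 2 + r ^ 2) * (r ^ 2 / (e ^ 2 + r ^ 2)) ^ 2) +
          k * β * (ζ r ^ 2 * r ^ (k - 2)) * (r ^ 2 / (e ^ 2 + r ^ 2)) ^ 2)) := by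
  have hc := h.continuous
  have hc' := h.continuous_deriv
  have hq : ∀ r : ℝ, e ^ 2 + r ^ 2 ≠ 0 := fun r => by positivity
  have hi : Continuous fun r : ℝ => (e ^ 2 + r ^ 2)⁻¹ := Continuous.inv₀ (by fun_prop) hq
  have hrk : Continuous fun r : ℝ => r ^ k := Real.continuous_rpow_const (by linarith)
  have hrk1 : Continuous fun r : ℝ => r ^ (k - 1) := Real.continuous_rpow_const (by linarith)
  have hrk2 : Continuous fun r : ℝ => r ^ (k - 2) := Real.continuous_rpow_const (by linarith)
  have hi3 : Continuous fun r : ℝ => ((e ^ 2 + r ^ 2) ^ 3)⁻¹ := by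
    simp only [← inv_pow]
    fun_prop
  have hi2 : Continuous fun r : ℝ => ((e ^ 2 + r ^ 2) ^ 2)⁻¹ := by
    simp only [← inv_pow]
    fun_prop
  rw [h.integral_gradient_cutoffBubble hR hΩ hball (P := fun r => p₀ + β * r ^ k) hp he,
    h.integral_cutoffBubble_sq hR a e, h.integral_energy he (P' := fun r => β * (k * r ^ (k - 1)))
      (fun r => ((Real.hasDerivAt_rpow_const (Or.inr (by linarith))).const_mul β).const_add p₀)
      (by fun_prop), mul_left_comm lam, ← mul_sub, ← intervalIntegral.integral_const_mul,
    ← intervalIntegral.integral_const_mul, ← intervalIntegral.integral_sub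
      (Continuous.intervalIntegrable (by simp only [div_eq_mul_inv]; fun_prop) _ _)
      (Continuous.intervalIntegrable (by simp only [div_eq_mul_inv]; fun_prop) _ _),
    ← intervalIntegral.integral_add
      (Continuous.intervalIntegrable (by simp only [div_eq_mul_inv]; fun_prop) _ _)
      (Continuous.intervalIntegrable (by simp only [div_eq_mul_inv]; fun_prop) _ _)]
  congr 1
  refine intervalIntegral.integral_congr_ae (ae_of_all _ fun r hr => ?_)
  rw [Set.uIoc_of_le hR.le] at hr
  have hr0 : 0 < r := hr.1
  have h0 : r ^ k = r ^ (k - 2) * r ^ 2 := by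
    rw [← Real.rpow_natCast r 2, ← Real.rpow_add hr0]
    norm_num
  have h1 : r ^ (k - 1) = r ^ (k - 2) * r := by
    rw [← Real.rpow_add_one hr0.ne']
    ring_nf
  simp only [h0, h1]
  have := hq r
  field_simp
  ring

theorem Slam_lt (h : IsCutoff R ζ) (hR : 0 < R) {Ω : Set (Euc 3)} (hΩo : IsOpen Ω)
    (hΩb : Bornology.IsBounded Ω) {a : Euc 3} (hball : closure (Metric.ball a R) ⊆ Ω)
    {p : Euc 3 → ℝ} {k β p₀ : ℝ} (hk : 2 ≤ k) (hβ : 0 < β) (hp₀ : 0 < p₀)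
    (hp : ∀ x ∈ Ω, p x = p₀ + β * ‖x - a‖ ^ k) {lam : ℝ} (hlam0 : 0 ≤ lam)
    (hlam : cutoffQuotient k β p₀ R ζ < lam) : Slam Ω p 6 lam < p₀ * sharpSobolev := by
  have hc := h.continuous
  have hc' := h.continuous_deriv
  have hrk : Continuous fun r : ℝ => r ^ k := Real.continuous_rpow_const (by linarith)
  have hrk2 : Continuous fun r : ℝ => r ^ (k - 2) := Real.continuous_rpow_const (by linarith)
  have hlim := tendsto_integral_bubble_weights hR.le
    (A := fun r => (p₀ + β * r ^ k) * deriv ζ r ^ 2 - lam * ζ r ^ 2)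
    (B := fun r => 3 * β * (ζ r ^ 2 * r ^ (k - 2))) (C := fun r => k * β * (ζ r ^ 2 * r ^ (k - 2)))
    (by fun_prop) (by fun_prop) (by fun_prop)
  have hneg : ∫ r in (0 : ℝ)..R, ((p₀ + β * r ^ k) * deriv ζ r ^ 2 - lam * ζ r ^ 2 +
      k * β * (ζ r ^ 2 * r ^ (k - 2))) < 0 := by
    rw [cutoffQuotient, div_lt_iff₀ (h.integral_sq_pos hR)] at hlam
    rw [intervalIntegral.integral_add (Continuous.intervalIntegrable (by fun_prop) _ _)
      (Continuous.intervalIntegrable (by fun_prop) _ _), intervalIntegral.integral_sub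
      (Continuous.intervalIntegrable (by fun_prop) _ _)
      (Continuous.intervalIntegrable (by fun_prop) _ _), intervalIntegral.integral_const_mul,
      intervalIntegral.integral_const_mul]
    linarith
  set C₀ := ∫ r in Set.Ioi (R / 2), r ^ (-4 : ℝ) with hC₀
  have hC₀nn : 0 ≤ C₀ := setIntegral_nonneg measurableSet_Ioi fun r hr =>
    Real.rpow_nonneg ((half_pos hR).le.trans (le_of_lt hr)) _
  have hcorr : Tendsto (fun e : ℝ => 3 * p₀ * C₀ * e ^ 2) (𝓝[>] 0) (𝓝 0) := by
    have : Continuous fun e : ℝ => 3 * p₀ * C₀ * e ^ 2 := by fun_prop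
    simpa using (this.tendsto 0).mono_left nhdsWithin_le_nhds
  have hsmall : Tendsto (fun e : ℝ => 16 * C₀ * e ^ 3) (𝓝[>] 0) (𝓝 0) := by
    have : Continuous fun e : ℝ => 16 * C₀ * e ^ 3 := by fun_prop
    simpa using (this.tendsto 0).mono_left nhdsWithin_le_nhds
  obtain ⟨e, h1, h2, he⟩ := (((hlim.add hcorr).eventually_lt_const (by simpa using hneg)).and
    ((hsmall.eventually_lt_const Real.pi_pos).and self_mem_nhdsWithin)).exists
  have he : 0 < e := he
  have hu := h.isTest_cutoffBubble hR hball he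
  have hpnn : ∀ x ∈ Ω, 0 ≤ p x := fun x hx => by
    rw [hp x hx]
    positivity
  refine (Slam_le hΩo hΩb hpnn hlam0 hu).trans_lt ?_
  rw [div_lt_iff₀ (Real.rpow_pos_of_pos hu.integral_pow_six_pos _),
    h.energy_cutoffBubble hR hΩo.measurableSet hball hk hp lam he,
    h.integral_cutoffBubble_pow_six hR a e, mul_assoc p₀]
  refine lt_of_lt_of_le ?_ (mul_le_mul_of_nonneg_left (sharpSobolev_mul_rpow_ge he hC₀nn h2.le
    (h.le_integral_pow_six_bubble hR he)) hp₀.le)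
  have h3 := mul_le_mul_of_nonneg_left (h.integral_sq_bubble_le hR he)
    (by positivity : 0 ≤ 3 * e ^ 2 * p₀)
  have h4 : 3 * e ^ 2 * p₀ * (Real.pi / (16 * e ^ 3)) = 3 * p₀ * Real.pi / (16 * e) := by
    field_simp
  rw [h4] at h3
  have h5 := mul_lt_mul_of_pos_left (add_lt_add_of_le_of_lt h3 h1)
    (by positivity : 0 < 4 * Real.pi)
  have h6 : 4 * Real.pi * (3 * p₀ * Real.pi / (16 * e) + 0) = p₀ * (3 * Real.pi ^ 2 / (4 * e)) := by
    field_simp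
    ring
  rw [h6] at h5
  linarith

end IsCutoff

theorem stmt_9
    (Ω : Set (Euc 3)) (hΩo : IsOpen Ω) (hΩb : Bornology.IsBounded Ω)
    (a : Euc 3) (ha : a ∈ Ω)
    (k β p₀ : ℝ) (hk : 2 ≤ k) (hβ : 0 < β) (hp₀ : 0 < p₀)
    (p : Euc 3 → ℝ) (hp : ∀ x ∈ closure Ω, p x = p₀ + β * ‖x - a‖ ^ k)
    (R : ℝ) (hR : 0 < R) (hball : closure (Metric.ball a R) ⊆ Ω)
    (γ : ℝ)
    (hγ : γ = sInf {d : ℝ | ∃ ζ : ℝ → ℝ, ContDiff ℝ (⊤ : ℕ∞) ζ ∧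
      (∀ r, ζ r ∈ Set.Icc (0 : ℝ) 1) ∧ (∀ r ∈ Set.Icc (0 : ℝ) (R / 2), ζ r = 1) ∧
      (∀ r, R ≤ r → ζ r = 0) ∧
      d = ((∫ r in (0 : ℝ)..R, (p₀ + β * r ^ k) * (deriv ζ r) ^ 2) +
            k * β * ∫ r in (0 : ℝ)..R, (ζ r) ^ 2 * r ^ (k - 2)) /
           ∫ r in (0 : ℝ)..R, (ζ r) ^ 2}) :
    0 < γ ∧ ∀ lam : ℝ, γ < lam → Slam Ω p 6 lam < p₀ * SobolevS Ω 6 := by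
  obtain ⟨ζ₀, hζ₀⟩ := exists_isCutoff hR
  have hγpos : 0 < γ := by
    rw [hγ]
    refine lt_of_lt_of_le (by positivity : 0 < p₀ / (4 * R ^ 2)) (le_csInf
      ⟨_, ζ₀, hζ₀.1, hζ₀.2.1, hζ₀.2.2.1, hζ₀.2.2.2, rfl⟩ ?_)
    rintro d ⟨ζ, h1, h2, h3, h4, rfl⟩
    exact IsCutoff.le_cutoffQuotient ⟨h1, h2, h3, h4⟩ hR hk hβ hp₀
  refine ⟨hγpos, fun lam hlam => ?_⟩
  have hlam' := hlam
  rw [hγ] at hlam'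
  obtain ⟨d, ⟨ζ, h1, h2, h3, h4, rfl⟩, hd⟩ := exists_lt_of_csInf_lt
    (by exact ⟨_, ζ₀, hζ₀.1, hζ₀.2.1, hζ₀.2.2.1, hζ₀.2.2.2, rfl⟩) hlam'
  have hζ : IsCutoff R ζ := ⟨h1, h2, h3, h4⟩
  refine (hζ.Slam_lt hR hΩo hΩb hball hk hβ hp₀ (fun x hx => hp x (subset_closure hx))
    (hγpos.trans hlam).le hd).trans_le ?_
  exact mul_le_mul_of_nonneg_left
    (sharpSobolev_le_SobolevS ⟨_, hζ.isTest_cutoffBubble hR hball one_pos⟩) hp₀.le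
end
end

section
/- Suppose n ≥ 4 and p satisfies condition (A) at a with exponent k, where 0 < k < n−2, and coefficient β_k > 0. Then, as ε → 0⁺, ε^{(n−2)/2} ∫_Ω p(x)|∇u_{a,ε}(x)|² dx = p₀K₁ + A_k ε^{k/2} + o(ε^{k/2}), where K₁ = (n−2)² ∫_{ℝⁿ} |y|²/(1+|y|²)ⁿ dy and A_k = (n−2)² β_k ∫_{ℝⁿ} |y|^{k+2}/(1+|y|²)ⁿ dy (both integrals being finite). -/
open MeasureTheory Filter Asymptotics
open scoped Topology

noncomputable section

/-- Condition (A): `lim_{x→a} (p(x) - p₀)/|x-a|^k = β`. -/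
def CondA {n : ℕ} (p : Euc n → ℝ) (a : Euc n) (p₀ k β : ℝ) : Prop :=
  Tendsto (fun x => (p x - p₀) / ‖x - a‖ ^ k) (𝓝[≠] a) (𝓝 β)

theorem integrable_norm_rpow_div_one_add_norm_sq_pow {n : ℕ} {s : ℝ} (hs0 : 0 ≤ s) (hsn : s < n) :
    Integrable (fun y : Euc n => ‖y‖ ^ s / (1 + ‖y‖ ^ 2) ^ n) := by
  have hint : Integrable (fun y : Euc n => (1 + ‖y‖ ^ 2) ^ (-(2 * n - s) / 2)) :=
    integrable_rpow_neg_one_add_norm_sq (by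
      rw [finrank_euclideanSpace_fin]
      linarith)
  refine hint.mono' (Measurable.aestronglyMeasurable (by fun_prop)) (ae_of_all _ fun y => ?_)
  have hA : 0 < 1 + ‖y‖ ^ 2 := by positivity
  rw [Real.norm_of_nonneg (by positivity), div_le_iff₀ (by positivity),
    ← Real.rpow_natCast (1 + ‖y‖ ^ 2) n, ← Real.rpow_add hA]
  calc ‖y‖ ^ s = (‖y‖ ^ 2) ^ (s / 2) := by
        rw [← Real.rpow_natCast, ← Real.rpow_mul (norm_nonneg y)]
        congr 1
        push_cast
        ring
    _ ≤ (1 + ‖y‖ ^ 2) ^ (s / 2) :=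
        Real.rpow_le_rpow (by positivity) (by linarith) (by positivity)
    _ = (1 + ‖y‖ ^ 2) ^ (-(2 * n - s) / 2 + n) := by
        congr 1
        ring

section Bubble

variable {E : Type*} [NormedAddCommGroup E] [InnerProductSpace ℝ E]

theorem hasFDerivAt_bubble {ε : ℝ} (hε : 0 < ε) (m : ℝ) (a x : E) :
    HasFDerivAt (fun y => (ε + ‖y - a‖ ^ 2) ^ (-m))
      ((-(2 * m) * (ε + ‖x - a‖ ^ 2) ^ (-(m + 1))) • innerSL ℝ (x - a)) x := by
  have h := ((((hasFDerivAt_id x).sub_const a).norm_sq).const_add ε).rpow_const (p := -m)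
    (Or.inl (by simp only [id]; positivity))
  refine h.congr_fderiv ?_
  ext v
  simp only [id, smul_apply, ContinuousLinearMap.comp_apply,
    ContinuousLinearMap.id_apply, smul_eq_mul, nsmul_eq_mul]
  rw [show -m - 1 = -(m + 1) by ring]
  push_cast
  ring

theorem norm_fderiv_bubble {ε m : ℝ} (hε : 0 < ε) (hm : 0 ≤ m) (a x : E) :
    ‖(-(2 * m) * (ε + ‖x - a‖ ^ 2) ^ (-(m + 1))) • innerSL ℝ (x - a)‖ =
      2 * m * (‖x - a‖ * (ε + ‖x - a‖ ^ 2) ^ (-(m + 1))) := by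
  rw [norm_smul, innerSL_apply_norm, norm_mul, norm_neg, Real.norm_of_nonneg (by positivity),
    Real.norm_of_nonneg (by positivity)]
  ring

/-- A compactly supported cutoff equal to `1` near `a` has gradient `O(|x - a| / (1 + |x - a|²))`. -/
theorem exists_norm_fderiv_cutoff_le {a : E} {ζ : E → ℝ} (hζs : ContDiff ℝ (⊤ : ℕ∞) ζ)
    (hζc : HasCompactSupport ζ) (hζ1 : ∀ᶠ x in 𝓝 a, ζ x = 1) :
    ∃ C, 0 ≤ C ∧ ∀ x, (1 + ‖x - a‖ ^ 2) * ‖fderiv ℝ ζ x‖ ≤ C * ‖x - a‖ := by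
  obtain ⟨r, hr, hball⟩ := Metric.eventually_nhds_iff_ball.1 hζ1.eventually_nhds
  have hc : Continuous (fderiv ℝ ζ) := hζs.continuous_fderiv (by simp)
  obtain ⟨C, hC⟩ := ((hζc.fderiv ℝ).smul_left
    (f := fun x => 1 + ‖x - a‖ ^ 2)).exists_bound_of_continuous (by fun_prop)
  have hC0 : 0 ≤ C := (norm_nonneg _).trans (hC a)
  refine ⟨C / r, by positivity, fun x => ?_⟩
  by_cases hx : x ∈ Metric.ball a r
  · have h : ζ =ᶠ[𝓝 x] fun _ => (1 : ℝ) := hball x hx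
    rw [h.fderiv_eq]
    simp
    positivity
  · have hx' : r ≤ ‖x - a‖ := by simpa [dist_eq_norm] using hx
    have h1 := hC x
    simp only [Pi.smul_apply', norm_smul] at h1
    rw [Real.norm_of_nonneg (by positivity)] at h1
    calc _ ≤ C := h1
      _ = C / r * r := by field_simp
      _ ≤ _ := by gcongr

variable [CompleteSpace E]

theorem norm_gradient (f : E → ℝ) (x : E) : ‖gradient f x‖ = ‖fderiv ℝ f x‖ := by
  simp [gradient]

theorem norm_gradient_cutoff_mul_bubble_eq {ε m : ℝ} (hε : 0 < ε) (hm : 0 ≤ m) {a x : E}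
    {ζ : E → ℝ} (hζ : ∀ᶠ y in 𝓝 x, ζ y = 1) :
    ‖gradient (fun y => ζ y * (ε + ‖y - a‖ ^ 2) ^ (-m)) x‖ =
      2 * m * (‖x - a‖ * (ε + ‖x - a‖ ^ 2) ^ (-(m + 1))) := by
  have h : (fun y => ζ y * (ε + ‖y - a‖ ^ 2) ^ (-m)) =ᶠ[𝓝 x]
      fun y => (ε + ‖y - a‖ ^ 2) ^ (-m) := by
    filter_upwards [hζ] with y hy
    rw [hy, one_mul]
  rw [norm_gradient, h.fderiv_eq, (hasFDerivAt_bubble hε m a x).fderiv,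
    norm_fderiv_bubble hε hm]

theorem exists_norm_gradient_cutoff_mul_bubble_le {m : ℝ} (hm : 0 ≤ m) {a : E} {ζ : E → ℝ}
    (hζs : ContDiff ℝ (⊤ : ℕ∞) ζ) (hζc : HasCompactSupport ζ) (hζ01 : ∀ x, ζ x ∈ Set.Icc (0 : ℝ) 1)
    (hζ1 : ∀ᶠ x in 𝓝 a, ζ x = 1) :
    ∃ C, 0 ≤ C ∧ ∀ ε, 0 < ε → ε ≤ 1 → ∀ x,
      ‖gradient (fun y => ζ y * (ε + ‖y - a‖ ^ 2) ^ (-m)) x‖ ≤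
        C * (‖x - a‖ * (ε + ‖x - a‖ ^ 2) ^ (-(m + 1))) := by
  obtain ⟨C, hC0, hC⟩ := exists_norm_fderiv_cutoff_le hζs hζc hζ1
  refine ⟨2 * m + C, by positivity, fun ε hε hε1 x => ?_⟩
  have hA : 0 < ε + ‖x - a‖ ^ 2 := by positivity
  have hζd : HasFDerivAt ζ (fderiv ℝ ζ x) x :=
    ((hζs.differentiable (by simp)) x).hasFDerivAt
  rw [norm_gradient, (hζd.fun_mul (hasFDerivAt_bubble hε m a x)).fderiv]
  refine (norm_add_le _ _).trans ?_
  rw [norm_smul (ζ x), norm_fderiv_bubble hε hm, norm_smul, Real.norm_of_nonneg (hζ01 x).1,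
    Real.norm_of_nonneg (by positivity), add_mul]
  have hU : (ε + ‖x - a‖ ^ 2) ^ (-m) =
      (ε + ‖x - a‖ ^ 2) * (ε + ‖x - a‖ ^ 2) ^ (-(m + 1)) := by
    rw [show -m = 1 + -(m + 1) by ring, Real.rpow_add hA, Real.rpow_one]
  refine add_le_add (mul_le_of_le_one_left (by positivity) (hζ01 x).2) ?_
  rw [hU]
  calc _ = ((ε + ‖x - a‖ ^ 2) * ‖fderiv ℝ ζ x‖) * (ε + ‖x - a‖ ^ 2) ^ (-(m + 1)) := by ring
    _ ≤ ((1 + ‖x - a‖ ^ 2) * ‖fderiv ℝ ζ x‖) * (ε + ‖x - a‖ ^ 2) ^ (-(m + 1)) := by gcongr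
    _ ≤ (C * ‖x - a‖) * (ε + ‖x - a‖ ^ 2) ^ (-(m + 1)) :=
        mul_le_mul_of_nonneg_right (hC x) (by positivity)
    _ = _ := by ring

end Bubble

theorem norm_mul_rpow_neg_half_sq {A : ℝ} (hA : 0 < A) (t : ℝ) (n : ℕ) :
    (t * A ^ (-(((n : ℝ) - 2) / 2 + 1))) ^ 2 = t ^ 2 / A ^ n := by
  rw [mul_pow, ← Real.rpow_natCast (A ^ _), ← Real.rpow_mul hA.le, div_eq_mul_inv (t ^ 2),
    ← Real.rpow_natCast A n, ← Real.rpow_neg hA.le]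
  congr 2
  push_cast
  ring

theorem scaling_identity {ε : ℝ} (hε : 0 < ε) (n : ℕ) (t : ℝ) :
    ε ^ (((n : ℝ) - 2) / 2) * √ε ^ n * ((√ε * t) ^ 2 / (ε + (√ε * t) ^ 2) ^ n) =
      t ^ 2 / (1 + t ^ 2) ^ n := by
  have hpow : ε ^ (((n : ℝ) - 2) / 2) * √ε ^ n * ε = ε ^ n := by
    rw [Real.sqrt_eq_rpow, ← Real.rpow_natCast, ← Real.rpow_mul hε.le, ← Real.rpow_add hε]
    nth_rw 2 [← Real.rpow_one ε]
    rw [← Real.rpow_add hε, ← Real.rpow_natCast]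
    congr 1
    ring
  have hsq : (√ε * t) ^ 2 = ε * t ^ 2 := by rw [mul_pow, Real.sq_sqrt hε.le]
  have h1 : ε + ε * t ^ 2 = ε * (1 + t ^ 2) := by ring
  rw [hsq, h1, mul_pow, ← hpow]
  have h2 : ε ^ (((n : ℝ) - 2) / 2) ≠ 0 := by positivity
  have h3 : √ε ^ n ≠ 0 := by positivity
  field_simp

theorem setIntegral_eq_integral_rescaled {n : ℕ} {Ω : Set (Euc n)} (hΩ : MeasurableSet Ω)
    (f : Euc n → ℝ) (a : Euc n) {R : ℝ} (hR : 0 < R) :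
    ∫ x in Ω, f x = R ^ n * ∫ y, Ω.indicator f (a + R • y) := by
  rw [Measure.integral_comp_smul volume (fun z => Ω.indicator f (a + z)) R,
    integral_add_left_eq_self (μ := volume) (Ω.indicator f) a, integral_indicator hΩ,
    finrank_euclideanSpace_fin, abs_of_pos (by positivity), smul_eq_mul]
  field_simp

theorem stmt_10 {n : ℕ} (hn : 4 ≤ n)
    (Ω : Set (Euc n)) (hΩo : IsOpen Ω) (hΩb : Bornology.IsBounded Ω)
    (a : Euc n) (ha : a ∈ Ω)
    (p : Euc n → ℝ) (hpc : ContinuousOn p (closure Ω))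
    (p₀ : ℝ) (hp₀ : 0 < p₀) (hpa : p a = p₀) (hmin : ∀ x ∈ closure Ω, p₀ ≤ p x)
    (k β : ℝ) (hk0 : 0 < k) (hkn : k < (n : ℝ) - 2) (hβ : 0 < β)
    (hA : CondA p a p₀ k β)
    (ζ : Euc n → ℝ) (hζs : ContDiff ℝ (⊤ : ℕ∞) ζ) (hζc : HasCompactSupport ζ)
    (hζ01 : ∀ x, ζ x ∈ Set.Icc (0 : ℝ) 1) (hζsupp : tsupport ζ ⊆ Ω)
    (hζ1 : ∀ᶠ x in 𝓝 a, ζ x = 1)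
    (K₁ Ak : ℝ)
    (hK₁ : K₁ = ((n : ℝ) - 2) ^ 2 * ∫ y : Euc n, ‖y‖ ^ 2 / (1 + ‖y‖ ^ 2) ^ n)
    (hAk : Ak = ((n : ℝ) - 2) ^ 2 * β * ∫ y : Euc n, ‖y‖ ^ (k + 2) / (1 + ‖y‖ ^ 2) ^ n) :
    Integrable (fun y : Euc n => ‖y‖ ^ 2 / (1 + ‖y‖ ^ 2) ^ n) ∧
    Integrable (fun y : Euc n => ‖y‖ ^ (k + 2) / (1 + ‖y‖ ^ 2) ^ n) ∧
    (fun ε : ℝ =>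
        ε ^ (((n : ℝ) - 2) / 2) *
            (∫ x in Ω, p x *
              ‖gradient (fun y => ζ y * (ε + ‖y - a‖ ^ 2) ^ (-(((n : ℝ) - 2) / 2))) x‖ ^ 2) -
          (p₀ * K₁ + Ak * ε ^ (k / 2)))
      =o[𝓝[>] (0 : ℝ)] fun ε => ε ^ (k / 2) := by
  have hn' : (4 : ℝ) ≤ n := by exact_mod_cast hn
  have hgi : Integrable (fun y : Euc n => ‖y‖ ^ 2 / (1 + ‖y‖ ^ 2) ^ n) := by
    simpa using integrable_norm_rpow_div_one_add_norm_sq_pow (n := n) (s := 2)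
      (by norm_num) (by linarith)
  have hhi : Integrable (fun y : Euc n => ‖y‖ ^ (k + 2) / (1 + ‖y‖ ^ 2) ^ n) :=
    integrable_norm_rpow_div_one_add_norm_sq_pow (by linarith) (by linarith)
  refine ⟨hgi, hhi, ?_⟩
  set m : ℝ := ((n : ℝ) - 2) / 2 with hm
  have hm0 : 0 ≤ m := by rw [hm]; linarith
  have h2m : 2 * m = (n : ℝ) - 2 := by rw [hm]; ring
  set g : Euc n → ℝ := fun y => ‖y‖ ^ 2 / (1 + ‖y‖ ^ 2) ^ n with hg
  have hg0 : ∀ y, 0 ≤ g y := fun y => by simp only [hg]; positivity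
  have hgh : ∀ y : Euc n, ‖y‖ ^ (k + 2) / (1 + ‖y‖ ^ 2) ^ n = ‖y‖ ^ k * g y := fun y => by
    rw [Real.rpow_add_of_nonneg (norm_nonneg y) hk0.le (by norm_num)]
    simp only [hg, Real.rpow_ofNat]
    ring
  simp only [hgh] at hhi hAk
  obtain ⟨M, hM⟩ := hΩb.isCompact_closure.exists_bound_of_continuousOn hpc
  have hM0 : 0 ≤ M := (norm_nonneg _).trans (hM a (subset_closure ha))
  obtain ⟨C, hC0, hC⟩ := exists_norm_gradient_cutoff_mul_bubble_le hm0 hζs hζc hζ01 hζ1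
  have hAle : ∀ᶠ x in 𝓝 a, x ≠ a → (p x - p₀) / ‖x - a‖ ^ k ≤ β + 1 :=
    eventually_nhdsWithin_iff.1 (hA.eventually_le_const (lt_add_one β))
  obtain ⟨r, hr, hball⟩ := Metric.eventually_nhds_iff_ball.1
    (hζ1.eventually_nhds.and ((hΩo.eventually_mem ha).and hAle))
  set f : ℝ → Euc n → ℝ := fun ε x =>
    p x * ‖gradient (fun y => ζ y * (ε + ‖y - a‖ ^ 2) ^ (-m)) x‖ ^ 2 with hf
  set F : ℝ → Euc n → ℝ := fun ε y =>
    ε ^ m * √ε ^ n * Ω.indicator (f ε) (a + √ε • y) with hF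
  have hnorm : ∀ (ε : ℝ) (y : Euc n), ‖a + √ε • y - a‖ = √ε * ‖y‖ := fun ε y => by
    rw [add_sub_cancel_left, norm_smul, Real.norm_of_nonneg (Real.sqrt_nonneg ε)]
  have hscale : ∀ ε, 0 < ε → ∀ (y : Euc n) (D : ℝ), ε ^ m * √ε ^ n *
      (D * (√ε * ‖y‖ * (ε + (√ε * ‖y‖) ^ 2) ^ (-(m + 1)))) ^ 2 = D ^ 2 * g y := by
    intro ε hε y D
    rw [mul_pow, hm, norm_mul_rpow_neg_half_sq (by positivity), mul_left_comm,
      scaling_identity hε]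
  have hFbd : ∀ ε, 0 < ε → ε ≤ 1 → ∀ y, ‖F ε y‖ ≤ M * C ^ 2 * g y := by
    intro ε hε hε1 y
    simp only [hF]
    by_cases hx : a + √ε • y ∈ Ω
    · rw [Set.indicator_of_mem hx, norm_mul, Real.norm_of_nonneg (by positivity), hf, norm_mul,
        norm_pow, norm_norm]
      have h1 := hC ε hε hε1 (a + √ε • y)
      rw [hnorm] at h1
      rw [mul_assoc M, ← hscale ε hε y C, mul_left_comm M]
      gcongr
      exact hM _ (subset_closure hx)
    · rw [Set.indicator_of_notMem hx, mul_zero, norm_zero]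
      have := hg0 y
      positivity
  have hmem : ∀ (ε : ℝ) (y : Euc n), √ε * ‖y‖ < r → a + √ε • y ∈ Metric.ball a r :=
    fun ε y h => by rwa [Metric.mem_ball, dist_eq_norm, hnorm]
  have hFloc : ∀ ε, 0 < ε → ∀ y, √ε * ‖y‖ < r →
      F ε y = ((n : ℝ) - 2) ^ 2 * p (a + √ε • y) * g y := by
    intro ε hε y hy
    obtain ⟨h1, h2, -⟩ := hball _ (hmem ε y hy)
    simp only [hF]
    rw [Set.indicator_of_mem h2, hf]
    simp only
    rw [norm_gradient_cutoff_mul_bubble_eq hε hm0 h1, hnorm, mul_left_comm, hscale ε hε, h2m]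
    ring
  have hpmeas : Measurable (Ω.indicator p) := by
    classical
    rw [← Set.piecewise_eq_indicator]
    exact (hpc.mono subset_closure).measurable_piecewise continuousOn_const hΩo.measurableSet
  have hFmeas : ∀ ε, Measurable (F ε) := by
    intro ε
    have h : Measurable (Ω.indicator (f ε)) := by
      have h' : Ω.indicator (f ε) = fun x => Ω.indicator p x *
          ‖fderiv ℝ (fun y => ζ y * (ε + ‖y - a‖ ^ 2) ^ (-m)) x‖ ^ 2 := by
        ext x
        rw [← norm_gradient]
        exact Set.indicator_mul_left Ω p _
      rw [h']
      exact hpmeas.mul ((measurable_fderiv ℝ _).norm.pow_const 2)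
    exact (h.comp (by fun_prop : Measurable fun y : Euc n => a + √ε • y)).const_mul _
  have hFint : ∀ ε, 0 < ε → ε ≤ 1 → Integrable (F ε) := fun ε hε hε1 =>
    (hgi.const_mul (M * C ^ 2)).mono' (hFmeas ε).aestronglyMeasurable
      (ae_of_all _ (hFbd ε hε hε1))
  set G : ℝ → Euc n → ℝ := fun ε y =>
    (F ε y - p₀ * ((n : ℝ) - 2) ^ 2 * g y) / ε ^ (k / 2) with hG
  have hsmall : ∀ᶠ ε : ℝ in 𝓝[>] 0, 0 < ε ∧ ε ≤ 1 := Ioc_mem_nhdsGT one_pos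
  have hpow : ∀ ε, 0 < ε → ∀ y : Euc n, (√ε * ‖y‖) ^ k = ε ^ (k / 2) * ‖y‖ ^ k := by
    intro ε hε y
    rw [Real.mul_rpow (Real.sqrt_nonneg ε) (norm_nonneg y), Real.sqrt_eq_rpow,
      ← Real.rpow_mul hε.le]
    congr 2
    ring
  have hGloc : ∀ ε, 0 < ε → ∀ y, y ≠ 0 → √ε * ‖y‖ < r → G ε y =
      ((n : ℝ) - 2) ^ 2 * ((p (a + √ε • y) - p₀) / ‖a + √ε • y - a‖ ^ k) *
        (‖y‖ ^ k * g y) := by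
    intro ε hε y hy0 hy
    have hyk : ‖y‖ ^ k ≠ 0 := (Real.rpow_pos_of_pos (norm_pos_iff.2 hy0) k).ne'
    have hεk : ε ^ (k / 2) ≠ 0 := by positivity
    simp only [hG]
    rw [hFloc ε hε y hy, hnorm, hpow ε hε]
    field_simp
  have hne : ∀ ε, 0 < ε → ∀ y : Euc n, y ≠ 0 → a + √ε • y ≠ a := by
    intro ε hε y hy h
    rw [add_eq_left, smul_eq_zero] at h
    exact h.elim (Real.sqrt_pos.2 hε).ne' hy
  have hG0 : ∀ ε, 0 < ε → G ε 0 = 0 := by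
    intro ε hε
    simp only [hG]
    rw [hFloc ε hε 0 (by simpa using hr)]
    simp [hg]
  have hlim : Tendsto (fun ε => ∫ y, G ε y) (𝓝[>] 0)
      (𝓝 (∫ y, ((n : ℝ) - 2) ^ 2 * β * (‖y‖ ^ k * g y))) := by
    refine tendsto_integral_filter_of_dominated_convergence
      (fun y => (((n : ℝ) - 2) ^ 2 * (β + 1) + (M * C ^ 2 + p₀ * ((n : ℝ) - 2) ^ 2) / r ^ k) *
        (‖y‖ ^ k * g y)) ?_ ?_ (hhi.const_mul _) ?_
    · refine Eventually.of_forall fun ε => Measurable.aestronglyMeasurable ?_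
      exact ((hFmeas ε).sub (by fun_prop)).div_const _
    · filter_upwards [hsmall] with ε ⟨hε, hε1⟩
      refine ae_of_all _ fun y => ?_
      have hh0 : 0 ≤ ‖y‖ ^ k * g y := mul_nonneg (by positivity) (hg0 y)
      rw [add_mul]
      by_cases hy : √ε * ‖y‖ < r
      · refine le_add_of_le_of_nonneg ?_ (by positivity)
        rcases eq_or_ne y 0 with rfl | hy0
        · rw [hG0 ε hε, norm_zero]
          positivity
        · obtain ⟨-, h2, h3⟩ := hball _ (hmem ε y hy)
          have hpos := sub_nonneg.2 (hmin _ (subset_closure h2))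
          rw [hGloc ε hε y hy0 hy, Real.norm_of_nonneg (by positivity)]
          gcongr
          exact h3 (hne ε hε y hy0)
      · refine le_add_of_nonneg_of_le (by positivity) ?_
        have hrk : r ^ k ≤ ε ^ (k / 2) * ‖y‖ ^ k := by
          rw [← hpow ε hε]
          exact Real.rpow_le_rpow hr.le (not_lt.1 hy) hk0.le
        have hεk : 0 < ε ^ (k / 2) := by positivity
        have hrk0 : 0 < r ^ k := by positivity
        have hnum : ‖F ε y - p₀ * ((n : ℝ) - 2) ^ 2 * g y‖ ≤
            (M * C ^ 2 + p₀ * ((n : ℝ) - 2) ^ 2) * g y := by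
          refine (norm_sub_le _ _).trans ?_
          rw [add_mul, Real.norm_of_nonneg (mul_nonneg (by positivity) (hg0 y))]
          exact add_le_add_left (hFbd ε hε hε1 y) _
        simp only [hG]
        rw [norm_div, Real.norm_of_nonneg hεk.le, div_le_iff₀ hεk]
        refine hnum.trans ?_
        have hgy := hg0 y
        calc _ = (M * C ^ 2 + p₀ * ((n : ℝ) - 2) ^ 2) * g y / r ^ k * r ^ k := by field_simp
          _ ≤ (M * C ^ 2 + p₀ * ((n : ℝ) - 2) ^ 2) * g y / r ^ k *
              (ε ^ (k / 2) * ‖y‖ ^ k) := by gcongr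
          _ = _ := by ring
    · refine ae_of_all _ fun y => ?_
      rcases eq_or_ne y 0 with rfl | hy0
      · have h0 : ((n : ℝ) - 2) ^ 2 * β * (‖(0 : Euc n)‖ ^ k * g 0) = 0 := by simp [hg]
        rw [h0]
        refine tendsto_const_nhds.congr' ?_
        filter_upwards [hsmall] with ε hε using (hG0 ε hε.1).symm
      · have hsq : Tendsto (fun ε : ℝ => √ε) (𝓝[>] 0) (𝓝 0) := by
          simpa using (Real.continuous_sqrt.tendsto 0).mono_left nhdsWithin_le_nhds
        have hsy : Tendsto (fun ε : ℝ => √ε * ‖y‖) (𝓝[>] 0) (𝓝 0) := by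
          simpa using hsq.mul_const ‖y‖
        have hx : Tendsto (fun ε : ℝ => a + √ε • y) (𝓝[>] 0) (𝓝[≠] a) := by
          refine tendsto_nhdsWithin_iff.2 ⟨by simpa using (hsq.smul_const y).const_add a, ?_⟩
          filter_upwards [hsmall] with ε hε using hne ε hε.1 y hy0
        have hmain := ((hA.comp hx).const_mul (((n : ℝ) - 2) ^ 2)).mul_const (‖y‖ ^ k * g y)
        refine hmain.congr' ?_
        filter_upwards [hsmall, hsy.eventually_lt_const hr] with ε hε hy
        exact (hGloc ε hε.1 y hy0 hy).symm
  rw [integral_const_mul, ← hAk] at hlim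
  rw [isLittleO_iff_tendsto']
  · have hlim0 := hlim.sub_const Ak
    rw [sub_self] at hlim0
    refine hlim0.congr' ?_
    filter_upwards [hsmall] with ε ⟨hε, hε1⟩
    have hεk : ε ^ (k / 2) ≠ 0 := by positivity
    rw [integral_div, integral_sub (hFint ε hε hε1) (hgi.const_mul _), integral_const_mul,
      setIntegral_eq_integral_rescaled hΩo.measurableSet (f ε) a (Real.sqrt_pos.2 hε), hK₁]
    rw [integral_const_mul]
    field_simp
    ring
  · filter_upwards [hsmall] with ε hε h
    exact absurd h (Real.rpow_pos_of_pos hε.1 _).ne'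
end
end

section
/- Suppose n = 4 and p satisfies condition (A) at a with exponent k = 2 and coefficient β₂ > 0, and suppose the function θ(x) := (p(x) − p₀)/|x−a|² − β₂ satisfies ∫_{B(a,ρ)} θ(x)/|x−a|⁴ dx < ∞ for some ρ > 0 with B(a,ρ) ⊂ Ω. Then there exist C > 0 and ε₀ > 0 such that for all 0 < ε < ε₀, | ∫_Ω p(x)|∇u_{a,ε}(x)|² dx − p₀K₁/ε − 2β₂ω₄ |log ε| | ≤ C, where K₁ = 4∫_{ℝ⁴} |y|²/(1+|y|²)⁴ dy and ω₄ = 2π² is the surface area of the unit sphere S³ ⊂ ℝ⁴. -/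
open MeasureTheory Filter Asymptotics
open scoped Topology

noncomputable section

theorem volume_real_ball_euc_four :
    (volume : Measure (Euc 4)).real (Metric.ball 0 1) = Real.pi ^ 2 / 2 := by
  rw [Measure.real, EuclideanSpace.volume_ball]
  norm_num
  rw [show Real.sqrt Real.pi ^ 4 = (Real.sqrt Real.pi ^ 2) ^ 2 by ring,
    Real.sq_sqrt Real.pi_pos.le, ENNReal.toReal_ofReal (by positivity)]

theorem integral_comp_norm_euc_four (f : ℝ → ℝ) :
    ∫ x : Euc 4, f ‖x‖ = 2 * Real.pi ^ 2 * ∫ r in Set.Ioi (0 : ℝ), r ^ 3 * f r := by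
  rw [integral_fun_norm_addHaar, volume_real_ball_euc_four]
  simp
  ring

theorem setIntegral_ball_comp_norm_euc_four (a : Euc 4) {δ : ℝ} (hδ : 0 ≤ δ) (f : ℝ → ℝ) :
    ∫ x in Metric.ball a δ, f ‖x - a‖ =
      2 * Real.pi ^ 2 * ∫ r in (0 : ℝ)..δ, r ^ 3 * f r := by
  have h : (Metric.ball a δ).indicator (fun x => f ‖x - a‖) =
      fun x => (Set.Iio δ).indicator f ‖x - a‖ := by
    ext x
    simp [Set.indicator, dist_eq_norm]
  rw [← integral_indicator Metric.isOpen_ball.measurableSet, h,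
    integral_sub_right_eq_self (fun x : Euc 4 => (Set.Iio δ).indicator f ‖x‖) a,
    integral_comp_norm_euc_four, intervalIntegral.integral_of_le hδ,
    integral_Ioc_eq_integral_Ioo, ← Set.Ioi_inter_Iio,
    ← setIntegral_indicator measurableSet_Iio]
  congr 2
  ext r
  simp [Set.indicator]

theorem integral_pow_five_div {ε : ℝ} (hε : 0 < ε) (δ : ℝ) :
    ∫ r in (0 : ℝ)..δ, r ^ 3 * (4 * r ^ 2 / (ε + r ^ 2) ^ 4) =
      2 / 3 / ε * (δ ^ 2 / (ε + δ ^ 2)) ^ 3 := by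
  have hd : ∀ r : ℝ, HasDerivAt (fun r => 2 / 3 / ε * (r ^ 2 / (ε + r ^ 2)) ^ 3)
      (r ^ 3 * (4 * r ^ 2 / (ε + r ^ 2) ^ 4)) r := by
    intro r
    have h0 : ε + r ^ 2 ≠ 0 := by positivity
    have h1 : HasDerivAt (fun r : ℝ => r ^ 2) (2 * r) r := by simpa using hasDerivAt_pow 2 r
    refine (((h1.div (h1.const_add ε) h0).pow 3).const_mul (2 / 3 / ε)).congr_deriv ?_
    simp
    field_simp
    ring
  rw [intervalIntegral.integral_eq_sub_of_hasDerivAt (fun r _ => hd r)]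
  · simp
  · refine Continuous.intervalIntegrable ?_ _ _
    have : ∀ r : ℝ, (ε + r ^ 2) ^ 4 ≠ 0 := fun r => by positivity
    fun_prop (disch := assumption)

theorem integral_pow_seven_div {ε : ℝ} (hε : 0 < ε) (δ : ℝ) :
    ∫ r in (0 : ℝ)..δ, r ^ 3 * (4 * r ^ 4 / (ε + r ^ 2) ^ 4) =
      2 * (Real.log (ε + δ ^ 2) + 3 * (ε / (ε + δ ^ 2)) - 3 / 2 * (ε / (ε + δ ^ 2)) ^ 2
        + 1 / 3 * (ε / (ε + δ ^ 2)) ^ 3 - Real.log ε - 11 / 6) := by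
  have hd : ∀ r : ℝ, HasDerivAt (fun r => 2 * (Real.log (ε + r ^ 2) + 3 * (ε / (ε + r ^ 2))
        - 3 / 2 * (ε / (ε + r ^ 2)) ^ 2 + 1 / 3 * (ε / (ε + r ^ 2)) ^ 3))
      (r ^ 3 * (4 * r ^ 4 / (ε + r ^ 2) ^ 4)) r := by
    intro r
    have h0 : ε + r ^ 2 ≠ 0 := by positivity
    have h1 : HasDerivAt (fun r : ℝ => ε + r ^ 2) (2 * r) r := by
      simpa using (hasDerivAt_pow 2 r).const_add ε
    have h2 : HasDerivAt (fun r : ℝ => ε / (ε + r ^ 2)) _ r := (hasDerivAt_const r ε).div h1 h0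
    refine (((((h1.log h0).add (h2.const_mul 3)).sub ((h2.pow 2).const_mul (3 / 2))).add
      ((h2.pow 3).const_mul (1 / 3))).const_mul 2).congr_deriv ?_
    simp
    field_simp
    ring
  rw [intervalIntegral.integral_eq_sub_of_hasDerivAt (fun r _ => hd r)]
  · have : ε / ε = 1 := div_self hε.ne'
    simp [this]
    ring
  · refine Continuous.intervalIntegrable ?_ _ _
    have : ∀ r : ℝ, (ε + r ^ 2) ^ 4 ≠ 0 := fun r => by positivity
    fun_prop (disch := assumption)

theorem four_mul_integral_norm_sq_div :
    4 * ∫ y : Euc 4, ‖y‖ ^ 2 / (1 + ‖y‖ ^ 2) ^ 4 = 2 * Real.pi ^ 2 * (2 / 3) := by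
  have hd : ∀ r : ℝ, HasDerivAt (fun r => 1 / 6 * (r ^ 2 / (1 + r ^ 2)) ^ 3)
      (r ^ 3 * (r ^ 2 / (1 + r ^ 2) ^ 4)) r := by
    intro r
    have h0 : 1 + r ^ 2 ≠ 0 := by positivity
    have h1 : HasDerivAt (fun r : ℝ => r ^ 2) (2 * r) r := by simpa using hasDerivAt_pow 2 r
    refine (((h1.div (h1.const_add 1) h0).pow 3).const_mul (1 / 6)).congr_deriv ?_
    simp
    field_simp
    ring
  have hlim : Tendsto (fun r : ℝ => 1 / 6 * (r ^ 2 / (1 + r ^ 2)) ^ 3) atTop (𝓝 (1 / 6)) := by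
    have h1 : Tendsto (fun r : ℝ => 1 - (1 + r ^ 2)⁻¹) atTop (𝓝 (1 - 0)) :=
      (tendsto_inv_atTop_zero.comp
        (tendsto_atTop_add_const_left _ _ (tendsto_pow_atTop two_ne_zero))).const_sub 1
    have h2 := (h1.pow 3).const_mul (1 / 6 : ℝ)
    simp only [sub_zero, one_pow, mul_one] at h2
    refine h2.congr fun r => ?_
    have h0 : 1 + r ^ 2 ≠ 0 := by positivity
    congr 2
    field_simp
    ring
  rw [integral_comp_norm_euc_four (fun r => r ^ 2 / (1 + r ^ 2) ^ 4),
    integral_Ioi_of_hasDerivAt_of_nonneg' (fun r _ => hd r)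
      (fun r (hr : 0 < r) => by positivity) hlim]
  norm_num
  ring

theorem norm_gradient_eq_norm_fderiv {F : Type*} [NormedAddCommGroup F] [InnerProductSpace ℝ F]
    [CompleteSpace F] (f : F → ℝ) (x : F) : ‖gradient f x‖ = ‖fderiv ℝ f x‖ := by
  rw [← toDual_gradient, LinearIsometryEquiv.norm_map]

section InvAddNormSq

variable {F : Type*} [NormedAddCommGroup F] [InnerProductSpace ℝ F]

theorem hasFDerivAt_inv_add_norm_sub_sq {ε : ℝ} (hε : 0 < ε) (a x : F) :
    HasFDerivAt (fun y => (ε + ‖y - a‖ ^ 2)⁻¹)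
      ((-(2 / (ε + ‖x - a‖ ^ 2) ^ 2)) • innerSL ℝ (x - a)) x := by
  have h0 : ε + ‖x - a‖ ^ 2 ≠ 0 := by positivity
  have h1 : HasFDerivAt (fun y => ε + ‖y - a‖ ^ 2) _ x :=
    (((hasFDerivAt_id x).sub_const a).norm_sq).const_add ε
  refine ((hasDerivAt_inv h0).comp_hasFDerivAt x h1).congr_fderiv ?_
  ext v
  simp
  ring

theorem norm_fderiv_inv_add_norm_sub_sq {ε : ℝ} (hε : 0 < ε) (a x : F) :
    ‖fderiv ℝ (fun y => (ε + ‖y - a‖ ^ 2)⁻¹) x‖ = 2 * ‖x - a‖ / (ε + ‖x - a‖ ^ 2) ^ 2 := by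
  rw [(hasFDerivAt_inv_add_norm_sub_sq hε a x).fderiv, norm_smul, innerSL_apply_norm, norm_neg,
    Real.norm_of_nonneg (by positivity)]
  ring

theorem contDiff_inv_add_norm_sub_sq {ε : ℝ} (hε : 0 < ε) (a : F) {n : WithTop ℕ∞} :
    ContDiff ℝ n (fun y : F => (ε + ‖y - a‖ ^ 2)⁻¹) :=
  (contDiff_const.add ((contDiff_id.sub contDiff_const).norm_sq ℝ)).inv
    fun _ => by positivity

theorem norm_fderiv_mul_inv_le {ε : ℝ} (hε : 0 < ε) (a : F) {ζ : F → ℝ} {x : F} {δ M : ℝ}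
    (hδ : 0 < δ) (hx : δ ≤ ‖x - a‖) (hζ : DifferentiableAt ℝ ζ x) (hζ1 : ‖ζ x‖ ≤ 1)
    (hM : ‖fderiv ℝ ζ x‖ ≤ M) :
    ‖fderiv ℝ (fun y => ζ y * (ε + ‖y - a‖ ^ 2)⁻¹) x‖ ≤ 2 / δ ^ 3 + M / δ ^ 2 := by
  have hv := (hasFDerivAt_inv_add_norm_sub_sq hε a x).differentiableAt
  have hM0 : 0 ≤ M := (norm_nonneg _).trans hM
  have hr : 0 < ‖x - a‖ := hδ.trans_le hx
  rw [fderiv_fun_mul hζ hv]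
  refine (norm_add_le _ _).trans (add_le_add ?_ ?_)
  · rw [norm_smul, norm_fderiv_inv_add_norm_sub_sq hε]
    calc _ ≤ 1 * (2 * ‖x - a‖ / (‖x - a‖ ^ 2) ^ 2) := by
          gcongr
          linarith
      _ = 2 / ‖x - a‖ ^ 3 := by field_simp
      _ ≤ 2 / δ ^ 3 := by gcongr
  · rw [norm_smul, Real.norm_of_nonneg (by positivity)]
    calc _ ≤ (δ ^ 2)⁻¹ * M := by
          gcongr
          nlinarith
      _ = M / δ ^ 2 := by ring

end InvAddNormSq

theorem abs_sub_div_le {ε c δ : ℝ} (hε : 0 < ε) (hδ : 0 < δ) (hc : 0 ≤ c) :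
    |c / ε * (δ ^ 2 / (ε + δ ^ 2)) ^ 3 - c / ε| ≤ 3 * c / δ ^ 2 := by
  set w := δ ^ 2 / (ε + δ ^ 2) with hw
  have hw0 : 0 ≤ w := by positivity
  have hw1 : 1 - w = ε / (ε + δ ^ 2) := by
    rw [hw]
    field_simp
    ring
  have hw2 : 1 - w ≤ ε / δ ^ 2 := by
    rw [hw1]
    gcongr
    linarith
  have hw3 : 0 ≤ 1 - w := by
    rw [hw1]
    positivity
  have h3 : 1 - w ^ 3 ≤ 3 * (1 - w) := by
    nlinarith [mul_nonneg hw0 hw3, mul_nonneg hw0 (mul_nonneg hw3 hw3)]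
  have h4 : 0 ≤ 1 - w ^ 3 := by
    nlinarith [mul_nonneg hw0 hw3, mul_nonneg hw0 (mul_nonneg hw0 hw3)]
  rw [show c / ε * w ^ 3 - c / ε = -(c / ε * (1 - w ^ 3)) by ring, abs_neg,
    abs_of_nonneg (by positivity)]
  calc c / ε * (1 - w ^ 3) ≤ c / ε * (3 * (ε / δ ^ 2)) := by
        gcongr
        linarith
    _ = 3 * c / δ ^ 2 := by field_simp

theorem abs_log_add_le {ε δ : ℝ} (hε : 0 < ε) (hε1 : ε < 1) (hδ : 0 < δ) :
    abs ((Real.log (ε + δ ^ 2) + 3 * (ε / (ε + δ ^ 2)) - 3 / 2 * (ε / (ε + δ ^ 2)) ^ 2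
        + 1 / 3 * (ε / (ε + δ ^ 2)) ^ 3 - Real.log ε - 11 / 6) - |Real.log ε|)
      ≤ |Real.log (δ ^ 2)| + |Real.log (1 + δ ^ 2)| + 7 := by
  rw [abs_of_neg (Real.log_neg hε hε1)]
  set q := ε / (ε + δ ^ 2) with hq
  have hq0 : 0 ≤ q := by positivity
  have hq1 : q ≤ 1 := by
    rw [hq, div_le_one (by positivity)]
    nlinarith
  have h2 := pow_le_one₀ hq0 hq1 (n := 2)
  have h3 := pow_le_one₀ hq0 hq1 (n := 3)
  have h20 := pow_nonneg hq0 2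
  have h30 := pow_nonneg hq0 3
  have hl : Real.log (δ ^ 2) ≤ Real.log (ε + δ ^ 2) :=
    Real.log_le_log (by positivity) (by linarith)
  have hu : Real.log (ε + δ ^ 2) ≤ Real.log (1 + δ ^ 2) :=
    Real.log_le_log (by positivity) (by linarith)
  rw [abs_le]
  constructor <;>
    linarith [neg_abs_le (Real.log (δ ^ 2)), le_abs_self (Real.log (1 + δ ^ 2)),
      abs_nonneg (Real.log (δ ^ 2)), abs_nonneg (Real.log (1 + δ ^ 2))]

theorem exists_abs_setIntegral_ball_sub_le {a : Euc 4} {p : Euc 4 → ℝ} {p₀ β δ : ℝ} (hδ : 0 < δ)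
    (hp₀ : 0 ≤ p₀) (hpa : p a = p₀) (hβ : 0 ≤ β)
    (hθ : IntegrableOn
      (fun x => ((p x - p₀) / ‖x - a‖ ^ 2 - β) / ‖x - a‖ ^ 4) (Metric.ball a δ)) :
    ∃ C : ℝ, ∀ ε : ℝ, 0 < ε → ε < 1 →
      abs ((∫ x in Metric.ball a δ, p x * (4 * ‖x - a‖ ^ 2 / (ε + ‖x - a‖ ^ 2) ^ 4)) -
        p₀ * (2 * Real.pi ^ 2 * (2 / 3)) / ε - 2 * β * (2 * Real.pi ^ 2) * |Real.log ε|) ≤ C := by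
  set T := fun x => ((p x - p₀) / ‖x - a‖ ^ 2 - β) / ‖x - a‖ ^ 4 with hT
  refine ⟨3 * (p₀ * (2 * Real.pi ^ 2 * (2 / 3))) / δ ^ 2 + 2 * β * (2 * Real.pi ^ 2) *
    (|Real.log (δ ^ 2)| + |Real.log (1 + δ ^ 2)| + 7) + ∫ x in Metric.ball a δ, 4 * ‖T x‖,
    fun ε hε hε1 => ?_⟩
  have h0 : ∀ x : Euc 4, (ε + ‖x - a‖ ^ 2) ^ 4 ≠ 0 := fun x => by positivity
  have hint : ∀ f : Euc 4 → ℝ, Continuous f → IntegrableOn f (Metric.ball a δ) := fun f hf =>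
    (hf.continuousOn.integrableOn_compact (isCompact_closedBall a δ)).mono_set
      Metric.ball_subset_closedBall
  have hc : ∀ m : ℕ, Continuous fun x : Euc 4 => 4 * ‖x - a‖ ^ m / (ε + ‖x - a‖ ^ 2) ^ 4 :=
    fun m => by fun_prop (disch := assumption)
  have hb : ∀ x : Euc 4, ‖4 * ‖x - a‖ ^ 8 / (ε + ‖x - a‖ ^ 2) ^ 4‖ ≤ 4 := by
    intro x
    rw [Real.norm_of_nonneg (by positivity), div_le_iff₀ (by positivity)]
    have : (‖x - a‖ ^ 2) ^ 4 ≤ (ε + ‖x - a‖ ^ 2) ^ 4 := by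
      gcongr
      linarith
    nlinarith
  have hle : ∀ x, ‖T x * (4 * ‖x - a‖ ^ 8 / (ε + ‖x - a‖ ^ 2) ^ 4)‖ ≤ 4 * ‖T x‖ := by
    intro x
    rw [norm_mul, mul_comm]
    exact mul_le_mul_of_nonneg_right (hb x) (norm_nonneg _)
  have hT4 : IntegrableOn (fun x => 4 * ‖T x‖) (Metric.ball a δ) := hθ.norm.const_mul 4
  have h3 : IntegrableOn (fun x => T x * (4 * ‖x - a‖ ^ 8 / (ε + ‖x - a‖ ^ 2) ^ 4))
      (Metric.ball a δ) :=
    hT4.mono' (hθ.aestronglyMeasurable.mul (hc 8).aestronglyMeasurable)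
      (Eventually.of_forall hle)
  have hsplit : ∀ x, p x * (4 * ‖x - a‖ ^ 2 / (ε + ‖x - a‖ ^ 2) ^ 4) =
      p₀ * (4 * ‖x - a‖ ^ 2 / (ε + ‖x - a‖ ^ 2) ^ 4) +
        β * (4 * ‖x - a‖ ^ 4 / (ε + ‖x - a‖ ^ 2) ^ 4) +
        T x * (4 * ‖x - a‖ ^ 8 / (ε + ‖x - a‖ ^ 2) ^ 4) := by
    intro x
    rcases eq_or_ne x a with rfl | hx
    · simp
    · have : ‖x - a‖ ≠ 0 := norm_ne_zero_iff.2 (sub_ne_zero.2 hx)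
      have := h0 x
      simp only [hT]
      field_simp
      ring
  have h1 := (hint _ (hc 2)).const_mul p₀
  have h2 := (hint _ (hc 4)).const_mul β
  have hI3 : |∫ x in Metric.ball a δ, T x * (4 * ‖x - a‖ ^ 8 / (ε + ‖x - a‖ ^ 2) ^ 4)| ≤
      ∫ x in Metric.ball a δ, 4 * ‖T x‖ :=
    norm_integral_le_of_norm_le hT4 (Eventually.of_forall hle)
  simp_rw [hsplit]
  rw [integral_add (by exact h1.add h2) h3, integral_add h1 h2, integral_const_mul,
    integral_const_mul,
    setIntegral_ball_comp_norm_euc_four a hδ.le (fun r => 4 * r ^ 2 / (ε + r ^ 2) ^ 4),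
    setIntegral_ball_comp_norm_euc_four a hδ.le (fun r => 4 * r ^ 4 / (ε + r ^ 2) ^ 4),
    integral_pow_five_div hε, integral_pow_seven_div hε]
  have e1 := abs_sub_div_le (c := p₀ * (2 * Real.pi ^ 2 * (2 / 3))) hε hδ (by positivity)
  have e2 := mul_le_mul_of_nonneg_left (abs_log_add_le hε hε1 hδ)
    (show 0 ≤ 2 * β * (2 * Real.pi ^ 2) by positivity)
  rw [← abs_of_nonneg (show 0 ≤ 2 * β * (2 * Real.pi ^ 2) by positivity), ← abs_mul,
    abs_of_nonneg (show 0 ≤ 2 * β * (2 * Real.pi ^ 2) by positivity)] at e2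
  refine le_trans (le_of_eq ?_) ((abs_add_three _ _ _).trans (add_le_add (add_le_add e1 e2) hI3))
  congr 1
  ring

theorem stmt_11
    (Ω : Set (Euc 4)) (hΩo : IsOpen Ω) (hΩb : Bornology.IsBounded Ω)
    (a : Euc 4) (ha : a ∈ Ω)
    (p : Euc 4 → ℝ) (hpc : ContinuousOn p (closure Ω))
    (p₀ : ℝ) (hp₀ : 0 < p₀) (hpa : p a = p₀) (hmin : ∀ x ∈ closure Ω, p₀ ≤ p x)
    (β : ℝ) (hβ : 0 < β) (hA : CondA p a p₀ 2 β)
    (ρ : ℝ) (hρ : 0 < ρ) (hball : Metric.ball a ρ ⊆ Ω)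
    (hθ : IntegrableOn
      (fun x => ((p x - p₀) / ‖x - a‖ ^ 2 - β) / ‖x - a‖ ^ 4) (Metric.ball a ρ))
    (ζ : Euc 4 → ℝ) (hζs : ContDiff ℝ (⊤ : ℕ∞) ζ) (hζc : HasCompactSupport ζ)
    (hζ01 : ∀ x, ζ x ∈ Set.Icc (0 : ℝ) 1) (hζsupp : tsupport ζ ⊆ Ω)
    (hζ1 : ∀ᶠ x in 𝓝 a, ζ x = 1)
    (K₁ ω₄ : ℝ)
    (hK₁ : K₁ = 4 * ∫ y : Euc 4, ‖y‖ ^ 2 / (1 + ‖y‖ ^ 2) ^ 4)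
    (hω : ω₄ = 2 * Real.pi ^ 2) :
    ∃ C : ℝ, 0 < C ∧ ∃ ε₀ : ℝ, 0 < ε₀ ∧ ∀ ε : ℝ, 0 < ε → ε < ε₀ →
      abs ((∫ x in Ω, p x *
            ‖gradient (fun y => ζ y * (ε + ‖y - a‖ ^ 2) ^ (-(((4 : ℝ) - 2) / 2))) x‖ ^ 2) -
          p₀ * K₁ / ε - 2 * β * ω₄ * |Real.log ε|) ≤ C := by
  subst hω
  rw [four_mul_integral_norm_sq_div] at hK₁
  subst hK₁
  obtain ⟨δ, hδ, hδζ⟩ := Metric.eventually_nhds_iff_ball.1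
    (hζ1.and (Metric.ball_mem_nhds a hρ))
  have hδρ : Metric.ball a δ ⊆ Metric.ball a ρ := fun x hx => (hδζ x hx).2
  have hδΩ : Metric.ball a δ ⊆ Ω := hδρ.trans hball
  obtain ⟨C₁, hC₁⟩ := exists_abs_setIntegral_ball_sub_le hδ hp₀.le hpa hβ.le (hθ.mono_set hδρ)
  have hK : IsCompact (closure Ω) := hΩb.isCompact_closure
  obtain ⟨P, hP⟩ := hK.exists_bound_of_continuousOn hpc
  have hζ1' : ContDiff ℝ 1 ζ := hζs.of_le (by exact_mod_cast le_top)
  obtain ⟨M, hM⟩ := (hζ1'.continuous_fderiv one_ne_zero).bounded_above_of_compact_support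
    (hζc.fderiv (𝕜 := ℝ))
  set B := P * (2 / δ ^ 3 + M / δ ^ 2) ^ 2 * volume.real (Ω \ Metric.ball a δ) with hB
  refine ⟨|C₁| + |B| + 1, by positivity, 1, one_pos, fun ε hε hε1 => ?_⟩
  set u : Euc 4 → ℝ := fun y => ζ y * (ε + ‖y - a‖ ^ 2)⁻¹ with hu
  have hu' : (fun y => ζ y * (ε + ‖y - a‖ ^ 2) ^ (-(((4 : ℝ) - 2) / 2))) = u := by
    ext y
    rw [show -(((4 : ℝ) - 2) / 2) = -1 by norm_num, Real.rpow_neg_one]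
  rw [hu']
  simp_rw [norm_gradient_eq_norm_fderiv]
  have hucont : Continuous fun x => ‖fderiv ℝ u x‖ ^ 2 :=
    ((hζ1'.mul (contDiff_inv_add_norm_sub_sq hε a)).continuous_fderiv one_ne_zero).norm.pow 2
  have hint : IntegrableOn (fun x => p x * ‖fderiv ℝ u x‖ ^ 2) Ω :=
    ((hpc.mul hucont.continuousOn).integrableOn_compact hK).mono_set subset_closure
  have hin : ∫ x in Metric.ball a δ, p x * ‖fderiv ℝ u x‖ ^ 2 =
      ∫ x in Metric.ball a δ, p x * (4 * ‖x - a‖ ^ 2 / (ε + ‖x - a‖ ^ 2) ^ 4) := by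
    refine setIntegral_congr_fun Metric.isOpen_ball.measurableSet fun x hx => ?_
    have : u =ᶠ[𝓝 x] fun y => (ε + ‖y - a‖ ^ 2)⁻¹ := by
      filter_upwards [Metric.isOpen_ball.mem_nhds hx] with y hy
      simp [hu, (hδζ y hy).1]
    rw [this.fderiv_eq, norm_fderiv_inv_add_norm_sub_sq hε, div_pow, mul_pow, ← pow_mul]
    norm_num
  have hout : |∫ x in Ω \ Metric.ball a δ, p x * ‖fderiv ℝ u x‖ ^ 2| ≤ B := by
    rw [← Real.norm_eq_abs, hB]
    refine norm_setIntegral_le_of_norm_le_const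
      ((hΩb.subset Set.sdiff_subset).measure_lt_top) fun x hx => ?_
    have hxP := hP x (subset_closure hx.1)
    rw [norm_mul, norm_pow, norm_norm]
    refine mul_le_mul hxP ?_ (by positivity) ((norm_nonneg _).trans hxP)
    gcongr
    refine norm_fderiv_mul_inv_le hε a hδ ?_ (hζ1'.differentiable one_ne_zero x) ?_ (hM x)
    · simpa [dist_eq_norm] using hx.2
    · rw [Real.norm_of_nonneg (hζ01 x).1]
      exact (hζ01 x).2
  have hsplit : ∫ x in Ω, p x * ‖fderiv ℝ u x‖ ^ 2 =
      (∫ x in Metric.ball a δ, p x * (4 * ‖x - a‖ ^ 2 / (ε + ‖x - a‖ ^ 2) ^ 4)) +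
        ∫ x in Ω \ Metric.ball a δ, p x * ‖fderiv ℝ u x‖ ^ 2 := by
    rw [← hin, ← integral_inter_add_sdiff Metric.isOpen_ball.measurableSet hint,
      Set.inter_eq_self_of_subset_right hδΩ]
  rw [hsplit, add_sub_right_comm, add_sub_right_comm]
  refine (abs_add_le _ _).trans ?_
  linarith [hC₁ ε hε hε1, le_abs_self C₁, le_abs_self B]
end
end

section
/- Let n = 3, k ≥ 2, β_k > 0, p₀ > 0, and suppose p(x) = p₀ + β_k|x−a|^k on cl(Ω). Fix R > 0 with cl(B(a,R)) ⊂ Ω and a smooth ζ : [0,∞) → [0,1] with ζ ≡ 1 on [0,R/2] and ζ ≡ 0 on [R,∞), and set u_{a,ε}(x) = ζ(|x−a|)·(ε + |x−a|²)^{−1/2}. Then, as ε → 0⁺, ∫_Ω p(x)|∇u_{a,ε}(x)|² dx = p₀K₁ ε^{−1/2} + ω₃ ∫₀^R (p₀ + β_k r^k) ζ'(r)² dr + kβ_k ω₃ ∫₀^R ζ(r)² r^{k−2} dr + o(1), where K₁ = ∫_{ℝ³} |y|²/(1+|y|²)³ dy and ω₃ = 4π is the surface area of the unit sphere S² ⊂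 ℝ³. -/
open MeasureTheory Filter Asymptotics
open scoped Topology

noncomputable section

/-- The gradient of a radial function has norm the absolute value of the radial derivative. -/
lemma norm_gradient_comp_norm_sub {E : Type*} [NormedAddCommGroup E] [InnerProductSpace ℝ E]
    [CompleteSpace E] {φ : ℝ → ℝ} {d : ℝ} {a x : E} (hx : x ≠ a)
    (h : HasDerivAt φ d ‖x - a‖) : ‖gradient (fun y => φ ‖y - a‖) x‖ = |d| := by
  have hne : x - a ≠ 0 := sub_ne_zero.2 hx
  have : Nontrivial E := ⟨⟨x, a, hx⟩⟩
  have hn : DifferentiableAt ℝ (fun z : E => ‖z‖) (x - a) := differentiableAt_id.norm ℝ hne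
  have h1 : HasFDerivAt (fun y : E => ‖y - a‖) (fderiv ℝ (fun z : E => ‖z‖) (x - a)) x := by
    have h0 : HasFDerivAt (fun y : E => y - a) (ContinuousLinearMap.id ℝ E) x :=
      (hasFDerivAt_id x).sub_const a
    exact hn.hasFDerivAt.comp x h0
  have h2 : HasFDerivAt (fun y : E => φ ‖y - a‖)
      (d • fderiv ℝ (fun z : E => ‖z‖) (x - a)) x := h.comp_hasFDerivAt x h1
  rw [gradient, h2.fderiv, LinearIsometryEquiv.norm_map, norm_smul, norm_fderiv_norm hn, mul_one,
    Real.norm_eq_abs]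

/-- Integration in polar coordinates for radial functions on `ℝ³`. -/
lemma integral_comp_norm_euc_three (f : ℝ → ℝ) :
    ∫ x : Euc 3, f ‖x‖ = 4 * Real.pi * ∫ r in Set.Ioi (0 : ℝ), r ^ 2 * f r := by
  rw [integral_fun_norm_addHaar]
  have : volume.real (Metric.ball (0 : Euc 3) 1) = Real.pi * 4 / 3 := by
    rw [Measure.real, EuclideanSpace.volume_ball_fin_three]
    simp only [ENNReal.ofReal_one, one_pow, one_mul]
    exact ENNReal.toReal_ofReal (by positivity)
  rw [this]
  simp only [finrank_euclideanSpace, Fintype.card_fin, smul_eq_mul, nsmul_eq_mul]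
  push_cast
  ring

lemma integrableOn_pow_four_div_one_add :
    IntegrableOn (fun r : ℝ => r ^ 4 / (1 + r ^ 2) ^ 3) (Set.Ioi 0) := by
  refine (integrable_inv_one_add_sq.mono' ?_ (ae_of_all _ fun r => ?_)).integrableOn
  · exact (Continuous.div (by fun_prop) (by fun_prop)
      fun r => by positivity).aestronglyMeasurable
  · rw [Real.norm_of_nonneg (by positivity), div_le_iff₀ (by positivity)]
    have h : (1 + r ^ 2)⁻¹ * (1 + r ^ 2) ^ 3 = (1 + r ^ 2) ^ 2 := by
      field_simp
    rw [h]
    nlinarith [sq_nonneg r]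

lemma pow_four_div_scaling {ε : ℝ} (hε : 0 < ε) (r : ℝ) :
    r ^ 4 / (ε + r ^ 2) ^ 3 = ε⁻¹ *
      (((√ε)⁻¹ * r) ^ 4 / (1 + ((√ε)⁻¹ * r) ^ 2) ^ 3) := by
  have h2 : ((√ε)⁻¹ * r) ^ 2 = r ^ 2 / ε := by
    rw [mul_pow, inv_pow, Real.sq_sqrt hε.le]; ring
  have h4 : ((√ε)⁻¹ * r) ^ 4 = (r ^ 2 / ε) ^ 2 := by rw [← h2]; ring
  have : ε + r ^ 2 ≠ 0 := by positivity
  rw [h4, h2]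
  field_simp

lemma integrableOn_pow_four_div {ε : ℝ} (hε : 0 < ε) :
    IntegrableOn (fun r : ℝ => r ^ 4 / (ε + r ^ 2) ^ 3) (Set.Ioi 0) := by
  have hs : 0 < (√ε)⁻¹ := by positivity
  have h := (integrableOn_Ioi_comp_mul_left_iff
    (fun r : ℝ => r ^ 4 / (1 + r ^ 2) ^ 3) 0 hs).2
    (by simpa using integrableOn_pow_four_div_one_add)
  simp only [pow_four_div_scaling hε]
  exact h.const_mul _

lemma integral_pow_four_div {ε : ℝ} (hε : 0 < ε) :
    ∫ r in Set.Ioi (0 : ℝ), r ^ 4 / (ε + r ^ 2) ^ 3 =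
      ε ^ (-(1 : ℝ) / 2) * ∫ r in Set.Ioi (0 : ℝ), r ^ 4 / (1 + r ^ 2) ^ 3 := by
  have hs : 0 < (√ε)⁻¹ := by positivity
  simp only [pow_four_div_scaling hε]
  rw [integral_const_mul, integral_comp_mul_left_Ioi
    (fun r : ℝ => r ^ 4 / (1 + r ^ 2) ^ 3) 0 hs, mul_zero, smul_eq_mul, inv_inv, ← mul_assoc]
  congr 1
  rw [Real.sqrt_eq_rpow, ← Real.rpow_neg_one, ← Real.rpow_add hε]
  norm_num

lemma measurable_weight (ε : ℝ) : Measurable fun r : ℝ => r ^ 2 / (ε + r ^ 2) := by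
  fun_prop

lemma abs_weight_le_one {ε : ℝ} (hε : 0 < ε) (r : ℝ) : |r ^ 2 / (ε + r ^ 2)| ≤ 1 := by
  rw [abs_of_nonneg (by positivity)]
  exact div_le_one_of_le₀ (by linarith) (by positivity)

lemma tendsto_weight {r : ℝ} (hr : 0 < r) :
    Tendsto (fun ε : ℝ => r ^ 2 / (ε + r ^ 2)) (𝓝[>] 0) (𝓝 1) := by
  have h : ContinuousAt (fun ε : ℝ => r ^ 2 / (ε + r ^ 2)) 0 :=
    continuousAt_const.div (by fun_prop) (by positivity)
  have := h.tendsto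
  rw [zero_add, div_self (by positivity)] at this
  exact this.mono_left nhdsWithin_le_nhds

lemma integrable_weight_pow_mul {ε : ℝ} (hε : 0 < ε) (m : ℕ) {A : ℝ → ℝ}
    (hA : IntegrableOn A (Set.Ioi 0)) :
    IntegrableOn (fun r => (r ^ 2 / (ε + r ^ 2)) ^ m * A r) (Set.Ioi 0) := by
  refine Integrable.bdd_mul (c := 1) hA
    ((measurable_weight ε).pow_const m).aestronglyMeasurable (ae_of_all _ fun r => ?_)
  rw [norm_pow]
  exact pow_le_one₀ (norm_nonneg _) (abs_weight_le_one hε r)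

lemma tendsto_integral_weight_pow_mul (m : ℕ) {A : ℝ → ℝ} (hA : IntegrableOn A (Set.Ioi 0)) :
    Tendsto (fun ε : ℝ => ∫ r in Set.Ioi (0 : ℝ), (r ^ 2 / (ε + r ^ 2)) ^ m * A r) (𝓝[>] 0)
      (𝓝 (∫ r in Set.Ioi (0 : ℝ), A r)) := by
  refine tendsto_integral_filter_of_dominated_convergence (fun r => ‖A r‖) ?_ ?_ hA.norm ?_
  · filter_upwards [self_mem_nhdsWithin] with ε hε
    exact (integrable_weight_pow_mul hε m hA).aestronglyMeasurable
  · filter_upwards [self_mem_nhdsWithin] with ε hε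
    refine ae_of_all _ fun r => ?_
    rw [norm_mul, norm_pow]
    exact mul_le_of_le_one_left (norm_nonneg _)
      (pow_le_one₀ (norm_nonneg _) (abs_weight_le_one hε r))
  · filter_upwards [ae_restrict_mem measurableSet_Ioi] with r hr
    simpa using ((tendsto_weight hr).pow m).mul_const (A r)

/-- The radial derivative of the cut-off profile `ζ(r) (ε + r²)^(-1/2)`. -/
lemma hasDerivAt_profile {ζ : ℝ → ℝ} {d ε r : ℝ} (hε : 0 < ε) (h : HasDerivAt ζ d r) :
    HasDerivAt (fun r => ζ r * (ε + r ^ 2) ^ (-(1 : ℝ) / 2))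
      ((ε + r ^ 2) ^ (-(1 : ℝ) / 2) * (d - ζ r * r / (ε + r ^ 2))) r := by
  have hpos : 0 < ε + r ^ 2 := by positivity
  have h1 : HasDerivAt (fun r : ℝ => ε + r ^ 2) (2 * r) r := by
    simpa using (hasDerivAt_pow 2 r).const_add ε
  have h2 := h.mul (h1.rpow_const (p := -(1 : ℝ) / 2) (Or.inl hpos.ne'))
  rw [Real.rpow_sub_one hpos.ne'] at h2
  refine h2.congr_deriv ?_
  ring

lemma rpow_neg_half_sq {t : ℝ} (ht : 0 < t) : (t ^ (-(1 : ℝ) / 2)) ^ 2 = t⁻¹ := by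
  rw [← Real.rpow_natCast, ← Real.rpow_mul ht.le, ← Real.rpow_neg_one]
  norm_num

lemma deriv_eq_zero_of_eq_one {ζ : ℝ → ℝ} (hζ01 : ∀ r, ζ r ∈ Set.Icc (0 : ℝ) 1) {r : ℝ}
    (h : ζ r = 1) : deriv ζ r = 0 :=
  IsLocalMax.deriv_eq_zero (Eventually.of_forall fun x => h ▸ (hζ01 x).2)

lemma deriv_eq_zero_of_eq_zero {ζ : ℝ → ℝ} (hζ01 : ∀ r, ζ r ∈ Set.Icc (0 : ℝ) 1) {r : ℝ}
    (h : ζ r = 0) : deriv ζ r = 0 :=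
  IsLocalMin.deriv_eq_zero (Eventually.of_forall fun x => h ▸ (hζ01 x).1)

lemma integrableOn_Ioi_of_continuousOn_Icc {g : ℝ → ℝ} {c R : ℝ} (hg : ContinuousOn g (Set.Icc c R))
    (h0 : ∀ r, 0 < r → r < c → g r = 0) (hR : ∀ r, 0 < r → R < r → g r = 0) :
    IntegrableOn g (Set.Ioi 0) := by
  refine hg.integrableOn_Icc.of_forall_sdiff_eq_zero measurableSet_Ioi fun r hr => ?_
  by_cases h : c ≤ r
  · exact hR r hr.1 (not_le.1 fun h' => hr.2 ⟨h, h'⟩)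
  · exact h0 r hr.1 (not_le.1 h)

lemma integral_Ioi_eq_intervalIntegral {g : ℝ → ℝ} {R : ℝ} (hR : 0 < R)
    (h : ∀ r, R < r → g r = 0) : ∫ r in Set.Ioi (0 : ℝ), g r = ∫ r in (0 : ℝ)..R, g r := by
  rw [intervalIntegral.integral_of_le hR.le]
  refine setIntegral_eq_of_subset_of_forall_sdiff_eq_zero measurableSet_Ioi
    Set.Ioc_subset_Ioi_self fun r hr => h r ?_
  exact not_le.1 fun h' => hr.2 ⟨hr.1, h'⟩

section Cutoff

variable {k β p₀ R : ℝ} {ζ : ℝ → ℝ}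

lemma integrableOn_weight_mul_deriv_sq (hk : 2 ≤ k) (hζs : ContDiff ℝ (⊤ : ℕ∞) ζ)
    (hζ01 : ∀ r, ζ r ∈ Set.Icc (0 : ℝ) 1) (hζ0 : ∀ r, R ≤ r → ζ r = 0) :
    IntegrableOn (fun r => (p₀ + β * r ^ k) * deriv ζ r ^ 2) (Set.Ioi 0) := by
  have hd : Continuous (deriv ζ) := hζs.continuous_deriv (by simp)
  have hr : Continuous fun r : ℝ => r ^ k := Real.continuous_rpow_const (by linarith)
  refine integrableOn_Ioi_of_continuousOn_Icc (c := 0) (R := R) (by fun_prop)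
    (fun r h h' => absurd h h'.not_gt) fun r _ h => ?_
  simp [deriv_eq_zero_of_eq_zero hζ01 (hζ0 r h.le)]

lemma integrableOn_cross_term (hk : 2 ≤ k) (hR : 0 < R) (hζs : ContDiff ℝ (⊤ : ℕ∞) ζ)
    (hζ01 : ∀ r, ζ r ∈ Set.Icc (0 : ℝ) 1) (hζ1 : ∀ r ∈ Set.Icc (0 : ℝ) (R / 2), ζ r = 1)
    (hζ0 : ∀ r, R ≤ r → ζ r = 0) :
    IntegrableOn (fun r => -2 * (p₀ + β * r ^ k) * ζ r * deriv ζ r / r) (Set.Ioi 0) := by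
  have hd : Continuous (deriv ζ) := hζs.continuous_deriv (by simp)
  have hc : Continuous ζ := hζs.continuous
  have hr : Continuous fun r : ℝ => r ^ k := Real.continuous_rpow_const (by linarith)
  refine integrableOn_Ioi_of_continuousOn_Icc (c := R / 2) (R := R) ?_ (fun r h h' => ?_)
    fun r _ h => ?_
  · exact ContinuousOn.div (by fun_prop) (by fun_prop) fun r h => by
      have := h.1
      exact (by linarith : 0 < r).ne'
  · simp [deriv_eq_zero_of_eq_one hζ01 (hζ1 r ⟨h.le, h'.le⟩)]
  · simp [hζ0 r h.le]

lemma integrableOn_sq_mul_rpow (hk : 2 ≤ k) (hζs : ContDiff ℝ (⊤ : ℕ∞) ζ)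
    (hζ0 : ∀ r, R ≤ r → ζ r = 0) :
    IntegrableOn (fun r => ζ r ^ 2 * r ^ (k - 2)) (Set.Ioi 0) := by
  have hc : Continuous ζ := hζs.continuous
  have hr : Continuous fun r : ℝ => r ^ (k - 2) := Real.continuous_rpow_const (by linarith)
  refine integrableOn_Ioi_of_continuousOn_Icc (c := 0) (R := R) (by fun_prop)
    (fun r h h' => absurd h h'.not_gt) fun r _ h => ?_
  simp [hζ0 r h.le]

lemma integrableOn_sq_sub_one_div_sq (hR : 0 < R) (hζs : ContDiff ℝ (⊤ : ℕ∞) ζ)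
    (hζ01 : ∀ r, ζ r ∈ Set.Icc (0 : ℝ) 1) (hζ1 : ∀ r ∈ Set.Icc (0 : ℝ) (R / 2), ζ r = 1) :
    IntegrableOn (fun r => (ζ r ^ 2 - 1) / r ^ 2) (Set.Ioi 0) := by
  have hc : Continuous ζ := hζs.continuous
  have h : IntegrableOn (fun r => (ζ r ^ 2 - 1) / r ^ 2) (Set.Ioi (R / 2)) := by
    refine Integrable.mono' (integrableOn_Ioi_rpow_of_lt (a := -2) (by norm_num) (half_pos hR))
      (Measurable.aestronglyMeasurable (by fun_prop)) ?_
    filter_upwards [ae_restrict_mem measurableSet_Ioi] with r hr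
    have hr0 : 0 < r := (half_pos hR).trans hr
    have e : r ^ (-2 : ℝ) = 1 / r ^ 2 := by
      rw [Real.rpow_neg hr0.le, one_div]
      norm_num
    rw [e, norm_div, Real.norm_of_nonneg (sq_nonneg r)]
    gcongr
    rw [Real.norm_eq_abs, abs_le]
    obtain ⟨h0, h1⟩ := hζ01 r
    constructor <;> nlinarith
  refine h.of_forall_sdiff_eq_zero measurableSet_Ioi fun r hr => ?_
  have hr2 : r ≤ R / 2 := not_lt.1 hr.2
  simp [hζ1 r ⟨hr.1.le, hr2⟩]

/-- Integration by parts for the cross term, written as the vanishing of the integral of the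
derivative of `-(p₀ (ζ² - 1) / r + β ζ² r^(k-1))`. -/
lemma integral_cross_term_add_eq_zero (hk : 2 ≤ k) (hR : 0 < R) (hζs : ContDiff ℝ (⊤ : ℕ∞) ζ)
    (hζ01 : ∀ r, ζ r ∈ Set.Icc (0 : ℝ) 1) (hζ1 : ∀ r ∈ Set.Icc (0 : ℝ) (R / 2), ζ r = 1)
    (hζ0 : ∀ r, R ≤ r → ζ r = 0) :
    (∫ r in Set.Ioi (0 : ℝ), -2 * (p₀ + β * r ^ k) * ζ r * deriv ζ r / r) +
      p₀ * (∫ r in Set.Ioi (0 : ℝ), (ζ r ^ 2 - 1) / r ^ 2) -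
      β * (k - 1) * (∫ r in Set.Ioi (0 : ℝ), ζ r ^ 2 * r ^ (k - 2)) = 0 := by
  have hB := integrableOn_cross_term (p₀ := p₀) (β := β) hk hR hζs hζ01 hζ1 hζ0
  have hC := (integrableOn_sq_sub_one_div_sq hR hζs hζ01 hζ1).const_mul p₀
  have hD := (integrableOn_sq_mul_rpow hk hζs hζ0).const_mul (β * (k - 1))
  rw [← integral_const_mul, ← integral_const_mul, ← integral_add hB hC,
    ← integral_sub (hB.fun_add hC) hD]
  have key := integral_Ioi_of_hasDerivAt_of_tendsto (a := 0) (m := 0)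
    (f := fun r => -(p₀ * ((ζ r ^ 2 - 1) / r) + β * (ζ r ^ 2 * r ^ (k - 1))))
    (f' := fun r => -2 * (p₀ + β * r ^ k) * ζ r * deriv ζ r / r + p₀ * ((ζ r ^ 2 - 1) / r ^ 2)
      - β * (k - 1) * (ζ r ^ 2 * r ^ (k - 2))) ?_ ?_ ((hB.add hC).sub hD) ?_
  · rw [key]
    simp [Real.zero_rpow (by linarith : k - 1 ≠ 0)]
  · have hc : ContinuousWithinAt (fun r : ℝ => -(β * r ^ (k - 1))) (Set.Ici 0) 0 := by
      have hr : Continuous fun r : ℝ => r ^ (k - 1) := Real.continuous_rpow_const (by linarith)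
      exact Continuous.continuousWithinAt (by fun_prop)
    refine hc.congr_of_eventuallyEq ?_ (by simp [hζ1 0 ⟨le_rfl, by linarith⟩])
    filter_upwards [Icc_mem_nhdsGE (half_pos hR)] with r hr
    simp [hζ1 r hr]
  · intro r hr
    have hr0 : (0 : ℝ) < r := hr
    have hd : HasDerivAt ζ (deriv ζ r) r := (hζs.differentiable (by simp) r).hasDerivAt
    have h1 := (((hd.pow 2).sub_const 1).div (hasDerivAt_id r) hr0.ne').const_mul p₀
    have h2 := ((hd.pow 2).mul
      ((hasDerivAt_id r).rpow_const (p := k - 1) (Or.inl hr0.ne'))).const_mul β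
    refine (h1.add h2).neg.congr_deriv ?_
    have e1 : r ^ k = r ^ (k - 2) * r ^ 2 := by
      rw [← Real.rpow_natCast r 2, ← Real.rpow_add hr0]
      norm_num
    have e2 : r ^ (k - 1) = r ^ (k - 2) * r := by
      rw [← Real.rpow_add_one hr0.ne']
      ring_nf
    have e3 : k - 1 - 1 = k - 2 := by ring
    simp only [id, e3, e1, e2, Pi.pow_apply]
    field_simp
    ring
  · have h : Tendsto (fun r : ℝ => p₀ * r⁻¹) atTop (𝓝 0) := by
      simpa using tendsto_inv_atTop_zero.const_mul p₀
    refine h.congr' ?_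
    filter_upwards [eventually_ge_atTop R] with r hr
    simp [hζ0 r hr, neg_div]

/-- The weighted radial energy density splits off the term which is singular as `ε → 0`. -/
lemma radial_energy_density_eq {ε r : ℝ} (d : ℝ) (hε : 0 < ε) (hr : 0 < r) :
    r ^ 2 * ((p₀ + β * r ^ k) *
        ((ε + r ^ 2) ^ (-(1 : ℝ) / 2) * (d - ζ r * r / (ε + r ^ 2))) ^ 2) =
      (r ^ 2 / (ε + r ^ 2)) ^ 1 * ((p₀ + β * r ^ k) * d ^ 2) +
      (r ^ 2 / (ε + r ^ 2)) ^ 2 * (-2 * (p₀ + β * r ^ k) * ζ r * d / r) +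
      (r ^ 2 / (ε + r ^ 2)) ^ 3 * (p₀ * ((ζ r ^ 2 - 1) / r ^ 2) +
        β * (ζ r ^ 2 * r ^ (k - 2))) +
      p₀ * (r ^ 4 / (ε + r ^ 2) ^ 3) := by
  have hpos : 0 < ε + r ^ 2 := by positivity
  have e1 : r ^ k = r ^ (k - 2) * r ^ 2 := by
    rw [← Real.rpow_natCast r 2, ← Real.rpow_add hr]
    norm_num
  rw [mul_pow, rpow_neg_half_sq hpos, e1]
  field_simp
  ring

end Cutoff

/-- The energy over `Ω` of the cut-off profile reduces to a one-dimensional integral. -/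
lemma integral_energy_eq_radial {Ω : Set (Euc 3)} (hΩo : IsOpen Ω) {a : Euc 3} {k β p₀ : ℝ}
    {p : Euc 3 → ℝ} (hp : ∀ x ∈ closure Ω, p x = p₀ + β * ‖x - a‖ ^ k)
    {R : ℝ} (hball : closure (Metric.ball a R) ⊆ Ω)
    {ζ : ℝ → ℝ} (hζs : ContDiff ℝ (⊤ : ℕ∞) ζ) (hζ01 : ∀ r, ζ r ∈ Set.Icc (0 : ℝ) 1)
    (hζ0 : ∀ r, R ≤ r → ζ r = 0) {ε : ℝ} (hε : 0 < ε) :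
    ∫ x in Ω, p x *
        ‖gradient (fun y => ζ (‖y - a‖) * (ε + ‖y - a‖ ^ 2) ^ (-(1 : ℝ) / 2)) x‖ ^ 2 =
      4 * Real.pi * ∫ r in Set.Ioi (0 : ℝ), r ^ 2 * ((p₀ + β * r ^ k) *
        ((ε + r ^ 2) ^ (-(1 : ℝ) / 2) * (deriv ζ r - ζ r * r / (ε + r ^ 2))) ^ 2) := by
  set f : ℝ → ℝ := fun r => (p₀ + β * r ^ k) *
    ((ε + r ^ 2) ^ (-(1 : ℝ) / 2) * (deriv ζ r - ζ r * r / (ε + r ^ 2))) ^ 2 with hf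
  calc
    _ = ∫ x in Ω, f ‖x - a‖ := by
      refine integral_congr_ae ?_
      filter_upwards [ae_restrict_mem hΩo.measurableSet,
        ae_restrict_of_ae (Measure.ae_ne volume a)] with x hx hxa
      have hd : HasDerivAt ζ (deriv ζ ‖x - a‖) ‖x - a‖ :=
        (hζs.differentiable (by simp) _).hasDerivAt
      rw [hp x (subset_closure hx),
        norm_gradient_comp_norm_sub (φ := fun r => ζ r * (ε + r ^ 2) ^ (-(1 : ℝ) / 2)) hxa
          (hasDerivAt_profile hε hd), sq_abs]
    _ = ∫ x, f ‖x - a‖ := by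
      refine setIntegral_eq_integral_of_forall_compl_eq_zero fun x hx => ?_
      have hRx : R ≤ ‖x - a‖ := by
        rw [← dist_eq_norm]
        exact not_lt.1 fun h => hx (hball (subset_closure h))
      have h0 := hζ0 _ hRx
      simp [hf, h0, deriv_eq_zero_of_eq_zero hζ01 h0]
    _ = ∫ x : Euc 3, f ‖x‖ := integral_sub_right_eq_self (fun x : Euc 3 => f ‖x‖) a
    _ = _ := integral_comp_norm_euc_three f

theorem stmt_12
    (Ω : Set (Euc 3)) (hΩo : IsOpen Ω) (hΩb : Bornology.IsBounded Ω)
    (a : Euc 3) (ha : a ∈ Ω)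
    (k β p₀ : ℝ) (hk : 2 ≤ k) (hβ : 0 < β) (hp₀ : 0 < p₀)
    (p : Euc 3 → ℝ) (hp : ∀ x ∈ closure Ω, p x = p₀ + β * ‖x - a‖ ^ k)
    (R : ℝ) (hR : 0 < R) (hball : closure (Metric.ball a R) ⊆ Ω)
    (ζ : ℝ → ℝ) (hζs : ContDiff ℝ (⊤ : ℕ∞) ζ)
    (hζ01 : ∀ r, ζ r ∈ Set.Icc (0 : ℝ) 1)
    (hζ1 : ∀ r ∈ Set.Icc (0 : ℝ) (R / 2), ζ r = 1) (hζ0 : ∀ r, R ≤ r → ζ r = 0)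
    (K₁ ω₃ : ℝ)
    (hK₁ : K₁ = ∫ y : Euc 3, ‖y‖ ^ 2 / (1 + ‖y‖ ^ 2) ^ 3)
    (hω : ω₃ = 4 * Real.pi) :
    (fun ε : ℝ =>
        (∫ x in Ω, p x *
            ‖gradient (fun y => ζ (‖y - a‖) * (ε + ‖y - a‖ ^ 2) ^ (-(1 : ℝ) / 2)) x‖ ^ 2) -
          (p₀ * K₁ * ε ^ (-(1 : ℝ) / 2) +
            ω₃ * (∫ r in (0 : ℝ)..R, (p₀ + β * r ^ k) * (deriv ζ r) ^ 2) +
            k * β * ω₃ * ∫ r in (0 : ℝ)..R, (ζ r) ^ 2 * r ^ (k - 2)))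
      =o[𝓝[>] (0 : ℝ)] fun _ => (1 : ℝ) := by
  have hA := integrableOn_weight_mul_deriv_sq (p₀ := p₀) (β := β) hk hζs hζ01 hζ0
  have hB := integrableOn_cross_term (p₀ := p₀) (β := β) hk hR hζs hζ01 hζ1 hζ0
  have hC1 := (integrableOn_sq_sub_one_div_sq hR hζs hζ01 hζ1).const_mul p₀
  have hC2 := (integrableOn_sq_mul_rpow hk hζs hζ0).const_mul β
  have hC := hC1.fun_add hC2
  have hK : K₁ = ω₃ * ∫ r in Set.Ioi (0 : ℝ), r ^ 4 / (1 + r ^ 2) ^ 3 := by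
    rw [hK₁, hω, integral_comp_norm_euc_three fun r => r ^ 2 / (1 + r ^ 2) ^ 3]
    congr 2 with r
    ring
  have hlim := (((tendsto_integral_weight_pow_mul 1 hA).add
    (tendsto_integral_weight_pow_mul 2 hB)).add
    (tendsto_integral_weight_pow_mul 3 hC)).const_mul ω₃
  have hparts := integral_cross_term_add_eq_zero (p₀ := p₀) (β := β) hk hR hζs hζ01 hζ1 hζ0
  have hIA := integral_Ioi_eq_intervalIntegral
    (g := fun r => (p₀ + β * r ^ k) * deriv ζ r ^ 2) hR fun r h => by
      simp [deriv_eq_zero_of_eq_zero hζ01 (hζ0 r h.le)]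
  have hID := integral_Ioi_eq_intervalIntegral
    (g := fun r => ζ r ^ 2 * r ^ (k - 2)) hR fun r h => by simp [hζ0 r h.le]
  have hIC : ∫ r in Set.Ioi (0 : ℝ), (p₀ * ((ζ r ^ 2 - 1) / r ^ 2) +
      β * (ζ r ^ 2 * r ^ (k - 2))) = p₀ * (∫ r in Set.Ioi (0 : ℝ), (ζ r ^ 2 - 1) / r ^ 2) +
      β * ∫ r in Set.Ioi (0 : ℝ), ζ r ^ 2 * r ^ (k - 2) := by
    rw [integral_add hC1 hC2, integral_const_mul, integral_const_mul]
  rw [isLittleO_one_iff]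
  have hlim0 := hlim.sub_const (ω₃ * (∫ r in (0 : ℝ)..R, (p₀ + β * r ^ k) * (deriv ζ r) ^ 2) +
    k * β * ω₃ * ∫ r in (0 : ℝ)..R, (ζ r) ^ 2 * r ^ (k - 2))
  refine (hlim0.congr' ?_).trans_eq ?_
  · filter_upwards [self_mem_nhdsWithin] with ε hε
    have hε0 : 0 < ε := hε
    have hs1 := integrable_weight_pow_mul hε0 1 hA
    have hs2 := integrable_weight_pow_mul hε0 2 hB
    have hs3 := integrable_weight_pow_mul hε0 3 hC
    have hs4 := (integrableOn_pow_four_div hε0).const_mul p₀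
    rw [integral_energy_eq_radial hΩo hp hball hζs hζ01 hζ0 hε0,
      setIntegral_congr_fun measurableSet_Ioi
        (fun r hr => radial_energy_density_eq (ζ := ζ) (deriv ζ r) hε0 hr),
      integral_add ((hs1.fun_add hs2).fun_add hs3) hs4, integral_add (hs1.fun_add hs2) hs3,
      integral_add hs1 hs2, integral_const_mul, integral_pow_four_div hε0, hK, hω]
    ring
  · rw [hIC, ← hIA, ← hID]
    congr 1
    linear_combination ω₃ * hparts
end
end
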